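/- For k ≥ 4 let Γ = ⟨γ⟩ be cyclic of order k, identified with ℤ_k via γ ↦ 1. Let (G,ψ) be a Γ-gain graph with a free vertex v of degree 3 and no loop, and suppose (G,ψ) is ℤ_k^j-gain tight for some 2 ≤ j ≤ k−2. If there is no admissible 1-reduction at v, then k is even, j is odd, v has exactly two distinct neighbours of which exactly one is free (call it v₁), and the 2-cycle formed by the two edges between v and v₁ has gain γ^{k/2}. -/

import Mathlib

open scoped Classical

namespace GR

/-- A finite directed multigraph with edge labels ("gains") in a group `Γ` and a
designated finite set of fixed vertices. -/
structure GainedGraph (V E Γ : Type) where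
  tail : E → V
  head : E → V
  gain : E → Γ
  fixed : Finset V

variable {V E Γ : Type} [DecidableEq V] [DecidableEq E] [Fintype V] [Fintype E] [Group Γ]

/-- A subgraph: a set of vertices and a set of edges whose endpoints lie in the vertex set. -/
structure Subgraph (G : GainedGraph V E Γ) where
  verts : Finset V
  edges : Finset E
  tail_mem : ∀ e ∈ edges, G.tail e ∈ verts
  head_mem : ∀ e ∈ edges, G.head e ∈ verts

namespace Subgraph

variable {G : GainedGraph V E Γ}

instance : Top (Subgraph G) :=
  ⟨⟨Finset.univ, Finset.univ, fun _ _ => Finset.mem_univ _, fun _ _ => Finset.mem_univ _⟩⟩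

instance : LE (Subgraph G) :=
  ⟨fun H K => H.verts ⊆ K.verts ∧ H.edges ⊆ K.edges⟩

def union (H K : Subgraph G) : Subgraph G where
  verts := H.verts ∪ K.verts
  edges := H.edges ∪ K.edges
  tail_mem e he := by
    rcases Finset.mem_union.1 he with h | h
    · exact Finset.mem_union_left _ (H.tail_mem e h)
    · exact Finset.mem_union_right _ (K.tail_mem e h)
  head_mem e he := by
    rcases Finset.mem_union.1 he with h | h
    · exact Finset.mem_union_left _ (H.head_mem e h)
    · exact Finset.mem_union_right _ (K.head_mem e h)

def inter (H K : Subgraph G) : Subgraph G where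
  verts := H.verts ∩ K.verts
  edges := H.edges ∩ K.edges
  tail_mem e he := by
    rcases Finset.mem_inter.1 he with ⟨h1, h2⟩
    exact Finset.mem_inter.2 ⟨H.tail_mem e h1, K.tail_mem e h2⟩
  head_mem e he := by
    rcases Finset.mem_inter.1 he with ⟨h1, h2⟩
    exact Finset.mem_inter.2 ⟨H.head_mem e h1, K.head_mem e h2⟩

/-- Delete a vertex together with all edges incident to it. -/
def deleteVertex (H : Subgraph G) (v : V) : Subgraph G where
  verts := H.verts.erase v
  edges := H.edges.filter fun e => G.tail e ≠ v ∧ G.head e ≠ v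
  tail_mem e he := by
    rcases Finset.mem_filter.1 he with ⟨h1, h2, h3⟩
    exact Finset.mem_erase.2 ⟨h2, H.tail_mem e h1⟩
  head_mem e he := by
    rcases Finset.mem_filter.1 he with ⟨h1, h2, h3⟩
    exact Finset.mem_erase.2 ⟨h3, H.head_mem e h1⟩

/-- Delete an edge. -/
def deleteEdge (H : Subgraph G) (f : E) : Subgraph G where
  verts := H.verts
  edges := H.edges.erase f
  tail_mem e he := H.tail_mem e (Finset.mem_of_mem_erase he)
  head_mem e he := H.head_mem e (Finset.mem_of_mem_erase he)

/-- Add an edge (together with its endpoints). -/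
def addEdge (H : Subgraph G) (f : E) : Subgraph G where
  verts := insert (G.tail f) (insert (G.head f) H.verts)
  edges := insert f H.edges
  tail_mem e he := by
    rcases Finset.mem_insert.1 he with rfl | h
    · exact Finset.mem_insert_self _ _
    · exact Finset.mem_insert_of_mem (Finset.mem_insert_of_mem (H.tail_mem e h))
  head_mem e he := by
    rcases Finset.mem_insert.1 he with rfl | h
    · exact Finset.mem_insert_of_mem (Finset.mem_insert_self _ _)
    · exact Finset.mem_insert_of_mem (Finset.mem_insert_of_mem (H.head_mem e h))

/-- The free vertices of a subgraph. -/
def freeVerts (H : Subgraph G) : Finset V := H.verts \ G.fixed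

/-- The fixed vertices of a subgraph. -/
def fixedVerts (H : Subgraph G) : Finset V := H.verts ∩ G.fixed

end Subgraph

/-- The starting vertex of an oriented traversal of an edge. -/
def stepStart (G : GainedGraph V E Γ) (s : E × Bool) : V :=
  if s.2 then G.tail s.1 else G.head s.1

/-- The ending vertex of an oriented traversal of an edge. -/
def stepEnd (G : GainedGraph V E Γ) (s : E × Bool) : V :=
  if s.2 then G.head s.1 else G.tail s.1

/-- The gain contributed by an oriented traversal of an edge. -/
def stepGain (G : GainedGraph V E Γ) (s : E × Bool) : Γ :=
  if s.2 then G.gain s.1 else (G.gain s.1)⁻¹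

/-- `IsWalk G H L u w` : `L` is a walk in the subgraph `H` from `u` to `w`. -/
def IsWalk (G : GainedGraph V E Γ) (H : Subgraph G) : List (E × Bool) → V → V → Prop
  | [], u, w => u = w ∧ u ∈ H.verts
  | s :: L, u, w => s.1 ∈ H.edges ∧ stepStart G s = u ∧ IsWalk G H L (stepEnd G s) w

/-- The gain of a walk. -/
def walkGain (G : GainedGraph V E Γ) (L : List (E × Bool)) : Γ :=
  (L.map (stepGain G)).prod

/-- The vertices visited by a walk starting at `u`. -/
def walkVerts (G : GainedGraph V E Γ) (u : V) (L : List (E × Bool)) : List V :=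
  u :: L.map (stepEnd G)

/-- `⟨H⟩` : the subgroup of `Γ` generated by the gains of all closed walks in `H`
containing no fixed vertex. -/
def gainGroup (G : GainedGraph V E Γ) (H : Subgraph G) : Subgroup Γ :=
  Subgroup.closure
    {g | ∃ u L, IsWalk G H L u u ∧ (∀ x ∈ walkVerts G u L, x ∉ G.fixed) ∧ walkGain G L = g}

/-- A subgraph is balanced if its gain group is trivial. -/
def Balanced (G : GainedGraph V E Γ) (H : Subgraph G) : Prop := gainGroup G H = ⊥

def Reachable (G : GainedGraph V E Γ) (H : Subgraph G) (u w : V) : Prop :=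
  ∃ L, IsWalk G H L u w

def Connected (G : GainedGraph V E Γ) (H : Subgraph G) : Prop :=
  H.verts.Nonempty ∧ ∀ u ∈ H.verts, ∀ w ∈ H.verts, Reachable G H u w

/-- `v` is a cut-vertex of the subgraph `H`. -/
def IsCutVertex (G : GainedGraph V E Γ) (H : Subgraph G) (v : V) : Prop :=
  v ∈ H.verts ∧ ∃ u ∈ H.verts, ∃ w ∈ H.verts, u ≠ v ∧ w ≠ v ∧
    Reachable G H u w ∧ ¬ Reachable G (H.deleteVertex v) u w

/-- `(2,m,l)`-sparsity of the subgraph `K`. -/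
def Sparse (G : GainedGraph V E Γ) (m l : ℤ) (K : Subgraph G) : Prop :=
  ∀ H : Subgraph G, H ≤ K → H.edges.Nonempty →
    (H.edges.card : ℤ) ≤ 2 * (H.freeVerts.card : ℤ) + m * (H.fixedVerts.card : ℤ) - l

/-- `(2,m,l)`-tightness of the subgraph `K`. -/
def Tight (G : GainedGraph V E Γ) (m l : ℤ) (K : Subgraph G) : Prop :=
  Sparse G m l K ∧
    (K.edges.card : ℤ) = 2 * (K.freeVerts.card : ℤ) + m * (K.fixedVerts.card : ℤ) - l

/-- `(2,m,3,l)`-gain-tightness: `(2,m,l)`-tight and every balanced subgraph with a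
nonempty edge set is `(2,3)`-sparse. -/
def GainTight23 (G : GainedGraph V E Γ) (m l : ℤ) (K : Subgraph G) : Prop :=
  Tight G m l K ∧ ∀ H : Subgraph G, H ≤ K → H.edges.Nonempty → Balanced G H →
    (H.edges.card : ℤ) ≤ 2 * (H.verts.card : ℤ) - 3

/-- The subgraph has no fixed vertex. -/
def NoFixed (G : GainedGraph V E Γ) (H : Subgraph G) : Prop :=
  ∀ x ∈ H.verts, x ∉ G.fixed

/-- Near-balanced with base vertex `v` and gain `δ`: unbalanced, and every closed
walk starting at `v` not containing `v` as an internal vertex has gain `1`, `δ` or `δ⁻¹`. -/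
def NearBalancedAt (G : GainedGraph V E Γ) (H : Subgraph G) (v : V) (δ : Γ) : Prop :=
  ¬ Balanced G H ∧ ∀ L, IsWalk G H L v v →
    (∀ x ∈ (L.map (stepEnd G)).dropLast, x ≠ v) → walkGain G L ∈ ({1, δ, δ⁻¹} : Set Γ)

def NearBalanced (G : GainedGraph V E Γ) (H : Subgraph G) : Prop :=
  NoFixed G H ∧ ∃ v ∈ H.verts, ∃ δ : Γ, NearBalancedAt G H v δ

/-- The gain group of `H` is isomorphic to `ℤ_n`. -/
def IsZIso (G : GainedGraph V E Γ) (H : Subgraph G) (n : ℕ) : Prop :=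
  Nonempty (gainGroup G H ≃* Multiplicative (ZMod n))

def ProperNearBalanced (G : GainedGraph V E Γ) (H : Subgraph G) : Prop :=
  NearBalanced G H ∧ ¬ IsZIso G H 2 ∧ ¬ IsZIso G H 3

/-- The set `S_i(k,j)`. -/
def SSet (k j : ℕ) (i : ℤ) : Set ℕ :=
  {n | 2 ≤ n ∧ n ∣ k ∧ (Odd j → n ≠ 2) ∧ ((j : ZMod n) = (i : ZMod n))}

/-- `H` is `S_i(k,j)`. -/
def IsS (G : GainedGraph V E Γ) (k j : ℕ) (i : ℤ) (H : Subgraph G) : Prop :=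
  ∃ n ∈ SSet k j i, IsZIso G H n

/-- `H` is `S_{±1}(k,j)`. -/
def IsSpm (G : GainedGraph V E Γ) (k j : ℕ) (H : Subgraph G) : Prop :=
  IsS G k j (-1) H ∨ IsS G k j 1 H

/-- The function `α_k^j` on (connected) subgraphs. -/
noncomputable def alpha (G : GainedGraph V E Γ) (k j : ℕ) (X : Subgraph G) : ℤ :=
  if Balanced G X then 0
  else if Odd j ∧ IsZIso G X 2 then 1
  else if IsSpm G k j X then 2 - (X.fixedVerts.card : ℤ)
  else if IsS G k j 0 X ∨ (X.fixedVerts.card = 0 ∧ ProperNearBalanced G X) then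
    2 - 2 * (X.fixedVerts.card : ℤ)
  else 3 - 2 * (X.fixedVerts.card : ℤ)

/-- The subgraph spanned by a set of edges. -/
def edgeSpan (G : GainedGraph V E Γ) (F : Finset E) : Subgraph G where
  verts := F.image G.tail ∪ F.image G.head
  edges := F
  tail_mem e he := Finset.mem_union_left _ (Finset.mem_image_of_mem _ he)
  head_mem e he := Finset.mem_union_right _ (Finset.mem_image_of_mem _ he)

/-- The connected component of the edge `e` in the subgraph spanned by `F`. -/
noncomputable def componentOf (G : GainedGraph V E Γ) (F : Finset E) (e : E) : Subgraph G :=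
  edgeSpan G (F.filter fun f => Reachable G (edgeSpan G F) (G.tail e) (G.tail f))

/-- The connected components of the edge set `F`. -/
noncomputable def components (G : GainedGraph V E Γ) (F : Finset E) : Finset (Subgraph G) :=
  F.image (componentOf G F)

/-- The count `f_k^j(F) = Σ_{X ∈ C(F)} (2|V(X)| − 3 + α_k^j(X))`. -/
noncomputable def fCount (G : GainedGraph V E Γ) (k j : ℕ) (F : Finset E) : ℤ :=
  ∑ X ∈ components G F, (2 * (X.verts.card : ℤ) - 3 + alpha G k j X)

/-- `ℤ_k^j`-gain sparsity. -/
def GainSparseKJ (G : GainedGraph V E Γ) (k j : ℕ) (K : Subgraph G) : Prop :=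
  ∀ H : Subgraph G, H ≤ K → H.edges.Nonempty → (H.edges.card : ℤ) ≤ fCount G k j H.edges

/-- `ℤ_k^j`-gain tightness. -/
def GainTightKJ (G : GainedGraph V E Γ) (k j : ℕ) (K : Subgraph G) : Prop :=
  GainSparseKJ G k j K ∧ (K.edges.card : ℤ) = fCount G k j K.edges

/-- The degree of a vertex in a subgraph (a loop counts twice). -/
def degree (G : GainedGraph V E Γ) (K : Subgraph G) (v : V) : ℕ :=
  (K.edges.filter fun e => G.tail e = v).card + (K.edges.filter fun e => G.head e = v).card

def HasLoopAt (G : GainedGraph V E Γ) (K : Subgraph G) (v : V) : Prop :=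
  ∃ e ∈ K.edges, G.tail e = v ∧ G.head e = v

/-- The neighbours of a vertex in a subgraph. -/
def neighbors (G : GainedGraph V E Γ) (K : Subgraph G) (v : V) : Finset V :=
  ((K.edges.filter fun e => G.tail e = v).image G.head) ∪
    ((K.edges.filter fun e => G.head e = v).image G.tail)

/-- The subgraph `K` satisfies the axioms of a `Γ`-gain graph. -/
structure IsGainGraphOn (G : GainedGraph V E Γ) (K : Subgraph G) : Prop where
  fixed_card : K.fixedVerts.card ≤ 1
  same_dir : ∀ e ∈ K.edges, ∀ f ∈ K.edges, e ≠ f → G.tail e = G.tail f →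
    G.head e = G.head f → G.gain e ≠ G.gain f
  opp_dir : ∀ e ∈ K.edges, ∀ f ∈ K.edges, e ≠ f → G.tail e = G.head f →
    G.head e = G.tail f → G.gain e ≠ (G.gain f)⁻¹
  fixed_not_loop : ∀ e ∈ K.edges, G.tail e = G.head e → G.tail e ∉ G.fixed
  fixed_not_parallel : ∀ e ∈ K.edges, ∀ f ∈ K.edges, e ≠ f →
    (G.tail e ∈ G.fixed ∨ G.head e ∈ G.fixed) →
    ({G.tail e, G.head e} : Finset V) ≠ {G.tail f, G.head f}
  loop_gain : ∀ e ∈ K.edges, G.tail e = G.head e → G.gain e ≠ 1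

/-- `H` together with the vertex `v` and all edges of `G₀` incident to `v`. -/
def addVertexEdges (G : GainedGraph V E Γ) (G₀ H : Subgraph G) (v : V) : Subgraph G where
  verts := (H.verts ∪ {v}) ∪
    ((G₀.edges.filter fun e => G.tail e = v ∨ G.head e = v).image G.tail ∪
      (G₀.edges.filter fun e => G.tail e = v ∨ G.head e = v).image G.head)
  edges := H.edges ∪ G₀.edges.filter fun e => G.tail e = v ∨ G.head e = v
  tail_mem e he := by
    rcases Finset.mem_union.1 he with h | h
    · exact Finset.mem_union_left _ (Finset.mem_union_left _ (H.tail_mem e h))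
    · exact Finset.mem_union_right _ (Finset.mem_union_left _ (Finset.mem_image_of_mem _ h))
  head_mem e he := by
    rcases Finset.mem_union.1 he with h | h
    · exact Finset.mem_union_left _ (Finset.mem_union_left _ (H.head_mem e h))
    · exact Finset.mem_union_right _ (Finset.mem_union_right _ (Finset.mem_image_of_mem _ h))

/-- The result of a 1-reduction at `v` adding the edge `f`: delete `v` and all edges at
`v` and add the edge `f`. -/
def reduceAt (G : GainedGraph V E Γ) (G₀ : Subgraph G) (v : V) (f : E) : Subgraph G where
  verts := insert (G.tail f) (insert (G.head f) (G₀.verts.erase v))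
  edges := insert f (G₀.edges.filter fun e => G.tail e ≠ v ∧ G.head e ≠ v)
  tail_mem e he := by
    rcases Finset.mem_insert.1 he with rfl | h
    · exact Finset.mem_insert_self _ _
    · rcases Finset.mem_filter.1 h with ⟨h1, h2, h3⟩
      exact Finset.mem_insert_of_mem
        (Finset.mem_insert_of_mem (Finset.mem_erase.2 ⟨h2, G₀.tail_mem e h1⟩))
  head_mem e he := by
    rcases Finset.mem_insert.1 he with rfl | h
    · exact Finset.mem_insert_of_mem (Finset.mem_insert_self _ _)
    · rcases Finset.mem_filter.1 h with ⟨h1, h2, h3⟩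
      exact Finset.mem_insert_of_mem
        (Finset.mem_insert_of_mem (Finset.mem_erase.2 ⟨h3, G₀.head_mem e h1⟩))

/-- The new edge `f` arises from a 1-reduction at the vertex `v` of `G₀`: its endpoints are
joined to `v` by two distinct edges of `G₀` and its gain is the gain of the corresponding
path of length two through `v`. -/
def IsOneReduction (G : GainedGraph V E Γ) (G₀ : Subgraph G) (v : V) (f : E) : Prop :=
  f ∉ G₀.edges ∧ G.tail f ≠ v ∧ G.head f ≠ v ∧
    ∃ s₁ s₂ : E × Bool, s₁.1 ∈ G₀.edges ∧ s₂.1 ∈ G₀.edges ∧ s₁.1 ≠ s₂.1 ∧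
      stepEnd G s₁ = v ∧ stepStart G s₂ = v ∧
      G.tail f = stepStart G s₁ ∧ G.head f = stepEnd G s₂ ∧
      G.gain f = stepGain G s₁ * stepGain G s₂

/-- Two labelled edges coincide (up to reorientation with gain inversion). -/
def SameEdge (G : GainedGraph V E Γ) (e f : E) : Prop :=
  (G.tail e = G.tail f ∧ G.head e = G.head f ∧ G.gain e = G.gain f) ∨
    (G.tail e = G.head f ∧ G.head e = G.tail f ∧ G.gain e = (G.gain f)⁻¹)

/-- `H` is a blocker of the 1-reduction at `v` adding the edge `f`. -/
def IsBlocker (G : GainedGraph V E Γ) (k j : ℕ) (G₀ : Subgraph G) (v : V) (f : E)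
    (H : Subgraph G) : Prop :=
  H ≤ G₀ ∧ v ∉ H.verts ∧ G.tail f ∈ H.verts ∧ G.head f ∈ H.verts ∧ H.edges.Nonempty ∧
    Connected G (H.addEdge f) ∧
    (H.edges.card : ℤ) = 2 * (H.verts.card : ℤ) - 3 + alpha G k j (H.addEdge f)

/-- The graph `G` extended by one fresh edge `none` with tail `t`, head `h` and gain `g`. -/
def extendGraph (G : GainedGraph V E Γ) (t h : V) (g : Γ) : GainedGraph V (Option E) Γ where
  tail e := e.elim t G.tail
  head e := e.elim h G.head
  gain e := e.elim g G.gain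
  fixed := G.fixed

/-- The whole original graph `G`, viewed inside the extension. -/
def extendTop (G : GainedGraph V E Γ) (t h : V) (g : Γ) : Subgraph (extendGraph G t h g) where
  verts := Finset.univ
  edges := Finset.univ.image Option.some
  tail_mem _ _ := Finset.mem_univ _
  head_mem _ _ := Finset.mem_univ _

/-- There is an admissible 1-reduction at `v`, i.e. a choice of new edge (with
endpoints and gain coming from a path of length two through `v`) such that the
resulting `Γ`-gain graph is well defined and `ℤ_k^j`-gain tight. -/
def AdmissibleOneReductionExists (G : GainedGraph V E Γ) (k j : ℕ) (v : V) : Prop :=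
  ∃ t h : V, ∃ g : Γ,
    IsOneReduction (extendGraph G t h g) (extendTop G t h g) v none ∧
    IsGainGraphOn (extendGraph G t h g)
      (reduceAt (extendGraph G t h g) (extendTop G t h g) v none) ∧
    GainTightKJ (extendGraph G t h g) k j
      (reduceAt (extendGraph G t h g) (extendTop G t h g) v none)

end GR

namespace GR

/-- A labelled edge: tail, head and gain. -/
abbrev LEdge (V : Type) (k : ℕ) : Type := V × V × ZMod k

namespace LEdge

variable {V : Type} {k : ℕ}

/-- The gain of `e` after switching by the potential `p`. -/
def defect (p : V → ZMod k) (e : LEdge V k) : ZMod k := e.2.2 - (p e.2.1 - p e.1)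

/-- The edge traversed backwards. -/
def rev (e : LEdge V k) : LEdge V k := (e.2.1, e.1, -e.2.2)

/-- After switching by `p`, the edge `e` has trivial gain unless it meets `u`, and leaves `u`
with gain `0` or `δ` otherwise. -/
def NearE (u : V) (δ : ZMod k) (p : V → ZMod k) (e : LEdge V k) : Prop :=
  (e.1 ≠ u → e.2.1 ≠ u → defect p e = 0) ∧
  (e.1 = u → e.2.1 ≠ u → defect p e = 0 ∨ defect p e = δ) ∧
  (e.1 ≠ u → e.2.1 = u → defect p e = 0 ∨ defect p e = -δ) ∧
  (e.1 = u → e.2.1 = u → e.2.2 = 0 ∨ e.2.2 = δ ∨ e.2.2 = -δ)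

/-- `p` is a potential for `m` times the gain of `e`, unless `e` meets `Φ`. -/
def BalE (Φ : Finset V) (m : ZMod k) (p : V → ZMod k) (e : LEdge V k) : Prop :=
  e.1 ∉ Φ → e.2.1 ∉ Φ → m * e.2.2 = p e.2.1 - p e.1

/-- No trivial loop and no edge inside `Φ`. -/
def Good (Φ : Finset V) (e : LEdge V k) : Prop :=
  (e.1 = e.2.1 → e.2.2 ≠ 0) ∧ (e.1 ∉ Φ ∨ e.2.1 ∉ Φ)

theorem defect_rev (p : V → ZMod k) (e : LEdge V k) : defect p e.rev = -defect p e := by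
  simp only [defect, rev]; ring

theorem nearE_rev {u : V} {δ : ZMod k} {p : V → ZMod k} {e : LEdge V k}
    (h : NearE u δ p e) : NearE u δ p e.rev := by
  obtain ⟨h1, h2, h3, h4⟩ := h
  refine ⟨fun a b => ?_, fun a b => ?_, fun a b => ?_, fun a b => ?_⟩
  · rw [defect_rev, h1 b a, neg_zero]
  · rw [defect_rev]
    rcases h3 b a with h | h <;> simp [h]
  · rw [defect_rev]
    rcases h2 b a with h | h <;> simp [h]
  · rcases h4 b a with h | h | h <;> simp [rev, h]

theorem balE_rev {Φ : Finset V} {m : ZMod k} {p : V → ZMod k} {e : LEdge V k}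
    (h : BalE Φ m p e) : BalE Φ m p e.rev := by
  intro a b
  have := h b a
  simp only [rev]
  linear_combination -this

theorem rev_rev (e : LEdge V k) : e.rev.rev = e := by simp [rev]

end LEdge

open LEdge
set_option linter.unusedSectionVars false

section Count

variable {V : Type} [DecidableEq V] {k : ℕ} (Φ : Finset V) (j : ℕ)

def Bal (m : ZMod k) (X : Finset (LEdge V k)) : Prop := ∃ p, ∀ e ∈ X, BalE Φ m p e

def Touches (X : Finset (LEdge V k)) : Prop := ∃ e ∈ X, e.1 ∈ Φ ∨ e.2.1 ∈ Φ

def Near (u : V) (δ : ZMod k) (X : Finset (LEdge V k)) : Prop := ∃ p, ∀ e ∈ X, NearE u δ p e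

/-- Indicator of `Bal`. -/
noncomputable def balInd (m : ZMod k) (X : Finset (LEdge V k)) : ℤ := if Bal Φ m X then 1 else 0

noncomputable def balSum (X : Finset (LEdge V k)) : ℤ :=
  balInd Φ ((j : ZMod k) - 1) X + balInd Φ (j : ZMod k) X + balInd Φ ((j : ZMod k) + 1) X

/-- The number of degrees of freedom left by the edges of `X` to a rigid body. -/
noncomputable def dof (X : Finset (LEdge V k)) : ℤ :=
  if Touches Φ X then balInd Φ (j : ZMod k) X
  else max (balSum Φ j X) (if ∃ u δ, Near u δ X then 1 else 0)

noncomputable def freeEnds (X : Finset (LEdge V k)) : Finset V :=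
  (X.image (fun e => e.1) ∪ X.image (fun e => e.2.1)) \ Φ

noncomputable def cnt (X : Finset (LEdge V k)) : ℤ := 2 * ((freeEnds Φ X).card : ℤ) - dof Φ j X

def Indep (I : Finset (LEdge V k)) : Prop :=
  ∀ H ⊆ I, H.Nonempty → (H.card : ℤ) ≤ cnt Φ j H

variable {Φ j} {X Y A B C I : Finset (LEdge V k)} {m : ZMod k}

theorem mem_freeEnds {x : V} :
    x ∈ freeEnds Φ X ↔ x ∉ Φ ∧ ∃ e ∈ X, e.1 = x ∨ e.2.1 = x := by
  simp only [freeEnds, Finset.mem_sdiff, Finset.mem_union, Finset.mem_image]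
  constructor
  · rintro ⟨⟨e, he, h⟩ | ⟨e, he, h⟩, h2⟩
    · exact ⟨h2, e, he, Or.inl h⟩
    · exact ⟨h2, e, he, Or.inr h⟩
  · rintro ⟨h2, e, he, h | h⟩
    · exact ⟨Or.inl ⟨e, he, h⟩, h2⟩
    · exact ⟨Or.inr ⟨e, he, h⟩, h2⟩

theorem tail_mem_freeEnds {e : LEdge V k} (he : e ∈ X) (h : e.1 ∉ Φ) : e.1 ∈ freeEnds Φ X :=
  mem_freeEnds.2 ⟨h, e, he, Or.inl rfl⟩

theorem head_mem_freeEnds {e : LEdge V k} (he : e ∈ X) (h : e.2.1 ∉ Φ) :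
    e.2.1 ∈ freeEnds Φ X :=
  mem_freeEnds.2 ⟨h, e, he, Or.inr rfl⟩

theorem Bal.mono (h : Bal Φ m Y) (hXY : X ⊆ Y) : Bal Φ m X :=
  h.imp fun _ hp e he => hp e (hXY he)

theorem Touches.mono (h : Touches Φ X) (hXY : X ⊆ Y) : Touches Φ Y :=
  h.imp fun _ he => ⟨hXY he.1, he.2⟩

theorem freeEnds_mono (hXY : X ⊆ Y) : freeEnds Φ X ⊆ freeEnds Φ Y := fun x hx => by
  rw [mem_freeEnds] at hx ⊢
  exact ⟨hx.1, hx.2.imp fun _ he => ⟨hXY he.1, he.2⟩⟩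

theorem freeEnds_union : freeEnds Φ (A ∪ B) = freeEnds Φ A ∪ freeEnds Φ B := by
  ext x
  simp only [Finset.mem_union, mem_freeEnds]
  constructor
  · rintro ⟨h, e, he | he, h'⟩
    · exact Or.inl ⟨h, e, he, h'⟩
    · exact Or.inr ⟨h, e, he, h'⟩
  · rintro (⟨h, e, he, h'⟩ | ⟨h, e, he, h'⟩)
    · exact ⟨h, e, Or.inl he, h'⟩
    · exact ⟨h, e, Or.inr he, h'⟩

theorem balInd_nonneg : 0 ≤ balInd Φ m X := by unfold balInd; split_ifs <;> norm_num

theorem balInd_le_one : balInd Φ m X ≤ 1 := by unfold balInd; split_ifs <;> norm_num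

theorem balInd_of (h : Bal Φ m X) : balInd Φ m X = 1 := if_pos h

theorem balInd_of_not (h : ¬ Bal Φ m X) : balInd Φ m X = 0 := if_neg h

theorem balInd_anti (hXY : X ⊆ Y) : balInd Φ m Y ≤ balInd Φ m X := by
  by_cases h : Bal Φ m Y
  · rw [balInd_of h, balInd_of (h.mono hXY)]
  · rw [balInd_of_not h]; exact balInd_nonneg

theorem balSum_nonneg : 0 ≤ balSum Φ j X := by
  have h1 := @balInd_nonneg V _ k Φ X
  unfold balSum
  have := h1 (m := (j : ZMod k) - 1)
  have := h1 (m := (j : ZMod k))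
  have := h1 (m := (j : ZMod k) + 1)
  omega

theorem balSum_le_three : balSum Φ j X ≤ 3 := by
  have h1 := @balInd_le_one V _ k Φ X
  unfold balSum
  have := h1 (m := (j : ZMod k) - 1)
  have := h1 (m := (j : ZMod k))
  have := h1 (m := (j : ZMod k) + 1)
  omega

theorem balSum_anti (hXY : X ⊆ Y) : balSum Φ j Y ≤ balSum Φ j X := by
  unfold balSum
  have h1 := @balInd_anti V _ k Φ X Y
  have := h1 (m := (j : ZMod k) - 1) hXY
  have := h1 (m := (j : ZMod k)) hXY
  have := h1 (m := (j : ZMod k) + 1) hXY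
  omega

theorem balInd_le_balSum : balInd Φ (j : ZMod k) X ≤ balSum Φ j X := by
  unfold balSum
  have h1 := @balInd_nonneg V _ k Φ X
  have := h1 (m := (j : ZMod k) - 1)
  have := h1 (m := (j : ZMod k) + 1)
  omega

theorem dof_of_touches (h : Touches Φ X) : dof Φ j X = balInd Φ (j : ZMod k) X := if_pos h

theorem balSum_le_dof (h : ¬ Touches Φ X) : balSum Φ j X ≤ dof Φ j X := by
  rw [dof, if_neg h]; exact le_max_left _ _

theorem one_le_dof_of_near (h : ¬ Touches Φ X) {u : V} {δ : ZMod k} (hn : Near u δ X) :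
    1 ≤ dof Φ j X := by
  rw [dof, if_neg h, if_pos ⟨u, δ, hn⟩]; exact le_max_right _ _

theorem balInd_le_dof : balInd Φ (j : ZMod k) X ≤ dof Φ j X := by
  by_cases h : Touches Φ X
  · exact (dof_of_touches h).ge
  · exact balInd_le_balSum.trans (balSum_le_dof h)

theorem dof_nonneg : 0 ≤ dof Φ j X := balInd_nonneg.trans balInd_le_dof

theorem dof_le_three : dof Φ j X ≤ 3 := by
  unfold dof
  have := @balInd_le_one V _ k Φ X (j : ZMod k)
  have := @balSum_le_three V _ k Φ j X
  split_ifs <;> omega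

theorem dof_le_one_of_touches (h : Touches Φ X) : dof Φ j X ≤ 1 := by
  rw [dof_of_touches h]; exact balInd_le_one

theorem dof_anti (hXY : X ⊆ Y) : dof Φ j Y ≤ dof Φ j X := by
  by_cases hX : Touches Φ X
  · rw [dof_of_touches hX, dof_of_touches (hX.mono hXY)]; exact balInd_anti hXY
  · by_cases hY : Touches Φ Y
    · rw [dof_of_touches hY]; exact (balInd_anti hXY).trans balInd_le_dof
    · have h1 := balSum_le_dof (j := j) hX
      have h2 := balSum_anti (j := j) (Φ := Φ) hXY
      have h3 := @dof_nonneg V _ k Φ j X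
      have h4 : (if ∃ u δ, Near u δ Y then (1 : ℤ) else 0) ≤ dof Φ j X := by
        split_ifs with h
        · obtain ⟨u, δ, p, hp⟩ := h
          exact one_le_dof_of_near hX ⟨p, fun e he => hp e (hXY he)⟩
        · exact h3
      conv_lhs => rw [dof, if_neg hY]
      exact max_le (h2.trans h1) h4

theorem cnt_mono (hXY : X ⊆ Y) : cnt Φ j X ≤ cnt Φ j Y := by
  unfold cnt
  have := dof_anti (Φ := Φ) (j := j) hXY
  have := Finset.card_le_card (freeEnds_mono (Φ := Φ) hXY)
  omega

theorem Indep.mono (h : Indep Φ j Y) (hXY : X ⊆ Y) : Indep Φ j X :=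
  fun H hH => h H (hH.trans hXY)

theorem balInd_one_of_bal_one (h : Bal Φ 1 X) : balInd Φ m X = 1 := by
  obtain ⟨p, hp⟩ := h
  refine balInd_of ⟨fun x => m * p x, fun e he a b => ?_⟩
  have := hp e he a b
  linear_combination m * this

theorem balSum_of_bal_one (h : Bal Φ 1 X) : balSum Φ j X = 3 := by
  simp only [balSum, balInd_one_of_bal_one h]; norm_num

theorem dof_of_bal_one (ht : ¬ Touches Φ X) (h : Bal Φ 1 X) : dof Φ j X = 3 :=
  le_antisymm dof_le_three ((balSum_of_bal_one h).ge.trans (balSum_le_dof ht))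

theorem bal_of_balInd (h : balInd Φ m X ≠ 0) : Bal Φ m X := by
  by_contra h'; exact h (balInd_of_not h')

theorem bal_one_of_balSum (h : 3 ≤ balSum Φ j X) : Bal Φ 1 X := by
  unfold balSum at h
  have h1 := @balInd_le_one V _ k Φ X
  have a1 := h1 (m := (j : ZMod k) - 1)
  have a2 := h1 (m := (j : ZMod k))
  have a3 := h1 (m := (j : ZMod k) + 1)
  obtain ⟨p, hp⟩ := bal_of_balInd (Φ := Φ) (X := X) (m := (j : ZMod k) - 1) (by omega)
  obtain ⟨q, hq⟩ := bal_of_balInd (Φ := Φ) (X := X) (m := (j : ZMod k)) (by omega)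
  refine ⟨fun x => q x - p x, fun e he a b => ?_⟩
  have := hp e he a b
  have := hq e he a b
  linear_combination this - hp e he a b

theorem bal_one_of_dof (h : 3 ≤ dof Φ j X) : ¬ Touches Φ X ∧ Bal Φ 1 X := by
  have ht : ¬ Touches Φ X := fun ht => by
    have := dof_le_one_of_touches (j := j) ht
    omega
  refine ⟨ht, bal_one_of_balSum (j := j) ?_⟩
  rw [dof, if_neg ht] at h
  split_ifs at h <;> omega

theorem cnt_nonneg (hX : X.Nonempty) (hg : ∀ e ∈ X, Good Φ e) : 0 ≤ cnt Φ j X := by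
  unfold cnt
  have hd := @dof_le_three V _ k Φ j X
  obtain ⟨e, he⟩ := hX
  have hpos : 0 < (freeEnds Φ X).card := by
    rw [Finset.card_pos]
    rcases (hg e he).2 with h | h
    · exact ⟨_, tail_mem_freeEnds he h⟩
    · exact ⟨_, head_mem_freeEnds he h⟩
  by_contra! hlt
  have h1 : (freeEnds Φ X).card = 1 := by omega
  obtain ⟨ht, p, hp⟩ := bal_one_of_dof (Φ := Φ) (j := j) (X := X) (by omega)
  obtain ⟨x, hx⟩ := Finset.card_eq_one.1 h1
  have f1 : e.1 ∉ Φ := fun h => ht ⟨e, he, Or.inl h⟩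
  have f2 : e.2.1 ∉ Φ := fun h => ht ⟨e, he, Or.inr h⟩
  have e1 := tail_mem_freeEnds he f1
  have e2 := head_mem_freeEnds he f2
  rw [hx, Finset.mem_singleton] at e1 e2
  have := hp e he f1 f2
  rw [e1, e2] at this
  exact (hg e he).1 (e1.trans e2.symm) (by simpa using this)

theorem card_inter_le_cnt (hI : Indep Φ j I) (hX : X.Nonempty) (hg : ∀ e ∈ X, Good Φ e) :
    ((I ∩ X).card : ℤ) ≤ cnt Φ j X := by
  rcases (I ∩ X).eq_empty_or_nonempty with h | h
  · rw [h]; exact cnt_nonneg hX hg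
  · exact (hI _ Finset.inter_subset_left h).trans (cnt_mono Finset.inter_subset_right)

/-- Splitting an edge set into two parts meeting in few free vertices. -/
theorem card_le_of_split (hI : Indep Φ j I) (hIC : I ⊆ C) (hg : ∀ e ∈ C, Good Φ e)
    (P : LEdge V k → Prop) [DecidablePred P] (h1 : (C.filter P).Nonempty)
    (h2 : (C.filter fun e => ¬ P e).Nonempty) (T : Finset V)
    (hT : ∀ x ∈ freeEnds Φ (C.filter P), x ∈ freeEnds Φ (C.filter fun e => ¬ P e) → x ∈ T) :
    (I.card : ℤ) + dof Φ j (C.filter P) + dof Φ j (C.filter fun e => ¬ P e) ≤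
      2 * ((freeEnds Φ C).card : ℤ) + 2 * (T.card : ℤ) := by
  have a1 := card_inter_le_cnt hI h1 fun e he => hg e (Finset.mem_of_mem_filter e he)
  have a2 := card_inter_le_cnt hI h2 fun e he => hg e (Finset.mem_of_mem_filter e he)
  have hCU : C = C.filter P ∪ C.filter fun e => ¬ P e := (Finset.filter_union_filter_not_eq P C).symm
  have a3 : I.card ≤ (I ∩ C.filter P).card + (I ∩ C.filter fun e => ¬ P e).card := by
    refine le_trans (Finset.card_le_card fun e he => ?_) (Finset.card_union_le _ _)
    rw [← Finset.inter_union_distrib_left, ← hCU]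
    exact Finset.mem_inter.2 ⟨he, hIC he⟩
  have a4 := Finset.card_union_add_card_inter (freeEnds Φ (C.filter P))
    (freeEnds Φ (C.filter fun e => ¬ P e))
  rw [← freeEnds_union, ← hCU] at a4
  have a5 : (freeEnds Φ (C.filter P) ∩ freeEnds Φ (C.filter fun e => ¬ P e)).card ≤ T.card :=
    Finset.card_le_card fun x hx => hT x (Finset.mem_inter.1 hx).1 (Finset.mem_inter.1 hx).2
  unfold cnt at a1 a2
  omega

end Count

section Unions

variable {V : Type} [DecidableEq V] {k : ℕ} {Φ : Finset V} {j : ℕ} {X Y A B C I : Finset (LEdge V k)} {m : ZMod k}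

theorem free_of_not_touches (h : ¬ Touches Φ X) {e : LEdge V k} (he : e ∈ X) :
    e.1 ∉ Φ ∧ e.2.1 ∉ Φ :=
  ⟨fun h' => h ⟨e, he, Or.inl h'⟩, fun h' => h ⟨e, he, Or.inr h'⟩⟩

theorem Near.neg {u : V} {δ : ZMod k} (h : Near u δ X) : Near u (-δ) X := by
  obtain ⟨p, hp⟩ := h
  refine ⟨fun x => if x = u then p u - δ else p x, fun e he => ?_⟩
  obtain ⟨h1, h2, h3, h4⟩ := hp e he
  refine ⟨fun a b => ?_, fun a b => ?_, fun a b => ?_, fun a b => ?_⟩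
  · simpa [defect, a, b] using h1 a b
  · have : p e.1 = p u := by rw [a]
    rcases h2 a b with h | h <;> simp only [defect, if_pos a, if_neg b] at h ⊢
    · exact Or.inr (by linear_combination h - this)
    · exact Or.inl (by linear_combination h - this)
  · have : p e.2.1 = p u := by rw [b]
    rcases h3 a b with h | h <;> simp only [defect, if_pos b, if_neg a] at h ⊢
    · exact Or.inr (by linear_combination h + this)
    · exact Or.inl (by linear_combination h + this)
  · rcases h4 a b with h | h | h <;> simp [h]

/-- A near-balanced set whose pattern at the base vertex is determined by the far end of each
edge is balanced. -/
theorem bal_one_of_pattern {u : V} {p : V → ZMod k} (τ : V → ZMod k)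
    (h0 : ∀ e ∈ C, e.1 ≠ u → e.2.1 ≠ u → defect p e = 0 ∧ τ e.1 = τ e.2.1)
    (h1 : ∀ e ∈ C, e.1 = u → e.2.1 ≠ u → defect p e = τ e.2.1)
    (h2 : ∀ e ∈ C, e.1 ≠ u → e.2.1 = u → defect p e = -τ e.1)
    (h3 : ∀ e ∈ C, ¬ (e.1 = u ∧ e.2.1 = u)) : Bal Φ 1 C := by
  refine ⟨fun x => if x = u then p u else p x + τ x, fun e he _ _ => ?_⟩
  by_cases a : e.1 = u <;> by_cases b : e.2.1 = u
  · exact (h3 e he ⟨a, b⟩).elim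
  · have := h1 e he a b
    have h' : p e.1 = p u := by rw [a]
    simp only [defect, if_pos a, if_neg b] at this ⊢
    linear_combination this - h'
  · have := h2 e he a b
    have h' : p e.2.1 = p u := by rw [b]
    simp only [defect, if_pos b, if_neg a] at this ⊢
    linear_combination this + h'
  · obtain ⟨this, h'⟩ := h0 e he a b
    simp only [defect, if_neg a, if_neg b] at this ⊢
    linear_combination this + h'

theorem bal_of_near {u : V} {δ : ZMod k} (h : Near u δ X) (hm : m * δ = 0) : Bal Φ m X := by
  obtain ⟨p, hp⟩ := h
  refine ⟨fun x => m * p x, fun e he _ _ => ?_⟩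
  obtain ⟨h1, h2, h3, h4⟩ := hp e he
  by_cases a : e.1 = u <;> by_cases b : e.2.1 = u
  · rw [a, b, sub_self]
    rcases h4 a b with h | h | h <;> simp [h, hm]
  · rcases h2 a b with h | h <;> simp only [defect] at h
    · linear_combination m * h
    · linear_combination m * h + hm
  · rcases h3 a b with h | h <;> simp only [defect] at h
    · linear_combination m * h
    · linear_combination m * h - hm
  · have h := h1 a b
    simp only [defect] at h
    linear_combination m * h

/-- The label of an edge read off at an end different from `u`. -/
noncomputable def farLabel (u : V) (l : V → ZMod k) (e : LEdge V k) : ZMod k :=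
  if e.1 = u then l e.2.1 else l e.1

/-- Gluing a near-balanced set with a balanced or near-balanced one along compatible
potentials. -/
theorem near_union {u : V} {δ ℓ : ZMod k} {p q : V → ZMod k}
    (hA : ¬ Touches Φ A) (hB : ¬ Touches Φ B) (hp : ∀ e ∈ A, NearE u δ p e)
    (h0 : ∀ x ∈ freeEnds Φ A, x ∈ freeEnds Φ B → x ≠ u → p x - q x = ℓ)
    (hq : ∀ e ∈ B, NearE u δ (fun x => if x = u ∧ u ∈ freeEnds Φ A then p u - ℓ else q x) e) :
    Near u δ (A ∪ B) := by
  refine ⟨fun x => if x ∈ freeEnds Φ A then p x - ℓ else q x, fun e he => ?_⟩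
  rcases Finset.mem_union.1 he with he | he
  · have hf := free_of_not_touches hA he
    have e1 := tail_mem_freeEnds he hf.1
    have e2 := head_mem_freeEnds he hf.2
    have : ∀ r : V → ZMod k, r e.1 = p e.1 - ℓ → r e.2.1 = p e.2.1 - ℓ → NearE u δ r e := by
      intro r h1 h2
      have h3 : defect r e = defect p e := by simp only [defect, h1, h2]; ring
      simpa only [NearE, h3] using hp e he
    exact this _ (if_pos e1) (if_pos e2)
  · have hf := free_of_not_touches hB he
    have e1 := tail_mem_freeEnds he hf.1
    have e2 := head_mem_freeEnds he hf.2
    have key : ∀ x ∈ freeEnds Φ B, (if x ∈ freeEnds Φ A then p x - ℓ else q x) =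
        if x = u ∧ u ∈ freeEnds Φ A then p u - ℓ else q x := by
      intro x hx
      by_cases hxu : x = u
      · subst hxu; simp
      · by_cases hxA : x ∈ freeEnds Φ A
        · rw [if_pos hxA, if_neg (fun h => hxu h.1), ← h0 x hxA hx hxu]; ring
        · rw [if_neg hxA, if_neg (fun h => hxu h.1)]
    have h := hq e he
    simp only [NearE, defect] at h ⊢
    rw [key _ e1, key _ e2]
    exact h

theorem near_union_bal {u : V} {δ ℓ : ZMod k} {p q : V → ZMod k}
    (hA : ¬ Touches Φ A) (hB : ¬ Touches Φ B) (hp : ∀ e ∈ A, NearE u δ p e)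
    (hq : ∀ e ∈ B, defect q e = 0)
    (h0 : ∀ x ∈ freeEnds Φ A, x ∈ freeEnds Φ B → x ≠ u → p x - q x = ℓ)
    (hu : u ∈ freeEnds Φ A → u ∈ freeEnds Φ B → p u - q u - ℓ = 0 ∨ p u - q u - ℓ = δ) :
    Near u δ (A ∪ B) := by
  refine near_union hA hB hp h0 fun e he => ?_
  have hf := free_of_not_touches hB he
  have e1 := tail_mem_freeEnds he hf.1
  have e2 := head_mem_freeEnds he hf.2
  have hd := hq e he
  simp only [defect] at hd
  refine ⟨fun a b => ?_, fun a b => ?_, fun a b => ?_, fun a b => ?_⟩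
  · simpa [defect, a, b] using hd
  · by_cases huA : u ∈ freeEnds Φ A
    · have := hu huA (a ▸ e1)
      have h' : q e.1 = q u := by rw [a]
      simp only [defect, a, b, huA, and_true, if_true, if_false]
      refine this.imp (fun t => ?_) (fun t => ?_)
      · linear_combination t + hd - h'
      · linear_combination t + hd - h'
    · left; simpa [defect, huA] using hd
  · by_cases huA : u ∈ freeEnds Φ A
    · have := hu huA (b ▸ e2)
      have h' : q e.2.1 = q u := by rw [b]
      simp only [defect, a, b, huA, and_true, if_true, if_false]
      refine this.imp (fun t => ?_) (fun t => ?_)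
      · linear_combination -t + hd + h'
      · linear_combination -t + hd + h'
    · left; simpa [defect, huA] using hd
  · left; rw [a, b] at hd; simpa using hd

theorem defect_of_bal {q : V → ZMod k} (hB : ¬ Touches Φ B) (hq : ∀ e ∈ B, BalE Φ 1 q e) :
    ∀ e ∈ B, defect q e = 0 := fun e he => by
  have hf := free_of_not_touches hB he
  have := hq e he hf.1 hf.2
  simp only [defect]
  linear_combination this

/-- Any two nonempty complementary parts of `C` share a free vertex. -/
def Linked (Φ : Finset V) (C : Finset (LEdge V k)) : Prop :=
  ∀ (P : LEdge V k → Prop) [DecidablePred P], (C.filter P).Nonempty → (C.filter fun e => ¬ P e).Nonempty →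
    ∃ x ∈ freeEnds Φ (C.filter P), x ∈ freeEnds Φ (C.filter fun e => ¬ P e)

theorem Linked.const (hC : Linked Φ C) {l : V → ZMod k}
    (hl : ∀ e ∈ C, e.1 ∉ Φ → e.2.1 ∉ Φ → l e.1 = l e.2.1) :
    ∃ ℓ, ∀ x ∈ freeEnds Φ C, l x = ℓ := by
  rcases C.eq_empty_or_nonempty with rfl | ⟨e₀, he₀⟩
  · exact ⟨0, fun x hx => by simp [mem_freeEnds] at hx⟩
  let lab : LEdge V k → ZMod k := fun e => if e.1 ∉ Φ then l e.1 else l e.2.1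
  have hlab : ∀ e ∈ C, ∀ x ∉ Φ, e.1 = x ∨ e.2.1 = x → lab e = l x := by
    rintro e he x hx (rfl | rfl)
    · exact if_pos hx
    · by_cases h : e.1 ∈ Φ
      · exact if_neg (not_not.2 h)
      · exact (if_pos h).trans (hl e he h hx)
  refine ⟨lab e₀, ?_⟩
  by_contra! hne
  obtain ⟨x, hx, hxne⟩ := hne
  rw [mem_freeEnds] at hx
  obtain ⟨hxΦ, e, he, hex⟩ := hx
  obtain ⟨y, h1, h2⟩ := hC (fun e => lab e = lab e₀) ⟨e₀, by simp [he₀]⟩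
    ⟨e, by simp only [Finset.mem_filter]; exact ⟨he, by rwa [hlab e he x hxΦ hex]⟩⟩
  rw [mem_freeEnds] at h1 h2
  obtain ⟨hy, f, hf, hfy⟩ := h1
  obtain ⟨-, g, hg, hgy⟩ := h2
  rw [Finset.mem_filter] at hf hg
  exact hg.2 ((hlab g hg.1 y hy hgy).trans ((hlab f hf.1 y hy hfy).symm.trans hf.2))

theorem sub_const_of_bal {p q : V → ZMod k} (hA : ∀ e ∈ A, BalE Φ m p e) (hB : ∀ e ∈ B, BalE Φ m q e)
    (hC : Linked Φ (A ∩ B)) : ∃ ℓ, ∀ x ∈ freeEnds Φ (A ∩ B), p x - q x = ℓ := by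
  refine hC.const (l := fun x => p x - q x) fun e he a b => ?_
  have h1 := hA e (Finset.mem_inter.1 he).1 a b
  have h2 := hB e (Finset.mem_inter.1 he).2 a b
  linear_combination h1 - h2

theorem Bal.union (hA : Bal Φ m A) (hB : Bal Φ m B) (hC : Linked Φ (A ∩ B))
    (hW : freeEnds Φ A ∩ freeEnds Φ B ⊆ freeEnds Φ (A ∩ B)) : Bal Φ m (A ∪ B) := by
  obtain ⟨p, hp⟩ := hA
  obtain ⟨q, hq⟩ := hB
  obtain ⟨ℓ, hℓ⟩ := sub_const_of_bal hp hq hC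
  refine ⟨fun x => if x ∈ freeEnds Φ A then p x - ℓ else q x, fun e he a b => ?_⟩
  rcases Finset.mem_union.1 he with he | he
  · simp only [if_pos (tail_mem_freeEnds he a), if_pos (head_mem_freeEnds he b)]
    linear_combination hp e he a b
  · have key : ∀ x ∈ freeEnds Φ B, (if x ∈ freeEnds Φ A then p x - ℓ else q x) = q x := by
      intro x hx
      split_ifs with hxA
      · rw [← hℓ x (hW (Finset.mem_inter.2 ⟨hxA, hx⟩))]; ring
      · rfl
    simp only [key _ (tail_mem_freeEnds he a), key _ (head_mem_freeEnds he b)]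
    exact hq e he a b

end Unions

section NearBalancedUnions

variable {V : Type} [DecidableEq V] {k : ℕ} {Φ : Finset V} {j : ℕ} {X Y A B C I : Finset (LEdge V k)} {m : ZMod k}

theorem exists_bal_of_balSum_pos (h : 0 < balSum Φ j X) :
    ∃ m : ZMod k, Bal Φ m X ∧ ∀ Y : Finset (LEdge V k), balSum Φ j Y = 0 → ¬ Bal Φ m Y := by
  have hn : ∀ (m : ZMod k) (Y : Finset (LEdge V k)), 0 ≤ balInd Φ m Y :=
    fun _ _ => balInd_nonneg
  by_cases h1 : Bal Φ ((j : ZMod k) - 1) X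
  · refine ⟨_, h1, fun Y hY hb => ?_⟩
    have := balInd_of hb
    have := hn (j : ZMod k) Y
    have := hn ((j : ZMod k) + 1) Y
    unfold balSum at hY; omega
  by_cases h2 : Bal Φ (j : ZMod k) X
  · refine ⟨_, h2, fun Y hY hb => ?_⟩
    have := balInd_of hb
    have := hn ((j : ZMod k) - 1) Y
    have := hn ((j : ZMod k) + 1) Y
    unfold balSum at hY; omega
  by_cases h3 : Bal Φ ((j : ZMod k) + 1) X
  · refine ⟨_, h3, fun Y hY hb => ?_⟩
    have := balInd_of hb
    have := hn ((j : ZMod k) - 1) Y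
    have := hn (j : ZMod k) Y
    unfold balSum at hY; omega
  · rw [balSum, balInd_of_not h1, balInd_of_not h2, balInd_of_not h3] at h
    norm_num at h

theorem bal_one_inter_of_near_bal {u : V} {δ : ZMod k} {p : V → ZMod k}
    (hA : ¬ Touches Φ A) (hp : ∀ e ∈ A, NearE u δ p e) (hB : Bal Φ m B) (hm : m * δ ≠ 0)
    (hg : ∀ e ∈ A, Good Φ e) : Bal Φ 1 (A ∩ B) := by
  obtain ⟨q, hq⟩ := hB
  have key : ∀ e ∈ A ∩ B, m * defect p e = (m * p e.1 - q e.1) - (m * p e.2.1 - q e.2.1) := by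
    intro e he
    obtain ⟨hA', hB'⟩ := Finset.mem_inter.1 he
    have hf := free_of_not_touches hA hA'
    have := hq e hB' hf.1 hf.2
    simp only [defect]; linear_combination this
  refine bal_one_of_pattern (u := u) (p := p)
    (fun x => if m * p x - q x = m * p u - q u then 0 else δ)
    (fun e he a b => ?_) (fun e he a b => ?_) (fun e he a b => ?_) (fun e he h => ?_)
  · have hk := key e he
    have h0 := (hp e (Finset.mem_inter.1 he).1).1 a b
    rw [h0, mul_zero] at hk
    exact ⟨h0, by rw [sub_eq_zero.1 hk.symm]⟩
  · have hk := key e he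
    rcases (hp e (Finset.mem_inter.1 he).1).2.1 a b with h0 | h0
    · rw [h0, mul_zero] at hk
      rw [h0, if_pos]; rw [← a, sub_eq_zero.1 hk.symm]
    · rw [h0, if_neg]; intro h
      rw [h, h0, a, sub_self] at hk; exact hm hk
  · have hk := key e he
    rcases (hp e (Finset.mem_inter.1 he).1).2.2.1 a b with h0 | h0
    · rw [h0, mul_zero] at hk
      rw [h0, if_pos, neg_zero]; rw [← b, sub_eq_zero.1 hk.symm]
    · rw [h0, if_neg]; intro h
      rw [h, h0, b, sub_self, mul_neg, neg_eq_zero] at hk; exact hm hk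
  · obtain ⟨hA', hB'⟩ := Finset.mem_inter.1 he
    have hf := free_of_not_touches hA hA'
    have h1 := hq e hB' hf.1 hf.2
    rw [h.1, h.2, sub_self] at h1
    rcases (hp e hA').2.2.2 h.1 h.2 with h0 | h0 | h0
    · exact (hg e hA').1 (h.1.trans h.2.symm) h0
    · exact hm (h0 ▸ h1)
    · rw [h0, mul_neg, neg_eq_zero] at h1; exact hm h1

theorem card_le_of_near_bal_one {u : V} {δ : ZMod k} {p : V → ZMod k}
    (hA : ¬ Touches Φ A) (hB : ¬ Touches Φ B) (hp : ∀ e ∈ A, NearE u δ p e) (hb : Bal Φ 1 B)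
    (hg : ∀ e ∈ A, Good Φ e) (hC : (A ∩ B).Nonempty) (hIC : I ⊆ A ∩ B) (hI : Indep Φ j I)
    (hW : freeEnds Φ A ∩ freeEnds Φ B ⊆ freeEnds Φ (A ∩ B)) :
    (I.card : ℤ) + 4 ≤ 2 * ((freeEnds Φ (A ∩ B)).card : ℤ) ∨ Near u δ (A ∪ B) := by
  have hbC : Bal Φ 1 (A ∩ B) := hb.mono Finset.inter_subset_right
  have htC : ¬ Touches Φ (A ∩ B) := fun h => hA (h.mono Finset.inter_subset_left)
  have hgC : ∀ e ∈ A ∩ B, Good Φ e := fun e he => hg e (Finset.mem_inter.1 he).1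
  obtain ⟨q, hq⟩ := hb
  have hd := defect_of_bal hB hq
  have key : ∀ e ∈ A ∩ B, defect p e = (p e.1 - q e.1) - (p e.2.1 - q e.2.1) := by
    intro e he
    have := hd e (Finset.mem_inter.1 he).2
    simp only [defect] at this ⊢; linear_combination this
  have noloop : ∀ e ∈ A ∩ B, ¬ (e.1 = u ∧ e.2.1 = u) := by
    rintro e he ⟨a, b⟩
    have := hd e (Finset.mem_inter.1 he).2
    rw [defect, a, b, sub_self, sub_zero] at this
    exact (hgC e he).1 (a.trans b.symm) this
  set l : V → ZMod k := fun x => p x - q x with hl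
  have far : ∀ e ∈ A ∩ B, ∀ x, x ≠ u → (e.1 = x ∨ e.2.1 = x) → farLabel u l e = l x := by
    rintro e he x hx (rfl | rfl)
    · rw [farLabel, if_neg hx]
    · rw [farLabel]
      split_ifs with h
      · rfl
      · have h0 := (hp e (Finset.mem_inter.1 he).1).1 h hx
        rw [key e he] at h0
        exact sub_eq_zero.1 h0
  obtain ⟨e₀, he₀⟩ := hC
  by_cases hcon : ∀ e ∈ A ∩ B, farLabel u l e = farLabel u l e₀
  · right
    refine near_union_bal hA hB hp hd (ℓ := farLabel u l e₀) (fun x h1 h2 hx => ?_)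
      (fun h1 h2 => ?_)
    · obtain ⟨-, e, he, hex⟩ := mem_freeEnds.1 (hW (Finset.mem_inter.2 ⟨h1, h2⟩))
      rw [← hcon e he, far e he x hx hex]
    · obtain ⟨-, e, he, hex⟩ := mem_freeEnds.1 (hW (Finset.mem_inter.2 ⟨h1, h2⟩))
      rcases hex with a | b
      · have b : e.2.1 ≠ u := fun b => noloop e he ⟨a, b⟩
        have h3 := (hp e (Finset.mem_inter.1 he).1).2.1 a b
        rw [key e he, a] at h3
        rwa [(hcon e he ▸ far e he _ b (Or.inr rfl) : farLabel u l e₀ = l e.2.1)]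
      · have a : e.1 ≠ u := fun a => noloop e he ⟨a, b⟩
        have h3 := (hp e (Finset.mem_inter.1 he).1).2.2.1 a b
        rw [key e he, b] at h3
        rw [(hcon e he ▸ far e he _ a (Or.inl rfl) : farLabel u l e₀ = l e.1)]
        rcases h3 with h3 | h3
        · left; simp only [hl]; linear_combination -h3
        · right; simp only [hl]; linear_combination -h3
  · left
    push Not at hcon
    obtain ⟨e₁, he₁, hne⟩ := hcon
    have := card_le_of_split hI hIC hgC (fun e => farLabel u l e = farLabel u l e₀)
      ⟨e₀, by simp [Finset.mem_inter.1 he₀]⟩ ⟨e₁, Finset.mem_filter.2 ⟨he₁, hne⟩⟩ {u} (by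
        intro x h1 h2
        by_contra hx
        rw [Finset.mem_singleton] at hx
        obtain ⟨-, f, hf, hfx⟩ := mem_freeEnds.1 h1
        obtain ⟨-, g, hg', hgx⟩ := mem_freeEnds.1 h2
        rw [Finset.mem_filter] at hf hg'
        rw [far f hf.1 x hx hfx] at hf
        rw [far g hg'.1 x hx hgx] at hg'
        exact hg'.2 hf.2)
    rw [dof_of_bal_one (fun h => htC (h.mono (Finset.filter_subset _ _)))
      (hbC.mono (Finset.filter_subset _ _)), dof_of_bal_one
      (fun h => htC (h.mono (Finset.filter_subset _ _)))
      (hbC.mono (Finset.filter_subset _ _)), Finset.card_singleton] at this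
    push_cast at this
    omega

/-- Two near-balanced sets with different base vertices. -/
theorem bal_or_card_le_of_near_ne {u w : V} (huw : u ≠ w) {δ ε : ZMod k} {p q : V → ZMod k}
    (ht : ¬ Touches Φ C) (hp : ∀ e ∈ C, NearE u δ p e) (hq : ∀ e ∈ C, NearE w ε q e)
    (hg : ∀ e ∈ C, Good Φ e) (hIC : I ⊆ C) (hI : Indep Φ j I) :
    Bal Φ 1 C ∨ (I.card : ℤ) + 2 ≤ 2 * ((freeEnds Φ C).card : ℤ) := by
  have key : ∀ e : LEdge V k, defect p e - defect q e =
      (p e.1 - q e.1) - (p e.2.1 - q e.2.1) := by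
    intro e; simp only [defect]; ring
  set l : V → ZMod k := fun x => p x - q x with hl
  have noloopu : ∀ e ∈ C, ¬ (e.1 = u ∧ e.2.1 = u) := by
    rintro e he ⟨a, b⟩
    have := (hq e he).1 (a ▸ huw) (b ▸ huw)
    rw [defect, a, b, sub_self, sub_zero] at this
    exact (hg e he).1 (a.trans b.symm) this
  have noloopw : ∀ e ∈ C, ¬ (e.1 = w ∧ e.2.1 = w) := by
    rintro e he ⟨a, b⟩
    have := (hp e he).1 (a ▸ huw.symm) (b ▸ huw.symm)
    rw [defect, a, b, sub_self, sub_zero] at this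
    exact (hg e he).1 (a.trans b.symm) this
  let lab : LEdge V k → ZMod k := fun e =>
    if e.1 = u then l u - defect p e else if e.2.1 = u then l u + defect p e else
      farLabel w l e
  have far : ∀ e ∈ C, ∀ x, x ≠ u → x ≠ w → (e.1 = x ∨ e.2.1 = x) → lab e = l x := by
    rintro e he x hxu hxw (rfl | rfl)
    · simp only [lab, if_neg hxu, farLabel, if_neg hxw]
      split_ifs with b
      · have h1 := (hq e he).1 hxw (b ▸ huw)
        have h2 := key e
        rw [h1, b] at h2
        simp only [hl]; linear_combination h2
      · rfl
    · by_cases a : e.1 = u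
      · simp only [lab, if_pos a]
        have h1 := (hq e he).1 (a ▸ huw) hxw
        have h2 := key e
        rw [h1, a] at h2
        simp only [hl]; linear_combination -h2
      · simp only [lab, if_neg a, if_neg hxu, farLabel]
        split_ifs with b
        · rfl
        · have h1 := (hq e he).1 b hxw
          have h2 := (hp e he).1 a hxu
          have h3 := key e
          rw [h1, h2] at h3
          simp only [hl]; linear_combination -h3
  have b1 : Bal Φ 1 (C.filter fun e => lab e = l u) := by
    refine bal_one_of_pattern (u := u) (p := p) (fun _ => 0) (fun e he a b => ?_)
      (fun e he a b => ?_) (fun e he a b => ?_) (fun e he => noloopu e (Finset.mem_filter.1 he).1)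
      <;> obtain ⟨he, hP⟩ := Finset.mem_filter.1 he
    · exact ⟨(hp e he).1 a b, rfl⟩
    · simpa [lab, a] using hP
    · simpa [lab, a, b] using hP
  have b2 : Bal Φ 1 (C.filter fun e => ¬ lab e = l u) := by
    refine bal_one_of_pattern (u := u) (p := p) (fun _ => δ) (fun e he a b => ?_)
      (fun e he a b => ?_) (fun e he a b => ?_) (fun e he => noloopu e (Finset.mem_filter.1 he).1)
      <;> obtain ⟨he, hP⟩ := Finset.mem_filter.1 he
    · exact ⟨(hp e he).1 a b, rfl⟩
    · exact ((hp e he).2.1 a b).resolve_left (by simpa [lab, a] using hP)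
    · exact ((hp e he).2.2.1 a b).resolve_left (by simpa [lab, a, b] using hP)
  have hCU := Finset.filter_union_filter_not_eq (fun e => lab e = l u) C
  rcases (C.filter fun e => lab e = l u).eq_empty_or_nonempty with h1 | h1
  · left; rw [h1, Finset.empty_union] at hCU; rwa [hCU] at b2
  rcases (C.filter fun e => ¬ lab e = l u).eq_empty_or_nonempty with h2 | h2
  · left; rw [h2, Finset.union_empty] at hCU; rwa [hCU] at b1
  right
  have := card_le_of_split hI hIC hg _ h1 h2 {u, w} (by
    intro x h1 h2
    by_contra hx
    simp only [Finset.mem_insert, Finset.mem_singleton, not_or] at hx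
    obtain ⟨-, f, hf, hfx⟩ := mem_freeEnds.1 h1
    obtain ⟨-, g, hg', hgx⟩ := mem_freeEnds.1 h2
    rw [Finset.mem_filter] at hf hg'
    rw [far f hf.1 x hx.1 hx.2 hfx] at hf
    rw [far g hg'.1 x hx.1 hx.2 hgx] at hg'
    exact hg'.2 hf.2)
  rw [dof_of_bal_one (fun h => ht (h.mono (Finset.filter_subset _ _))) b1,
    dof_of_bal_one (fun h => ht (h.mono (Finset.filter_subset _ _))) b2] at this
  have := Finset.card_le_two (a := u) (b := w)
  omega

/-- Two near-balanced sets with the same base vertex and unrelated gains. -/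
theorem bal_one_inter_of_near_near {u : V} {δ ε : ZMod k} {p q : V → ZMod k}
    (hp : ∀ e ∈ C, NearE u δ p e) (hq : ∀ e ∈ C, NearE u ε q e)
    (hg : ∀ e ∈ C, Good Φ e) (hδ : δ ≠ 0) (h1 : ε ≠ δ) (h2 : ε ≠ -δ) : Bal Φ 1 C := by
  have key : ∀ e : LEdge V k, defect p e - defect q e =
      (p e.1 - q e.1) - (p e.2.1 - q e.2.1) := by
    intro e; simp only [defect]; ring
  set l : V → ZMod k := fun x => p x - q x with hl
  have n1 : ∀ y : ZMod k, y = l u - δ ∨ y = l u - δ + ε → ¬ (y = l u ∨ y = l u + ε) := by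
    rintro y (rfl | rfl) (h | h)
    · exact hδ (by linear_combination -h)
    · exact h2 (by linear_combination -h)
    · exact h1 (by linear_combination h)
    · exact hδ (by linear_combination -h)
  refine bal_one_of_pattern (u := u) (p := p)
    (fun x => if l x = l u ∨ l x = l u + ε then 0 else δ)
    (fun e he a b => ?_) (fun e he a b => ?_) (fun e he a b => ?_) (fun e he h => ?_)
  · have h3 := (hp e he).1 a b
    have h4 := (hq e he).1 a b
    have h5 := key e
    rw [h3, h4, sub_self] at h5
    refine ⟨h3, ?_⟩
    have h6 : l e.1 = l e.2.1 := by simp only [hl]; linear_combination -h5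
    simp only [h6]
  · have h5 := key e
    rw [a] at h5
    rcases (hp e he).2.1 a b with h3 | h3 <;> rcases (hq e he).2.1 a b with h4 | h4 <;>
      rw [h3, h4] at h5 <;> rw [h3]
    · rw [if_pos]; left; simp only [hl]; linear_combination h5
    · rw [if_pos]; right; simp only [hl]; linear_combination h5
    · rw [if_neg]; apply n1; left; simp only [hl]; linear_combination h5
    · rw [if_neg]; apply n1; right; simp only [hl]; linear_combination h5
  · have h5 := key e
    rw [b] at h5
    rcases (hp e he).2.2.1 a b with h3 | h3 <;> rcases (hq e he).2.2.1 a b with h4 | h4 <;>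
      rw [h3, h4] at h5 <;> rw [h3]
    · rw [if_pos, neg_zero]; left; simp only [hl]; linear_combination -h5
    · rw [if_pos, neg_zero]; right; simp only [hl]; linear_combination -h5
    · rw [if_neg]; apply n1; left; simp only [hl]; linear_combination -h5
    · rw [if_neg]; apply n1; right; simp only [hl]; linear_combination -h5
  · have g0 := (hg e he).1 (h.1.trans h.2.symm)
    rcases (hp e he).2.2.2 h.1 h.2 with h3 | h3 | h3 <;>
      rcases (hq e he).2.2.2 h.1 h.2 with h4 | h4 | h4 <;>
      first
      | exact g0 h3
      | exact g0 h4
      | exact h1 (h4.symm.trans h3)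
      | exact h1 (neg_injective (h4.symm.trans h3))
      | exact h2 (h4.symm.trans h3)
      | exact h2 (neg_eq_iff_eq_neg.1 (h4.symm.trans h3))

/-- Two near-balanced sets with the same base vertex and the same gain. -/
theorem near_union_of_near_near {u : V} {δ : ZMod k} {p q : V → ZMod k}
    (hA : ¬ Touches Φ A) (hB : ¬ Touches Φ B)
    (hp : ∀ e ∈ A, NearE u δ p e) (hq : ∀ e ∈ B, NearE u δ q e)
    (hg : ∀ e ∈ A, Good Φ e) (hIC : I ⊆ A ∩ B) (hI : Indep Φ j I) (h2δ : 2 * δ ≠ 0)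
    (hW : freeEnds Φ A ∩ freeEnds Φ B ⊆ freeEnds Φ (A ∩ B)) :
    Bal Φ 1 (A ∩ B) ∨ (I.card : ℤ) + 2 ≤ 2 * ((freeEnds Φ (A ∩ B)).card : ℤ) ∨
      Near u δ (A ∪ B) := by
  have htC : ¬ Touches Φ (A ∩ B) := fun h => hA (h.mono Finset.inter_subset_left)
  have hgC : ∀ e ∈ A ∩ B, Good Φ e := fun e he => hg e (Finset.mem_inter.1 he).1
  have hpC : ∀ e ∈ A ∩ B, NearE u δ p e := fun e he => hp e (Finset.mem_inter.1 he).1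
  have hqC : ∀ e ∈ A ∩ B, NearE u δ q e := fun e he => hq e (Finset.mem_inter.1 he).2
  have hδ : δ ≠ 0 := fun h => h2δ (by simp [h])
  have key : ∀ e : LEdge V k, defect p e - defect q e =
      (p e.1 - q e.1) - (p e.2.1 - q e.2.1) := by
    intro e; simp only [defect]; ring
  set l : V → ZMod k := fun x => p x - q x with hl
  have far : ∀ e ∈ A ∩ B, ∀ x, x ≠ u → (e.1 = x ∨ e.2.1 = x) → farLabel u l e = l x := by
    rintro e he x hx (rfl | rfl)
    · rw [farLabel, if_neg hx]
    · rw [farLabel]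
      split_ifs with h
      · rfl
      · have h0 := (hpC e he).1 h hx
        have h1 := (hqC e he).1 h hx
        have h2 := key e
        rw [h0, h1] at h2
        simp only [hl]; linear_combination -h2
  have b2 : Bal Φ 1 ((A ∩ B).filter fun e => ¬ farLabel u l e = l u) := by
    refine bal_one_of_pattern (u := u) (p := p) (fun x => if l x = l u + δ then 0 else δ)
      (fun e he a b => ?_) (fun e he a b => ?_) (fun e he a b => ?_)
      (fun e he h => ?_) <;> obtain ⟨he, hP⟩ := Finset.mem_filter.1 he
    · have h3 := (hpC e he).1 a b
      have h4 := (hqC e he).1 a b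
      have h5 := key e
      rw [h3, h4, sub_self] at h5
      refine ⟨h3, ?_⟩
      have h6 : l e.1 = l e.2.1 := by simp only [hl]; linear_combination -h5
      simp only [h6]
    · have h5 := key e
      rw [far e he e.2.1 b (Or.inr rfl)] at hP
      rw [a] at h5
      rcases (hpC e he).2.1 a b with h3 | h3 <;> rcases (hqC e he).2.1 a b with h4 | h4 <;>
        rw [h3, h4] at h5 <;> rw [h3]
      · exact (hP (by simp only [hl]; linear_combination h5)).elim
      · rw [if_pos]; simp only [hl]; linear_combination h5
      · rw [if_neg]; intro h6; simp only [hl] at h6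
        exact h2δ (by linear_combination h5 - h6)
      · exact (hP (by simp only [hl]; linear_combination h5)).elim
    · have h5 := key e
      rw [far e he e.1 a (Or.inl rfl)] at hP
      rw [b] at h5
      rcases (hpC e he).2.2.1 a b with h3 | h3 <;> rcases (hqC e he).2.2.1 a b with h4 | h4 <;>
        rw [h3, h4] at h5 <;> rw [h3]
      · exact (hP (by simp only [hl]; linear_combination -h5)).elim
      · rw [if_pos, neg_zero]; simp only [hl]; linear_combination -h5
      · rw [if_neg]; intro h6; simp only [hl] at h6
        exact h2δ (by linear_combination -h5 - h6)
      · exact (hP (by simp only [hl]; linear_combination -h5)).elim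
    · exact hP (by rw [farLabel, if_pos h.1, h.2])
  have hCU := Finset.filter_union_filter_not_eq (fun e => farLabel u l e = l u) (A ∩ B)
  rcases ((A ∩ B).filter fun e => farLabel u l e = l u).eq_empty_or_nonempty with h1 | h1
  · left; rw [h1, Finset.empty_union] at hCU; rwa [hCU] at b2
  right
  rcases ((A ∩ B).filter fun e => ¬ farLabel u l e = l u).eq_empty_or_nonempty with h2 | h2
  · right
    have hall : ∀ e ∈ A ∩ B, farLabel u l e = l u := fun e he => by
      by_contra h
      have : e ∈ (A ∩ B).filter fun e => ¬ farLabel u l e = l u := Finset.mem_filter.2 ⟨he, h⟩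
      rw [h2] at this
      simp at this
    refine near_union hA hB hp (ℓ := l u) (q := q) (fun x h1 h2 hx => ?_) (fun e he => ?_)
    · obtain ⟨-, e, he, hex⟩ := mem_freeEnds.1 (hW (Finset.mem_inter.2 ⟨h1, h2⟩))
      rw [← hall e he, far e he x hx hex]
    · have : (fun x => if x = u ∧ u ∈ freeEnds Φ A then p u - l u else q x) = q := by
        funext x
        split_ifs with h
        · rw [h.1]; simp [hl]
        · rfl
      rw [this]; exact hq e he
  · left
    have := card_le_of_split hI hIC hgC _ h1 h2 {u} (by
      intro x h1 h2
      by_contra hx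
      rw [Finset.mem_singleton] at hx
      obtain ⟨-, f, hf, hfx⟩ := mem_freeEnds.1 h1
      obtain ⟨-, g, hg', hgx⟩ := mem_freeEnds.1 h2
      rw [Finset.mem_filter] at hf hg'
      rw [far f hf.1 x hx hfx] at hf
      rw [far g hg'.1 x hx hgx] at hg'
      exact hg'.2 hf.2)
    rw [dof_of_bal_one (X := (A ∩ B).filter fun e => ¬ farLabel u l e = l u)
      (fun h => htC (h.mono (Finset.filter_subset _ _))) b2, Finset.card_singleton] at this
    have h3 : 1 ≤ dof Φ j ((A ∩ B).filter fun e => farLabel u l e = l u) :=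
      one_le_dof_of_near (fun h => htC (h.mono (Finset.filter_subset _ _)))
        ⟨p, fun e he => hpC e (Finset.mem_filter.1 he).1⟩
    push_cast at this
    omega

end NearBalancedUnions

section Submodularity

variable {V : Type} [DecidableEq V] {k : ℕ} {Φ : Finset V} {j : ℕ} {X Y A B C I : Finset (LEdge V k)} {m : ZMod k}

theorem dof_cases : (dof Φ j X = if Touches Φ X then balInd Φ (j : ZMod k) X else balSum Φ j X) ∨
    (¬ Touches Φ X ∧ balSum Φ j X = 0 ∧ dof Φ j X = 1 ∧ ∃ u δ, Near u δ X) := by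
  have := @balSum_nonneg V _ k Φ j X
  unfold dof
  split_ifs with h h'
  · left; rfl
  · rcases this.eq_or_lt with h0 | h0
    · right; rw [← h0]; exact ⟨h, rfl, by norm_num, h'⟩
    · left; omega
  · left; omega

theorem balInd_add_le (hC : Linked Φ (A ∩ B))
    (hW : freeEnds Φ A ∩ freeEnds Φ B ⊆ freeEnds Φ (A ∩ B)) :
    balInd Φ m A + balInd Φ m B ≤ balInd Φ m (A ∪ B) + balInd Φ m (A ∩ B) := by
  have h1 : balInd Φ m A ≤ balInd Φ m (A ∩ B) := balInd_anti Finset.inter_subset_left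
  have h2 : balInd Φ m B ≤ balInd Φ m (A ∩ B) := balInd_anti Finset.inter_subset_right
  have h3 : 0 ≤ balInd Φ m (A ∪ B) := balInd_nonneg
  by_cases hA : Bal Φ m A
  · by_cases hB : Bal Φ m B
    · rw [balInd_of (hA.union hB hC hW)]
      have : balInd Φ m A ≤ 1 := balInd_le_one
      omega
    · rw [balInd_of_not hB] at h2 ⊢; omega
  · rw [balInd_of_not hA] at h1 ⊢; omega

theorem touches_union : Touches Φ (A ∪ B) ↔ Touches Φ A ∨ Touches Φ B := by
  constructor
  · rintro ⟨e, he, h⟩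
    rcases Finset.mem_union.1 he with he | he
    · exact Or.inl ⟨e, he, h⟩
    · exact Or.inr ⟨e, he, h⟩
  · rintro (h | h)
    · exact h.mono Finset.subset_union_left
    · exact h.mono Finset.subset_union_right

theorem dof_add_le_of_regular
    (hA : dof Φ j A = if Touches Φ A then balInd Φ (j : ZMod k) A else balSum Φ j A)
    (hB : dof Φ j B = if Touches Φ B then balInd Φ (j : ZMod k) B else balSum Φ j B)
    (hC : Linked Φ (A ∩ B)) (hW : freeEnds Φ A ∩ freeEnds Φ B ⊆ freeEnds Φ (A ∩ B)) :
    dof Φ j A + dof Φ j B ≤ dof Φ j (A ∪ B) + dof Φ j (A ∩ B) := by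
  have hU := touches_union (Φ := Φ) (A := A) (B := B)
  have k0 := balInd_add_le (m := (j : ZMod k)) hC hW
  have k1 := balInd_add_le (m := (j : ZMod k) - 1) hC hW
  have k2 := balInd_add_le (m := (j : ZMod k) + 1) hC hW
  have a1 : ∀ m : ZMod k, balInd Φ m A ≤ balInd Φ m (A ∩ B) :=
    fun m => balInd_anti Finset.inter_subset_left
  have b1 : ∀ m : ZMod k, balInd Φ m B ≤ balInd Φ m (A ∩ B) :=
    fun m => balInd_anti Finset.inter_subset_right
  have a2 := a1 (j - 1); have a3 := a1 (j + 1)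
  have b2 := b1 (j - 1); have b3 := b1 (j + 1)
  by_cases tA : Touches Φ A <;> by_cases tB : Touches Φ B
  · rw [if_pos tA] at hA; rw [if_pos tB] at hB
    have := @balInd_le_dof V _ k Φ j (A ∪ B)
    have := @balInd_le_dof V _ k Φ j (A ∩ B)
    omega
  · rw [if_pos tA] at hA; rw [if_neg tB] at hB
    have := @balInd_le_dof V _ k Φ j (A ∪ B)
    have := balSum_le_dof (j := j) (fun h : Touches Φ (A ∩ B) => tB (h.mono Finset.inter_subset_right))
    unfold balSum at *; omega
  · rw [if_neg tA] at hA; rw [if_pos tB] at hB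
    have := @balInd_le_dof V _ k Φ j (A ∪ B)
    have := balSum_le_dof (j := j) (fun h : Touches Φ (A ∩ B) => tA (h.mono Finset.inter_subset_left))
    unfold balSum at *; omega
  · rw [if_neg tA] at hA; rw [if_neg tB] at hB
    have := balSum_le_dof (j := j) (fun h : Touches Φ (A ∪ B) => (hU.1 h).elim tA tB)
    have := balSum_le_dof (j := j) (fun h : Touches Φ (A ∩ B) => tA (h.mono Finset.inter_subset_left))
    unfold balSum at *; omega

theorem exists_mul_eq_zero_of_two_mul {δ : ZMod k} (h : 2 * δ = 0) :
    (j : ZMod k) * δ = 0 ∨ ((j : ZMod k) + 1) * δ = 0 := by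
  rcases Nat.even_or_odd' j with ⟨i, hi | hi⟩
  · left; rw [hi]; push_cast; linear_combination (i : ZMod k) * h
  · right; rw [hi]; push_cast; linear_combination ((i : ZMod k) + 1) * h

theorem not_two_mul_of_near {u : V} {δ : ZMod k} (h : Near u δ X) (h0 : balSum Φ j X = 0) :
    2 * δ ≠ 0 := by
  intro h2
  have hn : ∀ (m : ZMod k), 0 ≤ balInd Φ m X := fun _ => balInd_nonneg
  have := hn (j - 1); have := hn j; have := hn (j + 1)
  unfold balSum at h0
  rcases exists_mul_eq_zero_of_two_mul (j := j) h2 with h2 | h2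
  · have := balInd_of (bal_of_near (Φ := Φ) h h2); omega
  · have := balInd_of (bal_of_near (Φ := Φ) h h2); omega

/-- The case of the merge inequality in which one set is near-balanced only. -/
theorem card_add_dof_le_of_near_left {u : V} {δ : ZMod k} (tA : ¬ Touches Φ A)
    (sA : balSum Φ j A = 0) (dA : dof Φ j A = 1) (nA : Near u δ A)
    (hg : ∀ e ∈ A, Good Φ e) (hne : (A ∩ B).Nonempty) (hIC : I ⊆ A ∩ B) (hI : Indep Φ j I)
    (hcard : (I.card : ℤ) + dof Φ j (A ∩ B) ≤ 2 * ((freeEnds Φ (A ∩ B)).card : ℤ))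
    (hW : freeEnds Φ A ∩ freeEnds Φ B ⊆ freeEnds Φ (A ∩ B))
    (hB : dof Φ j B = if Touches Φ B then balInd Φ (j : ZMod k) B else balSum Φ j B) :
    (I.card : ℤ) + dof Φ j A + dof Φ j B ≤
      2 * ((freeEnds Φ (A ∩ B)).card : ℤ) + dof Φ j (A ∪ B) := by
  have hU : 0 ≤ dof Φ j (A ∪ B) := dof_nonneg
  have htC : ¬ Touches Φ (A ∩ B) := fun h => tA (h.mono Finset.inter_subset_left)
  have dAC : dof Φ j A ≤ dof Φ j (A ∩ B) := dof_anti Finset.inter_subset_left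
  rcases le_or_gt (dof Φ j B) 0 with hb0 | hb0
  · omega
  obtain ⟨p, hp⟩ := nA
  rcases lt_or_ge (dof Φ j B) 3 with hb3 | hb3
  · have hpos : 0 < balSum Φ j B := by
      have := @balInd_le_balSum V _ k Φ j B
      split_ifs at hB <;> omega
    obtain ⟨m, hm, hmY⟩ := exists_bal_of_balSum_pos hpos
    have hmδ : m * δ ≠ 0 := fun h => hmY A sA (bal_of_near ⟨p, hp⟩ h)
    have := dof_of_bal_one (j := j) htC (bal_one_inter_of_near_bal tA hp hm hmδ hg)
    omega
  · obtain ⟨tB, hb⟩ := bal_one_of_dof hb3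
    have := @dof_le_three V _ k Φ j B
    rcases card_le_of_near_bal_one tA tB hp hb hg hne hIC hI hW with h | h
    · omega
    · have := one_le_dof_of_near (j := j) (Φ := Φ)
        (fun h => (touches_union.1 h).elim tA tB) h
      have := dof_of_bal_one (j := j) htC (hb.mono Finset.inter_subset_right)
      omega

/-- Submodularity of the count on edge sets with a common edge. -/
theorem cnt_union_add_card_le (hgA : ∀ e ∈ A, Good Φ e) (hgB : ∀ e ∈ B, Good Φ e)
    (hne : (A ∩ B).Nonempty) (hIC : I ⊆ A ∩ B) (hI : Indep Φ j I) :
    cnt Φ j (A ∪ B) + (I.card : ℤ) ≤ cnt Φ j A + cnt Φ j B := by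
  have hgC : ∀ e ∈ A ∩ B, Good Φ e := fun e he => hgA e (Finset.mem_inter.1 he).1
  have hfe := Finset.card_union_add_card_inter (freeEnds Φ A) (freeEnds Φ B)
  rw [← freeEnds_union] at hfe
  have hsub : freeEnds Φ (A ∩ B) ⊆ freeEnds Φ A ∩ freeEnds Φ B :=
    Finset.subset_inter (freeEnds_mono Finset.inter_subset_left)
      (freeEnds_mono Finset.inter_subset_right)
  have hle := Finset.card_le_card hsub
  have hcard := card_inter_le_cnt hI hne hgC
  rw [Finset.inter_eq_left.2 hIC] at hcard
  have dA : dof Φ j A ≤ dof Φ j (A ∩ B) := dof_anti Finset.inter_subset_left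
  have dB : dof Φ j B ≤ dof Φ j (A ∩ B) := dof_anti Finset.inter_subset_right
  have hU : 0 ≤ dof Φ j (A ∪ B) := dof_nonneg
  have dC := @dof_le_three V _ k Φ j (A ∩ B)
  unfold cnt at hcard ⊢
  suffices h : (I.card : ℤ) + dof Φ j A + dof Φ j B ≤
      2 * ((freeEnds Φ A ∩ freeEnds Φ B).card : ℤ) + dof Φ j (A ∪ B) by omega
  by_cases hL : Linked Φ (A ∩ B)
  swap
  · unfold Linked at hL
    push Not at hL
    obtain ⟨P, hP, h1, h2, h3⟩ := hL
    have := card_le_of_split hI hIC hgC P h1 h2 ∅ fun x hx hx' => (h3 x hx hx').elim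
    have e1 : dof Φ j (A ∩ B) ≤ dof Φ j ((A ∩ B).filter P) := dof_anti (Finset.filter_subset _ _)
    have e2 : dof Φ j (A ∩ B) ≤ dof Φ j ((A ∩ B).filter fun e => ¬ P e) :=
      dof_anti (Finset.filter_subset _ _)
    simp only [Finset.card_empty] at this
    omega
  by_cases hW : freeEnds Φ A ∩ freeEnds Φ B ⊆ freeEnds Φ (A ∩ B)
  · rw [hW.antisymm hsub]
    have hcard : (I.card : ℤ) + dof Φ j (A ∩ B) ≤ 2 * ((freeEnds Φ (A ∩ B)).card : ℤ) := by omega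
    rcases dof_cases (Φ := Φ) (j := j) (X := A) with rA | ⟨tA, sA, d1A, u, δ, nA⟩ <;>
      rcases dof_cases (Φ := Φ) (j := j) (X := B) with rB | ⟨tB, sB, d1B, w, ε, nB⟩
    · have := dof_add_le_of_regular rA rB hL hW
      omega
    · have hBA : B ∩ A = A ∩ B := Finset.inter_comm _ _
      have := card_add_dof_le_of_near_left (A := B) (B := A) tB sB d1B nB hgB (hBA ▸ hne)
        (hBA ▸ hIC) hI (hBA ▸ hcard) (by rwa [hBA, Finset.inter_comm]) rA
      rw [hBA, Finset.union_comm] at this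
      omega
    · exact card_add_dof_le_of_near_left tA sA d1A nA hgA hne hIC hI hcard hW rB
    · have htC : ¬ Touches Φ (A ∩ B) := fun h => tA (h.mono Finset.inter_subset_left)
      have htU : ¬ Touches Φ (A ∪ B) := fun h => (touches_union.1 h).elim tA tB
      suffices h : Bal Φ 1 (A ∩ B) ∨ (I.card : ℤ) + 2 ≤ 2 * ((freeEnds Φ (A ∩ B)).card : ℤ) ∨
          ∃ u δ, Near u δ (A ∪ B) by
        rcases h with h | h | ⟨u, δ, h⟩
        · have := dof_of_bal_one (j := j) htC h
          omega
        · omega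
        · have := one_le_dof_of_near (j := j) htU h
          omega
      have h2δ := not_two_mul_of_near nA sA
      obtain ⟨p, hp⟩ := id nA
      by_cases huw : u = w
      · subst huw
        by_cases h1 : ε = δ
        · subst h1
          obtain ⟨q, hq⟩ := nB
          exact (near_union_of_near_near tA tB hp hq hgA hIC hI h2δ hW).imp_right
            (Or.imp_right fun h => ⟨_, _, h⟩)
        by_cases h2 : ε = -δ
        · subst h2
          have nB' := nB.neg
          rw [neg_neg] at nB'
          obtain ⟨q, hq⟩ := nB'
          exact (near_union_of_near_near tA tB hp hq hgA hIC hI h2δ hW).imp_right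
            (Or.imp_right fun h => ⟨_, _, h⟩)
        · obtain ⟨q, hq⟩ := nB
          left
          exact bal_one_inter_of_near_near (fun e he => hp e (Finset.mem_inter.1 he).1)
            (fun e he => hq e (Finset.mem_inter.1 he).2) hgC (fun h => h2δ (by simp [h])) h1 h2
      · obtain ⟨q, hq⟩ := nB
        exact (bal_or_card_le_of_near_ne huw htC (fun e he => hp e (Finset.mem_inter.1 he).1)
            (fun e he => hq e (Finset.mem_inter.1 he).2) hgC hIC hI).imp_right Or.inl
  · have hlt : (freeEnds Φ (A ∩ B)).card < (freeEnds Φ A ∩ freeEnds Φ B).card :=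
      Finset.card_lt_card ⟨hsub, hW⟩
    by_cases hab : dof Φ j A ≤ 2 ∨ dof Φ j B ≤ 2
    · omega
    push Not at hab
    obtain ⟨tA, p, hp⟩ := bal_one_of_dof (Φ := Φ) (j := j) (X := A) (by omega)
    obtain ⟨tB, q, hq⟩ := bal_one_of_dof (Φ := Φ) (j := j) (X := B) (by omega)
    rcases lt_or_ge ((freeEnds Φ (A ∩ B)).card + 1) (freeEnds Φ A ∩ freeEnds Φ B).card
      with h2 | h2
    · omega
    obtain ⟨x₀, hx₀⟩ : ∃ x₀, (freeEnds Φ A ∩ freeEnds Φ B) \ freeEnds Φ (A ∩ B) = {x₀} := by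
      rw [← Finset.card_eq_one, Finset.card_sdiff_of_subset hsub]; omega
    obtain ⟨ℓ, hℓ⟩ := sub_const_of_bal hp hq hL
    have hn : Near x₀ (p x₀ - q x₀ - ℓ) (A ∪ B) := by
      refine near_union_bal tA tB (ℓ := ℓ) (p := p) (q := q) (fun e he => ?_) (defect_of_bal tB hq)
        (fun x h1 h2 h3 => hℓ x ?_) (fun _ _ => Or.inr rfl)
      · have := defect_of_bal tA hp e he
        refine ⟨fun _ _ => this, fun _ _ => Or.inl this, fun _ _ => Or.inl this, fun a b => ?_⟩
        rw [defect, a, b, sub_self, sub_zero] at this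
        exact Or.inl this
      · by_contra hx
        have : x ∈ (freeEnds Φ A ∩ freeEnds Φ B) \ freeEnds Φ (A ∩ B) :=
          Finset.mem_sdiff.2 ⟨Finset.mem_inter.2 ⟨h1, h2⟩, hx⟩
        rw [hx₀, Finset.mem_singleton] at this
        exact h3 this
    have := one_le_dof_of_near (j := j) (fun h => (touches_union.1 h).elim tA tB) hn
    omega

end Submodularity

section TightSets

variable {V : Type} [DecidableEq V] {k : ℕ} {Φ : Finset V} {j : ℕ} {A B I J K S : Finset (LEdge V k)}

variable (Φ j) in
/-- `A` is tight relative to the independent set `I`. -/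
def TightFor (I A : Finset (LEdge V k)) : Prop :=
  (∀ e ∈ A, Good Φ e) ∧ cnt Φ j A ≤ ((I ∩ A).card : ℤ)

theorem TightFor.union (hI : Indep Φ j I) (hA : TightFor Φ j I A) (hB : TightFor Φ j I B)
    (hne : (A ∩ B).Nonempty) : TightFor Φ j I (A ∪ B) := by
  refine ⟨fun e he => (Finset.mem_union.1 he).elim (hA.1 e) (hB.1 e), ?_⟩
  have h1 := cnt_union_add_card_le hA.1 hB.1 hne (I := I ∩ (A ∩ B)) Finset.inter_subset_right
    (hI.mono Finset.inter_subset_left)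
  have h2 := Finset.card_union_add_card_inter (I ∩ A) (I ∩ B)
  rw [← Finset.inter_union_distrib_left, ← Finset.inter_inter_distrib_left] at h2
  have := hA.2
  have := hB.2
  omega

variable [Fintype V] [NeZero k]

theorem exists_max_tight (hI : Indep Φ j I) {e : LEdge V k}
    (h : ∃ A, TightFor Φ j I A ∧ e ∈ A) :
    ∃ A, TightFor Φ j I A ∧ e ∈ A ∧ ∀ B, TightFor Φ j I B → (A ∩ B).Nonempty → B ⊆ A := by
  obtain ⟨A₀, h₀⟩ := h
  obtain ⟨A, hA, hmax⟩ := Finset.exists_max_image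
    ((Finset.univ : Finset (Finset (LEdge V k))).filter fun A => TightFor Φ j I A ∧ e ∈ A)
    Finset.card ⟨A₀, by simpa using h₀⟩
  simp only [Finset.mem_filter, Finset.mem_univ, true_and] at hA hmax
  refine ⟨A, hA.1, hA.2, fun B hB hne => ?_⟩
  have h1 := hmax (A ∪ B) ⟨hA.1.union hI hB hne, Finset.mem_union_left _ hA.2⟩
  have h2 := Finset.eq_of_subset_of_card_le Finset.subset_union_left h1
  rw [h2]; exact Finset.subset_union_right

/-- An independent set `J`, all of whose elements are spanned by `I`, obstructs adding three
elements to `I` as soon as they lie with `J` in a set of small count. -/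
theorem false_of_tight_cover (hI : Indep Φ j I) (hJ : Indep Φ j J)
    (hcov : ∀ e ∈ J, ∃ A, TightFor Φ j I A ∧ e ∈ A) (hSI : Indep Φ j (S ∪ I))
    (hd : Disjoint S I) (hS : S.card = 3) (hSK : S ⊆ K) (hJK : J ⊆ K)
    (hgK : ∀ e ∈ K, Good Φ e) (hK : cnt Φ j K ≤ (J.card : ℤ) + 2) : False := by
  have hmax : ∀ e, ∃ A, e ∈ J → TightFor Φ j I A ∧ e ∈ A ∧
      ∀ B, TightFor Φ j I B → (A ∩ B).Nonempty → B ⊆ A := fun e => by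
    by_cases he : e ∈ J
    · exact (exists_max_tight hI (hcov e he)).imp fun _ h _ => h
    · exact ⟨∅, fun h => (he h).elim⟩
  choose f hf using hmax
  have key : ∀ J' ⊆ J, (∀ e ∈ K ∪ J'.biUnion f, Good Φ e) ∧
      cnt Φ j (K ∪ J'.biUnion f) + ((J ∩ J'.biUnion f).card : ℤ) ≤
        cnt Φ j K + ((I ∩ J'.biUnion f).card : ℤ) := by
    intro J'
    induction J' using Finset.induction_on with
    | empty => intro _; simpa using hgK
    | insert e J' heJ' ih =>
      intro hsub
      obtain ⟨ih1, ih2⟩ := ih fun x hx => hsub (Finset.mem_insert_of_mem hx)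
      have heJ := hsub (Finset.mem_insert_self e J')
      obtain ⟨ht, he, hm⟩ := hf e heJ
      rw [Finset.biUnion_insert, Finset.union_comm (f e)]
      set X := J'.biUnion f with hX
      by_cases hdis : Disjoint X (f e)
      · refine ⟨fun x hx => ?_, ?_⟩
        · rw [← Finset.union_assoc] at hx
          exact (Finset.mem_union.1 hx).elim (ih1 x) (ht.1 x)
        · have hsubJ : J ∩ f e ⊆ (K ∪ X) ∩ f e :=
            Finset.inter_subset_inter_right (hJK.trans Finset.subset_union_left)
          have h1 := cnt_union_add_card_le (j := j) ih1 ht.1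
            ⟨e, hsubJ (Finset.mem_inter.2 ⟨heJ, he⟩)⟩ hsubJ (hJ.mono Finset.inter_subset_left)
          have h2 := ht.2
          rw [Finset.union_assoc] at h1
          have h3 : ∀ Z : Finset (LEdge V k),
              (Z ∩ (X ∪ f e)).card = (Z ∩ X).card + (Z ∩ f e).card := fun Z => by
            rw [Finset.inter_union_distrib_left, Finset.card_union_of_disjoint]
            exact hdis.mono Finset.inter_subset_right Finset.inter_subset_right
          rw [h3 J, h3 I]
          omega
      · have : f e ⊆ X := by
          rw [Finset.not_disjoint_iff] at hdis
          obtain ⟨x, hx, hxe⟩ := hdis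
          obtain ⟨e', he', hxe'⟩ := Finset.mem_biUnion.1 hx
          have := (hf e' (hsub (Finset.mem_insert_of_mem he'))).2.2 (f e) ht
            ⟨x, Finset.mem_inter.2 ⟨hxe', hxe⟩⟩
          exact this.trans (Finset.subset_biUnion_of_mem f he')
        rw [Finset.union_eq_left.2 this]
        exact ⟨ih1, ih2⟩
  obtain ⟨-, h⟩ := key J subset_rfl
  set X := J.biUnion f
  have hJX : J ⊆ X := fun e he => Finset.mem_biUnion.2 ⟨e, he, (hf e he).2.1⟩
  rw [Finset.inter_eq_left.2 hJX] at h
  have hne : (S ∪ I ∩ X).Nonempty := by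
    rw [Finset.nonempty_iff_ne_empty]
    intro h0
    have := Finset.card_le_card (h0 ▸ Finset.subset_union_left : S ⊆ ∅)
    simp [hS] at this
  have h1 := hSI (S ∪ I ∩ X) (Finset.union_subset_union_right Finset.inter_subset_left) hne
  have h2 : cnt Φ j (S ∪ I ∩ X) ≤ cnt Φ j (K ∪ X) :=
    cnt_mono (Finset.union_subset_union hSK Finset.inter_subset_right)
  rw [Finset.card_union_of_disjoint (hd.mono_right Finset.inter_subset_left), hS] at h1
  push_cast at h1
  omega

end TightSets

section StarSets

variable {V : Type} [DecidableEq V] {k : ℕ} {Φ : Finset V} {j : ℕ} {H I J K S : Finset (LEdge V k)}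

theorem two_mul_card_sub_three_le_cnt (hΦ : Φ.card ≤ 1) {T : Finset V}
    (hT : ∀ x ∈ T, ∃ e ∈ H, e.1 = x ∨ e.2.1 = x) : 2 * (T.card : ℤ) - 3 ≤ cnt Φ j H := by
  have hsub : T \ Φ ⊆ freeEnds Φ H := fun x hx =>
    mem_freeEnds.2 ⟨(Finset.mem_sdiff.1 hx).2, hT x (Finset.mem_sdiff.1 hx).1⟩
  have h1 := Finset.card_le_card hsub
  unfold cnt
  by_cases ht : Touches Φ H
  · have h2 := Finset.le_card_sdiff Φ T
    have := dof_le_one_of_touches (j := j) ht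
    omega
  · have hTΦ : T \ Φ = T := by
      refine Finset.sdiff_eq_self_of_disjoint (Finset.disjoint_left.2 fun x hx hxΦ => ?_)
      obtain ⟨e, he, rfl | rfl⟩ := hT x hx
      · exact ht ⟨e, he, Or.inl hxΦ⟩
      · exact ht ⟨e, he, Or.inr hxΦ⟩
    rw [hTΦ] at h1
    have := @dof_le_three V _ k Φ j H
    omega

theorem cnt_ge_of_mem {T : Finset V} (hT : ∀ x ∈ T, x ∉ Φ ∧ ∃ e ∈ H, e.1 = x ∨ e.2.1 = x) :
    2 * (T.card : ℤ) - dof Φ j H ≤ cnt Φ j H := by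
  have h1 := Finset.card_le_card fun x hx => (mem_freeEnds (Φ := Φ)).2 (hT x hx)
  unfold cnt
  omega

theorem not_bal_of_loop {m : ZMod k} {x : V} {y : ZMod k} (hx : x ∉ Φ) (he : (x, x, y) ∈ H)
    (hm : m * y ≠ 0) : ¬ Bal Φ m H := by
  rintro ⟨p, hp⟩
  have := hp _ he hx hx
  simp only [sub_self] at this
  exact hm this

theorem balInd_eq_zero_of_loop {m : ZMod k} {x : V} {y : ZMod k} (hx : x ∉ Φ)
    (he : (x, x, y) ∈ H) (hm : m * y ≠ 0) : balInd Φ m H = 0 :=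
  balInd_of_not (not_bal_of_loop hx he hm)

/-- Both `j - 1` and `j + 1` annihilate `y`. -/
def KilledTwice (j : ℕ) (y : ZMod k) : Prop :=
  ((j : ZMod k) - 1) * y = 0 ∧ ((j : ZMod k) + 1) * y = 0

theorem KilledTwice.two_mul {y : ZMod k} (h : KilledTwice j y) : 2 * y = 0 := by
  linear_combination h.2 - h.1

theorem balSum_le_one_of_loop {x : V} {y : ZMod k} (hx : x ∉ Φ) (he : (x, x, y) ∈ H)
    (hy : y ≠ 0) (ht : ¬ KilledTwice j y) : balSum Φ j H ≤ 1 := by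
  have n : ∀ m : ZMod k, balInd Φ m H ≤ 1 := fun m => balInd_le_one
  have := n (j - 1); have := n j; have := n (j + 1)
  have z := fun m : ZMod k => balInd_eq_zero_of_loop (m := m) hx he
  unfold balSum
  by_cases h0 : (j : ZMod k) * y = 0
  · have h1 : ((j : ZMod k) - 1) * y ≠ 0 := fun h => hy (by linear_combination h0 - h)
    have h2 : ((j : ZMod k) + 1) * y ≠ 0 := fun h => hy (by linear_combination h - h0)
    rw [z _ h1, z _ h2]; omega
  · rw [z _ h0]
    by_cases h1 : ((j : ZMod k) - 1) * y = 0
    · rw [z _ fun h => ht ⟨h1, h⟩]; omega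
    · rw [z _ h1]; omega

theorem dof_le_one_of_loop {x : V} {y : ZMod k} (hx : x ∉ Φ) (he : (x, x, y) ∈ H)
    (hy : y ≠ 0) (ht : ¬ KilledTwice j y) : dof Φ j H ≤ 1 := by
  have := balSum_le_one_of_loop hx he hy ht
  have := @balInd_le_one V _ k Φ H (j : ZMod k)
  unfold dof
  split_ifs <;> omega

theorem dof_le_two_of_not_bal (h : ¬ Bal Φ 1 H) : dof Φ j H ≤ 2 := by
  by_contra! h'
  exact h (bal_one_of_dof (j := j) (by omega)).2

theorem card_le_ite (a b c : LEdge V k) (h : H ⊆ {a, b, c}) :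
    H.card ≤ (if a ∈ H then 1 else 0) + (if b ∈ H then 1 else 0) + (if c ∈ H then 1 else 0) := by
  have hsub : H ⊆ (if a ∈ H then {a} else ∅) ∪ (if b ∈ H then {b} else ∅) ∪
      (if c ∈ H then {c} else ∅) := by
    intro e he
    have := h he
    simp only [Finset.mem_insert, Finset.mem_singleton] at this
    rcases this with rfl | rfl | rfl <;> simp [he]
  refine (Finset.card_le_card hsub).trans ((Finset.card_union_le _ _).trans
    (Nat.add_le_add ((Finset.card_union_le _ _).trans (Nat.add_le_add ?_ ?_)) ?_)) <;>
    split_ifs <;> simp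

/-- Three edges at `v`, whose far ends and outward gains are given by `x` and `g`, all of whose
1-reductions are blocked by tight sets. -/
structure Star (Φ : Finset V) (j : ℕ) (I S K : Finset (LEdge V k)) (v : V) (x : Fin 3 → V)
    (g : Fin 3 → ZMod k) : Prop where
  indep : Indep Φ j (S ∪ I)
  disj : Disjoint S I
  card_eq : S.card = 3
  subset : S ⊆ K
  blocked : ∀ i i', i ≠ i' → ∃ A, TightFor Φ j I A ∧ (x i, x i', g i' - g i) ∈ A
  mem : ∀ i i', i ≠ i' → (x i, x i', g i' - g i) ∈ K
  cases : ∀ e ∈ K, (∃ i, e = (v, x i, g i) ∨ e = rev (v, x i, g i)) ∨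
    ∃ i i', i ≠ i' ∧ e = (x i, x i', g i' - g i)
  free : v ∉ Φ
  ne : ∀ i, x i ≠ v
  gain_ne : ∀ i i', i ≠ i' → x i = x i' → g i ≠ g i'
  parallel : ∀ i i', i ≠ i' → x i = x i' → x i ∉ Φ
  card_le : Φ.card ≤ 1

namespace Star

variable {v : V} {x : Fin 3 → V} {g : Fin 3 → ZMod k}

theorem good (h : Star Φ j I S K v x g) : ∀ e ∈ K, Good Φ e := by
  intro e he
  rcases h.cases e he with ⟨i, rfl | rfl⟩ | ⟨i, i', hne, rfl⟩
  · exact ⟨fun h' => (h.ne i h'.symm).elim, Or.inl h.free⟩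
  · exact ⟨fun h' => (h.ne i h').elim, Or.inr h.free⟩
  · refine ⟨fun h' => sub_ne_zero.2 (h.gain_ne i i' hne h').symm, ?_⟩
    by_contra! h'
    exact h.parallel i i' hne (Finset.card_le_one.1 h.card_le _ h'.1 _ h'.2) h'.1

theorem elim [Fintype V] [NeZero k] (h : Star Φ j I S K v x g) (hJ : Indep Φ j J)
    (hJc : ∀ e ∈ J, ∃ i i', i ≠ i' ∧ e = (x i, x i', g i' - g i))
    (hK : cnt Φ j K ≤ (J.card : ℤ) + 2) : False := by
  refine false_of_tight_cover (h.indep.mono Finset.subset_union_right) hJ (fun e he => ?_) h.indep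
    h.disj h.card_eq h.subset (fun e he => ?_) h.good hK
  · obtain ⟨i, i', hne, rfl⟩ := hJc e he
    exact h.blocked i i' hne
  · obtain ⟨i, i', hne, rfl⟩ := hJc e he
    exact h.mem i i' hne

theorem cnt_le (h : Star Φ j I S K v x g) {T : Finset V} (hv : v ∈ T)
    (hx : ∀ i, x i ∉ Φ → x i ∈ T) : cnt Φ j K ≤ 2 * (T.card : ℤ) - dof Φ j K := by
  have : freeEnds Φ K ⊆ T := by
    intro y hy
    obtain ⟨hyΦ, e, he, hey⟩ := mem_freeEnds.1 hy
    rcases h.cases e he with ⟨i, rfl | rfl⟩ | ⟨i, i', hne, rfl⟩ <;>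
      rcases hey with rfl | rfl <;> first | exact hv | exact hx _ hyΦ
  have := Finset.card_le_card this
  unfold cnt
  omega

theorem bal (h : Star Φ j I S K v x g) {m : ZMod k} {p : V → ZMod k}
    (hp : ∀ i, x i ∉ Φ → m * g i = p (x i) - p v) : Bal Φ m K := by
  have hs : ∀ i, BalE Φ m p (v, x i, g i) := fun i _ b => hp i b
  refine ⟨p, fun e he => ?_⟩
  rcases h.cases e he with ⟨i, rfl | rfl⟩ | ⟨i, i', hne, rfl⟩
  · exact hs i
  · exact balE_rev (hs i)
  · intro a b
    have := hp i a
    have := hp i' b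
    simp only at *
    linear_combination this - hp i a

theorem touches (h : Star Φ j I S K v x g) {i : Fin 3} (hi : x i ∈ Φ) : Touches Φ K := by
  obtain ⟨i', hne⟩ := exists_ne i
  exact ⟨_, h.mem i i' hne.symm, Or.inl hi⟩

theorem not_touches (h : Star Φ j I S K v x g) (hi : ∀ i, x i ∉ Φ) : ¬ Touches Φ K := by
  rintro ⟨e, he, hey⟩
  rcases h.cases e he with ⟨i, rfl | rfl⟩ | ⟨i, i', hne, rfl⟩ <;> rcases hey with h' | h' <;>
    first | exact h.free h' | exact hi _ h'

end Star
end StarSets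

section StarCases

variable {V : Type} [DecidableEq V] {k : ℕ} {Φ : Finset V} {j : ℕ} {H I J K S : Finset (LEdge V k)}

theorem one_le_cnt_of_mem (hΦ : Φ.card ≤ 1) {y z : V} {t : ZMod k} (hyz : y ≠ z)
    (he : (y, z, t) ∈ H) : 1 ≤ cnt Φ j H := by
  have := two_mul_card_sub_three_le_cnt (j := j) (H := H) hΦ (T := {y, z}) (by
    intro w hw
    simp only [Finset.mem_insert, Finset.mem_singleton] at hw
    rcases hw with rfl | rfl
    · exact ⟨_, he, Or.inl rfl⟩
    · exact ⟨_, he, Or.inr rfl⟩)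
  rw [Finset.card_pair hyz] at this
  push_cast at this
  omega

theorem three_le_cnt (hΦ : Φ.card ≤ 1) {y z w : V} (hyz : y ≠ z) (hyw : y ≠ w) (hzw : z ≠ w)
    (h1 : ∃ e ∈ H, e.1 = y ∨ e.2.1 = y) (h2 : ∃ e ∈ H, e.1 = z ∨ e.2.1 = z)
    (h3 : ∃ e ∈ H, e.1 = w ∨ e.2.1 = w) : 3 ≤ cnt Φ j H := by
  have := two_mul_card_sub_three_le_cnt (j := j) (H := H) hΦ (T := {y, z, w}) (by
    intro x hx
    simp only [Finset.mem_insert, Finset.mem_singleton] at hx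
    rcases hx with rfl | rfl | rfl <;> assumption)
  rw [Finset.card_eq_three.2 ⟨y, z, w, hyz, hyw, hzw, rfl⟩] at this
  push_cast at this
  omega

theorem indep_triangle (hΦ : Φ.card ≤ 1) {y z w : V} (hyz : y ≠ z) (hyw : y ≠ w) (hzw : z ≠ w)
    (r s t : ZMod k) : Indep Φ j {(y, z, r), (y, w, s), (z, w, t)} := by
  intro H hH hne
  have hc := card_le_ite _ _ _ hH
  have hpos := hne.card_pos
  by_cases h1 : (y, z, r) ∈ H <;> by_cases h2 : (y, w, s) ∈ H <;> by_cases h3 : (z, w, t) ∈ H <;>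
    simp only [h1, h2, h3, if_true, if_false] at hc
  · have := three_le_cnt (j := j) hΦ hyz hyw hzw ⟨_, h1, Or.inl rfl⟩ ⟨_, h1, Or.inr rfl⟩
      ⟨_, h2, Or.inr rfl⟩
    omega
  · have := three_le_cnt (j := j) hΦ hyz hyw hzw ⟨_, h1, Or.inl rfl⟩ ⟨_, h1, Or.inr rfl⟩
      ⟨_, h2, Or.inr rfl⟩
    omega
  · have := three_le_cnt (j := j) hΦ hyz hyw hzw ⟨_, h1, Or.inl rfl⟩ ⟨_, h1, Or.inr rfl⟩
      ⟨_, h3, Or.inr rfl⟩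
    omega
  · have := one_le_cnt_of_mem (j := j) hΦ hyz h1
    omega
  · have := three_le_cnt (j := j) hΦ hyz hyw hzw ⟨_, h2, Or.inl rfl⟩ ⟨_, h3, Or.inl rfl⟩
      ⟨_, h2, Or.inr rfl⟩
    omega
  · have := one_le_cnt_of_mem (j := j) hΦ hyw h2
    omega
  · have := one_le_cnt_of_mem (j := j) hΦ hzw h3
    omega
  · omega

theorem indep_of_loop_parallel (hΦ : Φ.card ≤ 1) {y z : V} (hy : y ∉ Φ) (hz : z ∉ Φ)
    (hyz : y ≠ z) {r s t : ZMod k} (hst : s ≠ t)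
    (hJ : J ⊆ {(y, y, r), (y, z, s), (y, z, t)})
    (hr : (y, y, r) ∈ J → r ≠ 0 ∧ ¬ KilledTwice j r) : Indep Φ j J := by
  intro H hH hne
  have hc := card_le_ite _ _ _ (hH.trans hJ)
  have hpos := hne.card_pos
  have hyy : ∀ {q}, (y, z, q) ∈ H → 4 - dof Φ j H ≤ cnt Φ j H := fun {q} hq => by
    have := cnt_ge_of_mem (Φ := Φ) (j := j) (H := H) (T := {y, z}) (by
      intro w hw
      simp only [Finset.mem_insert, Finset.mem_singleton] at hw
      rcases hw with rfl | rfl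
      · exact ⟨hy, _, hq, Or.inl rfl⟩
      · exact ⟨hz, _, hq, Or.inr rfl⟩)
    rw [Finset.card_pair hyz] at this
    push_cast at this
    omega
  have hl : (y, y, r) ∈ H → dof Φ j H ≤ 1 := fun h =>
    dof_le_one_of_loop hy h (hr (hH h)).1 (hr (hH h)).2
  by_cases h1 : (y, y, r) ∈ H <;> by_cases h2 : (y, z, s) ∈ H <;>
    by_cases h3 : (y, z, t) ∈ H <;> simp only [h1, h2, h3, if_true, if_false] at hc
  · have := hyy h2; have := hl h1; omega
  · have := hyy h2; have := hl h1; omega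
  · have := hyy h3; have := hl h1; omega
  · have := hl h1
    have := cnt_ge_of_mem (Φ := Φ) (j := j) (H := H) (T := {y}) (by
      intro w hw
      rw [Finset.mem_singleton] at hw
      exact ⟨hw ▸ hy, _, h1, Or.inl hw.symm⟩)
    rw [Finset.card_singleton] at this
    push_cast at this
    omega
  · have := hyy h2
    have : dof Φ j H ≤ 2 := by
      refine dof_le_two_of_not_bal ?_
      rintro ⟨p, hp⟩
      have e1 := hp _ h2 hy hz
      have e2 := hp _ h3 hy hz
      simp only at e1 e2
      exact hst (by linear_combination e1 - e2)
    omega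
  · have := one_le_cnt_of_mem (j := j) hΦ hyz h2
    omega
  · have := one_le_cnt_of_mem (j := j) hΦ hyz h3
    omega
  · omega

theorem indep_of_loop_fixed {y z : V} (hy : y ∉ Φ) (hz : z ∈ Φ) {r s : ZMod k}
    (hJ : J ⊆ {(y, y, r), (y, z, s)})
    (hr : (y, y, r) ∈ J → r ≠ 0 ∧ ¬ KilledTwice j r ∧ (j : ZMod k) * r ≠ 0) : Indep Φ j J := by
  intro H hH hne
  have hc := card_le_ite _ _ _ ((hH.trans hJ).trans (by simp) : H ⊆ {(y, y, r), (y, y, r), (y, z, s)})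
  have hc' : H.card ≤ 2 := (Finset.card_le_card (hH.trans hJ)).trans Finset.card_le_two
  have hpos := hne.card_pos
  have hge : 2 - dof Φ j H ≤ cnt Φ j H := by
    have := cnt_ge_of_mem (Φ := Φ) (j := j) (H := H) (T := {y}) (by
      intro w hw
      rw [Finset.mem_singleton] at hw
      obtain ⟨e, he⟩ := hne
      refine ⟨hw ▸ hy, e, he, Or.inl ?_⟩
      have := hJ (hH he)
      simp only [Finset.mem_insert, Finset.mem_singleton] at this
      rcases this with rfl | rfl <;> exact hw.symm)
    rw [Finset.card_singleton] at this
    push_cast at this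
    omega
  by_cases h1 : (y, y, r) ∈ H <;> by_cases h2 : (y, z, s) ∈ H <;>
    simp only [h1, h2, if_true, if_false] at hc
  · have := dof_of_touches (j := j) ⟨_, h2, Or.inr hz⟩
    rw [balInd_eq_zero_of_loop hy h1 (hr (hH h1)).2.2] at this
    omega
  · have := dof_le_one_of_loop hy h1 (hr (hH h1)).1 (hr (hH h1)).2.1
    have : H.card ≤ 1 := Finset.card_le_one.2 fun a ha b hb => by
      have ha' := hJ (hH ha)
      have hb' := hJ (hH hb)
      simp only [Finset.mem_insert, Finset.mem_singleton] at ha' hb'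
      rcases ha' with rfl | rfl
      · rcases hb' with rfl | rfl
        · rfl
        · exact (h2 hb).elim
      · exact (h2 ha).elim
    omega
  · have := dof_le_one_of_touches (j := j) ⟨_, h2, Or.inr hz⟩
    omega
  · omega

theorem indep_singleton_loop {y : V} (hy : y ∉ Φ) {r : ZMod k} (hr : r ≠ 0)
    (ht : ¬ KilledTwice j r) : Indep Φ j {(y, y, r)} := by
  intro H hH hne
  obtain rfl := (Finset.subset_singleton_iff.1 hH).resolve_left hne.ne_empty
  have := dof_le_one_of_loop hy (Finset.mem_singleton_self (y, y, r)) hr ht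
  have := cnt_ge_of_mem (Φ := Φ) (j := j) (H := {(y, y, r)}) (T := {y}) (by simp [hy])
  rw [Finset.card_singleton] at this ⊢
  push_cast at *
  omega

theorem indep_pair_loops {y : V} (hy : y ∉ Φ) {r s : ZMod k} (hr : r ≠ 0) (hs : s ≠ 0)
    (hrt : ¬ KilledTwice j r) (hst : ¬ KilledTwice j s) (h1 : r ≠ s) (h2 : r + s ≠ 0)
    (hk : ∀ m : ZMod k, m = j - 1 ∨ m = j ∨ m = j + 1 → ¬ (m * r = 0 ∧ m * s = 0)) :
    Indep Φ j {(y, y, r), (y, y, s)} := by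
  intro H hH hne
  rw [Finset.Nonempty] at hne
  have hc : H.card ≤ 2 := (Finset.card_le_card hH).trans Finset.card_le_two
  have hge : 2 - dof Φ j H ≤ cnt Φ j H := by
    have := cnt_ge_of_mem (Φ := Φ) (j := j) (H := H) (T := {y}) (by
      intro w hw
      rw [Finset.mem_singleton] at hw
      obtain ⟨e, he⟩ := hne
      refine ⟨hw ▸ hy, e, he, Or.inl ?_⟩
      have := hH he
      simp only [Finset.mem_insert, Finset.mem_singleton] at this
      rcases this with rfl | rfl <;> exact hw.symm)
    rw [Finset.card_singleton] at this
    push_cast at this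
    omega
  have ht : ¬ Touches Φ H := by
    rintro ⟨e, he, h⟩
    have := hH he
    simp only [Finset.mem_insert, Finset.mem_singleton] at this
    rcases this with rfl | rfl <;> rcases h with h | h <;> exact hy h
  by_cases a : (y, y, r) ∈ H
  · by_cases b : (y, y, s) ∈ H
    · have : dof Φ j H = 0 := by
        have z : ∀ m : ZMod k, m = j - 1 ∨ m = j ∨ m = j + 1 → balInd Φ m H = 0 := fun m hm => by
          by_cases h0 : m * r = 0
          · exact balInd_eq_zero_of_loop hy b fun h => hk m hm ⟨h0, h⟩
          · exact balInd_eq_zero_of_loop hy a h0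
        rw [dof, if_neg ht, balSum, z _ (Or.inl rfl), z _ (Or.inr (Or.inl rfl)),
          z _ (Or.inr (Or.inr rfl)), if_neg]
        · rfl
        rintro ⟨u, δ, p, hp⟩
        by_cases hu : y = u
        · have e1 := (hp _ a).2.2.2 hu hu
          have e2 := (hp _ b).2.2.2 hu hu
          simp only at e1 e2
          rcases e1.resolve_left hr with e1 | e1 <;> rcases e2.resolve_left hs with e2 | e2
          · exact h1 (e1.trans e2.symm)
          · exact h2 (by rw [e1, e2]; ring)
          · exact h2 (by rw [e1, e2]; ring)
          · exact h1 (e1.trans e2.symm)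
        · have := (hp _ a).1 hu hu
          simp only [defect, sub_self, sub_zero] at this
          exact hr this
      omega
    · have hsub : H ⊆ {(y, y, r)} := fun e he => by
        have := hH he
        simp only [Finset.mem_insert, Finset.mem_singleton] at this ⊢
        exact this.resolve_right fun h => b (h ▸ he)
      exact indep_singleton_loop hy hr hrt H hsub hne
  · have hsub : H ⊆ {(y, y, s)} := fun e he => by
      have := hH he
      simp only [Finset.mem_insert, Finset.mem_singleton] at this ⊢
      exact this.resolve_left fun h => a (h ▸ he)
    exact indep_singleton_loop hy hs hst H hsub hne

end StarCases

section StarConclusion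

variable {V : Type} [DecidableEq V] {k : ℕ} {Φ : Finset V} {j : ℕ} {H I J K S : Finset (LEdge V k)}

theorem eq_half_of_two_mul [NeZero k] {y : ZMod k} (h : 2 * y = 0) (hy : y ≠ 0) :
    Even k ∧ y = ((k / 2 : ℕ) : ZMod k) := by
  have h1 : ((2 * y.val : ℕ) : ZMod k) = 0 := by
    push_cast
    rw [ZMod.natCast_zmod_val]
    exact h
  obtain ⟨c, hc⟩ := (ZMod.natCast_eq_zero_iff _ _).1 h1
  have h2 := ZMod.val_lt y
  have h3 : 0 < y.val := Nat.pos_of_ne_zero fun h0 => hy ((ZMod.val_eq_zero y).1 h0)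
  have hc1 : c = 1 := by
    rcases c with _ | _ | c
    · omega
    · rfl
    · nlinarith
  subst hc1
  refine ⟨⟨y.val, by omega⟩, ?_⟩
  rw [show k / 2 = y.val by omega, ZMod.natCast_zmod_val]

theorem eq_of_two_mul [NeZero k] {y z : ZMod k} (h : 2 * y = 0) (hy : y ≠ 0) (h' : 2 * z = 0)
    (hz : z ≠ 0) : y = z := by
  rw [(eq_half_of_two_mul h hy).2, (eq_half_of_two_mul h' hz).2]

theorem odd_of_two_mul {y : ZMod k} (h : 2 * y = 0) (hy : (j : ZMod k) * y ≠ 0) : Odd j := by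
  by_contra hj
  obtain ⟨i, rfl⟩ := Nat.not_odd_iff_even.1 hj
  apply hy
  push_cast
  linear_combination (i : ZMod k) * h

/-- Among three nonzero residues with sum zero which are not killed together by `j - 1`, `j` or
`j + 1`, two are distinct and killed by at most one of `j - 1` and `j + 1`. -/
theorem exists_pair_not_killedTwice [NeZero k] {y : Fin 3 → ZMod k} (h0 : ∀ i, y i ≠ 0)
    (hs : y 0 + y 1 + y 2 = 0)
    (hm : ∀ m : ZMod k, m = j - 1 ∨ m = j ∨ m = j + 1 → ¬ ∀ i, m * y i = 0) :
    ∃ i i', i ≠ i' ∧ ¬ KilledTwice j (y i) ∧ ¬ KilledTwice j (y i') ∧ y i ≠ y i' := by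
  have hs' : ∀ i, y i + y (i + 1) + y (i + 2) = 0 := by
    intro i
    fin_cases i
    · exact hs
    · change y 1 + y 2 + y 0 = 0; linear_combination hs
    · change y 2 + y 0 + y 1 = 0; linear_combination hs
  have hall : ∀ (P : ZMod k → Prop) (i : Fin 3), P (y i) → P (y (i + 1)) → P (y (i + 2)) →
      ∀ i, P (y i) := by
    intro P i a b c i'
    have : i' = i ∨ i' = i + 1 ∨ i' = i + 2 := by clear a b c; revert i i'; decide
    rcases this with rfl | rfl | rfl <;> assumption
  by_cases hK : ∃ i, KilledTwice j (y i)
  · obtain ⟨i, hi⟩ := hK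
    have n1 : ¬ KilledTwice j (y (i + 1)) := fun h => h0 (i + 2) (by
      have := eq_of_two_mul hi.two_mul (h0 _) h.two_mul (h0 _)
      linear_combination hs' i - hi.two_mul + this)
    have n2 : ¬ KilledTwice j (y (i + 2)) := fun h => h0 (i + 1) (by
      have := eq_of_two_mul hi.two_mul (h0 _) h.two_mul (h0 _)
      linear_combination hs' i - hi.two_mul + this)
    refine ⟨i + 1, i + 2, by clear hi n1 n2; revert i; decide, n1, n2, fun he => ?_⟩
    have hyi : y i = -2 * y (i + 1) := by linear_combination hs' i + he
    have h4 : 4 * y (i + 1) = 0 := by linear_combination 2 * hyi - hi.two_mul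
    have hkill : ∀ m : ZMod k, m * y (i + 1) = 0 → ∀ i, m * y i = 0 := fun m hm =>
      hall (fun z => m * z = 0) i (by rw [hyi]; linear_combination -2 * hm) hm (by rw [← he, hm])
    have hj : Odd j := odd_of_two_mul hi.two_mul fun h => h0 i (by linear_combination h - hi.1)
    obtain ⟨t, rfl⟩ := hj
    rcases Nat.even_or_odd' t with ⟨c, rfl | rfl⟩
    · refine hm _ (Or.inl rfl) (hkill _ ?_)
      push_cast
      linear_combination (c : ZMod k) * h4
    · refine hm _ (Or.inr (Or.inr rfl)) (hkill _ ?_)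
      push_cast
      linear_combination ((c : ZMod k) + 1) * h4
  · push Not at hK
    by_cases h1 : y 0 = y 1
    · by_cases h2 : y 1 = y 2
      · exfalso
        have h3 : 3 * y 0 = 0 := by linear_combination hs + 2 * h1 + h2
        have hkill : ∀ m : ZMod k, m * y 0 = 0 → ∀ i, m * y i = 0 := fun m hm =>
          hall (fun z => m * z = 0) 0 hm (by change m * y 1 = 0; rw [← h1, hm])
            (by change m * y 2 = 0; rw [← h2, ← h1, hm])
        have : j % 3 = 0 ∨ j % 3 = 1 ∨ j % 3 = 2 := by omega
        have hj : ((3 * (j / 3) + j % 3 : ℕ) : ZMod k) = j := by rw [Nat.div_add_mod]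
        rcases this with h | h | h <;> rw [h] at hj <;> push_cast at hj
        · exact hm _ (Or.inr (Or.inl rfl)) (hkill _ (by
            rw [← hj]; linear_combination ((j / 3 : ℕ) : ZMod k) * h3))
        · exact hm _ (Or.inl rfl) (hkill _ (by
            rw [← hj]; linear_combination ((j / 3 : ℕ) : ZMod k) * h3))
        · exact hm _ (Or.inr (Or.inr rfl)) (hkill _ (by
            rw [← hj]; linear_combination (((j / 3 : ℕ) : ZMod k) + 1) * h3))
      · exact ⟨1, 2, by decide, hK 1, hK 2, h2⟩
    · exact ⟨0, 1, by decide, hK 0, hK 1, h1⟩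

namespace Star

variable {v : V} {x : Fin 3 → V} {g : Fin 3 → ZMod k}

theorem near (h : Star Φ j I S K v x g) {a b c : Fin 3} (habc : ∀ i, i = a ∨ i = b ∨ i = c)
    (hab : x a = x b) (hac : x a ≠ x c) : Near (x a) (g a - g b) K := by
  set p : V → ZMod k := fun y => if y = x a then 0 else if y = v then -g a else g c - g a with hp
  have hpa : p (x a) = 0 := by simp [hp]
  have hpv : p v = -g a := by simp [hp, (h.ne a).symm]
  have hpc : p (x c) = g c - g a := by simp [hp, hac.symm, h.ne c]
  have hva : v ≠ x a := (h.ne a).symm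
  have hs : ∀ i, NearE (x a) (g a - g b) p (v, x i, g i) := by
    intro i
    rcases habc i with rfl | rfl | rfl
    · refine ⟨fun _ h' => (h' rfl).elim, fun h' => (hva h').elim, fun _ _ => Or.inl ?_,
        fun h' => (hva h').elim⟩
      simp only [defect, hpa, hpv]; ring
    · refine ⟨fun _ h' => (h' hab.symm).elim, fun h' => (hva h').elim, fun _ _ => Or.inr ?_,
        fun h' => (hva h').elim⟩
      simp only [defect, ← hab, hpa, hpv]; ring
    · refine ⟨fun _ _ => ?_, fun h' => (hva h').elim, fun _ h' => (hac h'.symm).elim,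
        fun h' => (hva h').elim⟩
      simp only [defect, hpc, hpv]; ring
  have haa : ∀ t, t = 0 ∨ t = g a - g b ∨ t = -(g a - g b) → NearE (x a) (g a - g b) p
      (x a, x a, t) := fun t ht =>
    ⟨fun h' => (h' rfl).elim, fun _ h' => (h' rfl).elim, fun h' => (h' rfl).elim, fun _ _ => ht⟩
  have hac' : ∀ t, t = g c - g a ∨ t = g c - g b → NearE (x a) (g a - g b) p (x a, x c, t) := by
    intro t ht
    refine ⟨fun h' => (h' rfl).elim, fun _ _ => ?_, fun h' => (h' rfl).elim,
      fun _ h' => (hac h'.symm).elim⟩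
    simp only [defect, hpc, hpa]
    rcases ht with rfl | rfl
    · left; ring
    · right; ring
  have hca : ∀ t, t = g a - g c ∨ t = g b - g c → NearE (x a) (g a - g b) p (x c, x a, t) := by
    intro t ht
    have := nearE_rev (hac' (-t) (by rcases ht with rfl | rfl <;> simp))
    simpa [rev] using this
  refine ⟨p, fun e he => ?_⟩
  rcases h.cases e he with ⟨i, rfl | rfl⟩ | ⟨i, i', hne, rfl⟩
  · exact hs i
  · exact nearE_rev (hs i)
  · rcases habc i with rfl | rfl | rfl <;> rcases habc i' with rfl | rfl | rfl <;>
      first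
      | exact (hne rfl).elim
      | (try simp only [← hab]
         first
         | (apply haa; simp)
         | (apply hac'; simp)
         | (apply hca; simp))

theorem conclusion_of_pair [Fintype V] [NeZero k] (h : Star Φ j I S K v x g) {a b c : Fin 3}
    (hne : a ≠ b) (hca : a ≠ c) (hcb : b ≠ c)
    (habc : ∀ i, i = a ∨ i = b ∨ i = c) (hab : x a = x b) (hac : x a ≠ x c) :
    x c ∈ Φ ∧ Even k ∧ Odd j ∧ g b - g a = ((k / 2 : ℕ) : ZMod k) := by
  have hxa := h.parallel a b hne hab
  have hva : v ≠ x a := (h.ne a).symm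
  have hy : g b - g a ≠ 0 := sub_ne_zero.2 (h.gain_ne a b hne hab).symm
  have hnear := h.near habc hab hac
  have hst : g c - g a ≠ g c - g b := fun h' => hy (by linear_combination h')
  have hbal : ∀ m : ZMod k, m * (g b - g a) = 0 → Bal Φ m K := fun m hm =>
    bal_of_near hnear (by linear_combination -hm)
  have hℓ : ∃ i i', i ≠ i' ∧ (x a, x a, g b - g a) = (x i, x i', g i' - g i) :=
    ⟨a, b, hne, by rw [← hab]⟩
  have he1 : ∃ i i', i ≠ i' ∧ (x a, x c, g c - g a) = (x i, x i', g i' - g i) := ⟨a, c, hca, rfl⟩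
  have he2 : ∃ i i', i ≠ i' ∧ (x a, x c, g c - g b) = (x i, x i', g i' - g i) :=
    ⟨b, c, hcb, by rw [← hab]⟩
  have hl1 : (x a, x a, g b - g a) ≠ (x a, x c, g c - g a) := by simp [hac]
  have hl2 : (x a, x a, g b - g a) ≠ (x a, x c, g c - g b) := by simp [hac]
  have h12 : (x a, x c, g c - g a) ≠ (x a, x c, g c - g b) := by simpa using hst
  by_cases hxc : x c ∈ Φ
  · have hT := h.cnt_le (T := {v, x a}) (by simp) fun i hi => by
      rcases habc i with rfl | rfl | rfl
      · simp
      · simp [hab]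
      · exact (hi hxc).elim
    rw [Finset.card_pair hva] at hT
    by_cases hj0 : (j : ZMod k) * (g b - g a) = 0
    · exfalso
      have hd := balInd_of (hbal _ hj0)
      rw [← dof_of_touches (h.touches hxc)] at hd
      refine h.elim (J := {(x a, x c, g c - g a)}) (indep_of_loop_fixed hxa hxc (r := g b - g a)
        (s := g c - g a) (by simp) fun h' => (hl1 (Finset.mem_singleton.1 h')).elim) ?_ ?_
      · intro e he
        rw [Finset.mem_singleton] at he
        exact he ▸ he1
      · rw [Finset.card_singleton]; push_cast at *; omega
    · by_cases hk : KilledTwice j (g b - g a)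
      · have := eq_half_of_two_mul hk.two_mul hy
        exact ⟨hxc, this.1, odd_of_two_mul hk.two_mul hj0, this.2⟩
      · exfalso
        refine h.elim (J := {(x a, x a, g b - g a), (x a, x c, g c - g a)})
          (indep_of_loop_fixed hxa hxc subset_rfl fun _ => ⟨hy, hk, hj0⟩) ?_ ?_
        · intro e he
          rw [Finset.mem_insert, Finset.mem_singleton] at he
          rcases he with rfl | rfl <;> assumption
        · have := @dof_nonneg V _ k Φ j K
          rw [Finset.card_pair hl1]; push_cast at *; omega
  · exfalso
    have hnt := h.not_touches (fun i => by
      rcases habc i with rfl | rfl | rfl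
      · exact hxa
      · rwa [← hab]
      · exact hxc)
    have hT := h.cnt_le (T := {v, x a, x c}) (by simp) fun i _ => by
      rcases habc i with rfl | rfl | rfl <;> simp [hab]
    have hcard : ({v, x a, x c} : Finset V).card = 3 :=
      Finset.card_eq_three.2 ⟨_, _, _, hva, (h.ne c).symm, hac, rfl⟩
    rw [hcard] at hT
    by_cases hk : KilledTwice j (g b - g a)
    · refine h.elim (J := {(x a, x c, g c - g a), (x a, x c, g c - g b)})
        (indep_of_loop_parallel h.card_le hxa hxc hac (r := g b - g a) hst (by simp)
          fun h' => ?_) ?_ ?_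
      · rw [Finset.mem_insert, Finset.mem_singleton] at h'
        rcases h' with h' | h' <;> contradiction
      · intro e he
        rw [Finset.mem_insert, Finset.mem_singleton] at he
        rcases he with rfl | rfl <;> assumption
      · have h1 := balInd_of (hbal _ hk.1)
        have h2 := balInd_of (hbal _ hk.2)
        have h3 := @balInd_nonneg V _ k Φ K j
        have h4 := balSum_le_dof (j := j) hnt
        unfold balSum at h4
        rw [Finset.card_pair h12]; push_cast at *; omega
    · refine h.elim (J := {(x a, x a, g b - g a), (x a, x c, g c - g a), (x a, x c, g c - g b)})
        (indep_of_loop_parallel h.card_le hxa hxc hac hst subset_rfl fun _ => ⟨hy, hk⟩) ?_ ?_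
      · intro e he
        simp only [Finset.mem_insert, Finset.mem_singleton] at he
        rcases he with rfl | rfl | rfl <;> assumption
      · have h4 := one_le_dof_of_near (j := j) hnt hnear
        rw [Finset.card_eq_three.2 ⟨_, _, _, hl1, hl2, h12, rfl⟩]
        push_cast at *; omega

theorem false_of_injective [Fintype V] [NeZero k] (h : Star Φ j I S K v x g)
    (hx : Function.Injective x) : False := by
  have hpx : ∀ i, Function.extend x g 0 (x i) = g i := fun i => hx.extend_apply g 0 i
  have hpv : Function.extend x g 0 v = 0 :=
    Function.extend_apply' _ _ _ fun ⟨i, hi⟩ => h.ne i hi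
  have hbal : ∀ m : ZMod k, Bal Φ m K := fun m =>
    h.bal (p := fun y => m * Function.extend x g 0 y) fun i _ => by rw [hpx, hpv]; ring
  have n01 : x 0 ≠ x 1 := fun h' => absurd (hx h') (by decide)
  have n02 : x 0 ≠ x 2 := fun h' => absurd (hx h') (by decide)
  have n12 : x 1 ≠ x 2 := fun h' => absurd (hx h') (by decide)
  refine h.elim (indep_triangle h.card_le n01 n02 n12 (g 1 - g 0) (g 2 - g 0) (g 2 - g 1)) ?_ ?_
  · intro e he
    simp only [Finset.mem_insert, Finset.mem_singleton] at he
    rcases he with rfl | rfl | rfl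
    · exact ⟨0, 1, by decide, rfl⟩
    · exact ⟨0, 2, by decide, rfl⟩
    · exact ⟨1, 2, by decide, rfl⟩
  · rw [Finset.card_eq_three.2 ⟨_, _, _, by simp [n12], by simp [n01], by simp [n01], rfl⟩]
    have hd : ∀ i, x i ∈ Φ → cnt Φ j K ≤ 5 := by
      intro i hi
      have hd := balInd_of (hbal j)
      rw [← dof_of_touches (h.touches hi)] at hd
      have hT := h.cnt_le (T := insert v ((Finset.univ.erase i).image x)) (by simp) fun i' hi' => by
        refine Finset.mem_insert_of_mem (Finset.mem_image_of_mem _ (Finset.mem_erase.2 ⟨?_, ?_⟩))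
        · rintro rfl; exact hi' hi
        · exact Finset.mem_univ _
      have h1 := Finset.card_insert_le v ((Finset.univ.erase i).image x)
      have h2 := Finset.card_image_le (f := x) (s := Finset.univ.erase i)
      rw [Finset.card_erase_of_mem (Finset.mem_univ _), Finset.card_univ, Fintype.card_fin] at h2
      omega
    by_cases hΦ : ∃ i, x i ∈ Φ
    · obtain ⟨i, hi⟩ := hΦ
      exact hd i hi
    · push Not at hΦ
      have hd := dof_of_bal_one (j := j) (h.not_touches hΦ) (hbal 1)
      have hT := h.cnt_le (T := insert v (Finset.univ.image x)) (by simp) fun i' _ => by simp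
      have h1 := Finset.card_insert_le v (Finset.univ.image x)
      have h2 := Finset.card_image_le (f := x) (s := Finset.univ)
      rw [Finset.card_univ, Fintype.card_fin] at h2
      push_cast
      omega

theorem false_of_const [Fintype V] [NeZero k] (h : Star Φ j I S K v x g)
    (hx : ∀ i, x i = x 0) : False := by
  have hz : x 0 ∉ Φ := h.parallel 0 1 (by decide) (hx 1).symm
  have hΦ : ∀ i, x i ∉ Φ := fun i => by rwa [hx]
  have hnt := h.not_touches hΦ
  have hT := h.cnt_le (T := {v, x 0}) (by simp) fun i _ => by simp [hx i]
  rw [Finset.card_pair (h.ne 0).symm] at hT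
  set y : Fin 3 → ZMod k := fun i => g (i + 1) - g i with hy
  have hs : y 0 + y 1 + y 2 = 0 := by
    change (g 1 - g 0) + (g 2 - g 1) + (g 0 - g 2) = 0
    ring
  have h0 : ∀ i, y i ≠ 0 := fun i => sub_ne_zero.2
    (h.gain_ne (i + 1) i (by revert i; decide) (by rw [hx, hx i]))
  have hcand : ∀ i, ∃ a b, a ≠ b ∧ (x 0, x 0, y i) = (x a, x b, g b - g a) := fun i =>
    ⟨i, i + 1, by revert i; decide, by rw [hx i, hx (i + 1)]⟩
  by_cases hm : ∃ m : ZMod k, (m = j - 1 ∨ m = j ∨ m = j + 1) ∧ ∀ i, m * y i = 0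
  · obtain ⟨m, hm, hmy⟩ := hm
    have hbal : Bal Φ m K := h.bal (p := fun z => if z = x 0 then m * g 0 else 0) fun i _ => by
      rw [hx i, if_pos rfl, if_neg (h.ne 0).symm]
      have h1 : m * (g 1 - g 0) = 0 := hmy 0
      have h2 : m * (g 2 - g 1) = 0 := hmy 1
      fin_cases i
      · change m * g 0 = m * g 0 - 0; ring
      · change m * g 1 = m * g 0 - 0; linear_combination h1
      · change m * g 2 = m * g 0 - 0; linear_combination h1 + h2
    have hd : 1 ≤ dof Φ j K := by
      have h1 := balInd_of hbal
      have h2 := balSum_le_dof (j := j) hnt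
      have n : ∀ m : ZMod k, 0 ≤ balInd Φ m K := fun m => balInd_nonneg
      have := n (j - 1); have := n j; have := n (j + 1)
      unfold balSum at h2
      rcases hm with rfl | rfl | rfl <;> omega
    obtain ⟨i, hi⟩ : ∃ i, ¬ KilledTwice j (y i) := by
      by_contra! hc
      have := eq_of_two_mul (hc 0).two_mul (h0 0) (hc 1).two_mul (h0 1)
      exact h0 2 (by linear_combination hs + this - (hc 0).two_mul)
    refine h.elim (indep_singleton_loop hz (h0 i) hi) ?_ ?_
    · intro e he
      rw [Finset.mem_singleton] at he
      exact he ▸ hcand i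
    · rw [Finset.card_singleton]; push_cast at *; omega
  · push Not at hm
    obtain ⟨i, i', hne, hi, hi', hii⟩ := exists_pair_not_killedTwice h0 hs
      fun m hm' => by simpa using hm m hm'
    obtain ⟨l, hli, hl⟩ : ∃ l, (l ≠ i ∧ l ≠ i') ∧ ∀ n, n = i ∨ n = i' ∨ n = l := by
      clear hi hi' hii; revert i i'; decide
    have hsum : y i + y i' + y l = 0 := by
      have hu : (Finset.univ : Finset (Fin 3)) = {i, i', l} := by
        ext n; simpa using hl n
      have hsum := Fin.sum_univ_three y
      rw [hu, Finset.sum_insert (by simp [hne, hli.1.symm]), Finset.sum_pair hli.2.symm] at hsum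
      linear_combination hsum + hs
    refine h.elim (indep_pair_loops hz (h0 i) (h0 i') hi hi' hii
      (fun h' => h0 l (by linear_combination hsum - h')) fun m hm' hmm => ?_) ?_ ?_
    · obtain ⟨n, hn⟩ := hm m hm'
      rcases hl n with rfl | rfl | rfl
      · exact hn hmm.1
      · exact hn hmm.2
      · exact hn (by linear_combination m * hsum - hmm.1 - hmm.2)
    · intro e he
      rw [Finset.mem_insert, Finset.mem_singleton] at he
      rcases he with rfl | rfl
      exacts [hcand i, hcand i']
    · have := @dof_nonneg V _ k Φ j K
      rw [Finset.card_pair (by simpa using hii)]; push_cast; omega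

theorem conclusion [Fintype V] [NeZero k] (h : Star Φ j I S K v x g) :
    ∃ a b c : Fin 3, a ≠ b ∧ (∀ i, i = a ∨ i = b ∨ i = c) ∧ x a = x b ∧ x a ≠ x c ∧ x a ∉ Φ ∧
      x c ∈ Φ ∧ Even k ∧ Odd j ∧ g b - g a = ((k / 2 : ℕ) : ZMod k) := by
  have key : ∀ a b c : Fin 3, a ≠ b → a ≠ c → b ≠ c → x a = x b → x a ≠ x c →
      ∃ a b c : Fin 3, a ≠ b ∧ (∀ i, i = a ∨ i = b ∨ i = c) ∧ x a = x b ∧ x a ≠ x c ∧ x a ∉ Φ ∧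
        x c ∈ Φ ∧ Even k ∧ Odd j ∧ g b - g a = ((k / 2 : ℕ) : ZMod k) := by
    intro a b c hab hac hbc e1 e2
    have habc : ∀ i, i = a ∨ i = b ∨ i = c := by clear e1 e2; revert a b c; decide
    exact ⟨a, b, c, hab, habc, e1, e2, h.parallel a b hab e1,
      h.conclusion_of_pair hab hac hbc habc e1 e2⟩
  by_cases h01 : x 0 = x 1
  · by_cases h02 : x 0 = x 2
    · refine (h.false_of_const fun i => ?_).elim
      fin_cases i
      exacts [rfl, h01.symm, h02.symm]
    · exact key 0 1 2 (by decide) (by decide) (by decide) h01 h02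
  · by_cases h02 : x 0 = x 2
    · exact key 0 2 1 (by decide) (by decide) (by decide) h02 h01
    · by_cases h12 : x 1 = x 2
      · exact key 1 2 0 (by decide) (by decide) (by decide) h12 fun h' => h01 h'.symm
      · refine (h.false_of_injective fun a b hab => ?_).elim
        fin_cases a <;> fin_cases b <;> simp_all

end Star
end StarConclusion

section Walks

variable {V E : Type} [DecidableEq V] [DecidableEq E] {k : ℕ}
  {G : GainedGraph V E (Multiplicative (ZMod k))} {H : Subgraph G} {m : ZMod k}

/-- The labelled edge underlying an edge of `G`. -/
def lab (G : GainedGraph V E (Multiplicative (ZMod k))) (e : E) : LEdge V k :=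
  (G.tail e, G.head e, (G.gain e).toAdd)

/-- The labelled edge traversed by a step. -/
def stepLab (G : GainedGraph V E (Multiplicative (ZMod k))) (s : E × Bool) : LEdge V k :=
  (stepStart G s, stepEnd G s, (stepGain G s).toAdd)

theorem stepLab_true (e : E) : stepLab G (e, true) = lab G e := by
  simp [stepLab, lab, stepStart, stepEnd, stepGain]

theorem stepLab_false (e : E) : stepLab G (e, false) = rev (lab G e) := by
  simp [stepLab, lab, stepStart, stepEnd, stepGain, rev]

theorem stepLab_not (e : E) (b : Bool) : stepLab G (e, !b) = rev (stepLab G (e, b)) := by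
  cases b
  · rw [Bool.not_false, stepLab_true, stepLab_false, rev_rev]
  · rw [Bool.not_true, stepLab_true, stepLab_false]

theorem stepStart_not (e : E) (b : Bool) : stepStart G (e, !b) = stepEnd G (e, b) :=
  congrArg Prod.fst (stepLab_not (G := G) e b)

theorem stepEnd_not (e : E) (b : Bool) : stepEnd G (e, !b) = stepStart G (e, b) :=
  congrArg (fun l => l.2.1) (stepLab_not (G := G) e b)

theorem stepGain_not (e : E) (b : Bool) : stepGain G (e, !b) = (stepGain G (e, b))⁻¹ := by
  cases b <;> simp [stepGain]

theorem stepStart_mem {s : E × Bool} (h : s.1 ∈ H.edges) : stepStart G s ∈ H.verts := by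
  unfold stepStart
  split_ifs
  exacts [H.tail_mem _ h, H.head_mem _ h]

theorem stepEnd_mem {s : E × Bool} (h : s.1 ∈ H.edges) : stepEnd G s ∈ H.verts := by
  unfold stepEnd
  split_ifs
  exacts [H.head_mem _ h, H.tail_mem _ h]

theorem IsWalk.append {L M : List (E × Bool)} {u w y : V} (h : IsWalk G H L u w)
    (h' : IsWalk G H M w y) : IsWalk G H (L ++ M) u y := by
  induction L generalizing u with
  | nil => obtain ⟨rfl, _⟩ := h; exact h'
  | cons s L ih => exact ⟨h.1, h.2.1, ih h.2.2⟩

theorem isWalk_singleton {s : E × Bool} (h : s.1 ∈ H.edges) :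
    IsWalk G H [s] (stepStart G s) (stepEnd G s) :=
  ⟨h, rfl, rfl, stepEnd_mem h⟩

theorem walkGain_cons (s : E × Bool) (L : List (E × Bool)) :
    (walkGain G (s :: L)).toAdd = (stepGain G s).toAdd + (walkGain G L).toAdd := by
  simp [walkGain]

theorem walkGain_append (L M : List (E × Bool)) :
    (walkGain G (L ++ M)).toAdd = (walkGain G L).toAdd + (walkGain G M).toAdd := by
  simp [walkGain]

theorem walkGain_nil : (walkGain G []).toAdd = 0 := by simp [walkGain]

/-- `w` is reached from `u` by a walk of total gain `g` without fixed vertices. -/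
def FreeWalk (G : GainedGraph V E (Multiplicative (ZMod k))) (H : Subgraph G) (u w : V)
    (g : ZMod k) : Prop :=
  ∃ L, IsWalk G H L u w ∧ (∀ x ∈ walkVerts G u L, x ∉ G.fixed) ∧ (walkGain G L).toAdd = g

theorem FreeWalk.trans {u w y : V} {g g' : ZMod k} (h : FreeWalk G H u w g)
    (h' : FreeWalk G H w y g') : FreeWalk G H u y (g + g') := by
  obtain ⟨L, h1, h2, rfl⟩ := h
  obtain ⟨M, h3, h4, rfl⟩ := h'
  refine ⟨L ++ M, h1.append h3, fun x hx => ?_, walkGain_append _ _⟩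
  simp only [walkVerts, List.map_append, List.mem_cons, List.mem_append] at hx h2 h4
  rcases hx with hx | hx | hx
  exacts [h2 x (Or.inl hx), h2 x (Or.inr hx), h4 x (Or.inr hx)]

theorem freeWalk_step {s : E × Bool} (h : s.1 ∈ H.edges) (h1 : stepStart G s ∉ G.fixed)
    (h2 : stepEnd G s ∉ G.fixed) :
    FreeWalk G H (stepStart G s) (stepEnd G s) (stepGain G s).toAdd := by
  refine ⟨[s], isWalk_singleton h, fun x hx => ?_, by rw [walkGain_cons, walkGain_nil, add_zero]⟩
  simp only [walkVerts, List.map_cons, List.map_nil, List.mem_cons, List.not_mem_nil,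
    or_false] at hx
  rcases hx with rfl | rfl <;> assumption

theorem FreeWalk.symm {u w : V} {g : ZMod k} (h : FreeWalk G H u w g) :
    FreeWalk G H w u (-g) := by
  obtain ⟨L, h1, h2, rfl⟩ := h
  induction L generalizing u with
  | nil =>
    obtain ⟨rfl, h1⟩ := h1
    exact ⟨[], ⟨rfl, h1⟩, h2, by simp [walkGain_nil]⟩
  | cons s L ih =>
    obtain ⟨a, rfl, b⟩ := h1
    have h3 := ih b fun x hx => h2 x (List.mem_cons_of_mem _ (by simpa [walkVerts] using hx))
    have h4 := freeWalk_step (G := G) (H := H) (s := (s.1, !s.2)) a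
      (by rw [stepStart_not]; exact h2 _ (by simp [walkVerts]))
      (by rw [stepEnd_not]; exact h2 _ (by simp [walkVerts]))
    rw [stepStart_not, stepEnd_not, stepGain_not] at h4
    have := h3.trans h4
    rwa [toAdd_inv, ← neg_add_rev, ← walkGain_cons] at this

/-- A groupoid-like relation all of whose closed walks are killed by `m` has a potential. -/
theorem exists_potential {W : V → V → ZMod k → Prop} (hsymm : ∀ u w g, W u w g → W w u (-g))
    (htrans : ∀ u w y g g', W u w g → W w y g' → W u y (g + g'))
    (hm : ∀ u g, W u u g → m * g = 0) :
    ∃ p : V → ZMod k, ∀ u w g, W u w g → m * g = p w - p u := by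
  let R : Setoid V :=
    { r := fun u w => u = w ∨ ∃ g, W u w g
      iseqv :=
        { refl := fun _ => Or.inl rfl
          symm := by
            rintro u w (rfl | ⟨g, h⟩)
            exacts [Or.inl rfl, Or.inr ⟨_, hsymm _ _ _ h⟩]
          trans := by
            rintro u w y (rfl | ⟨g, h⟩) (rfl | ⟨g', h'⟩)
            exacts [Or.inl rfl, Or.inr ⟨_, h'⟩, Or.inr ⟨_, h⟩, Or.inr ⟨_, htrans _ _ _ _ _ h h'⟩] } }
  let r : V → V := fun u => (Quotient.mk R u).out
  let p : V → ZMod k := fun u => if h : ∃ g, W (r u) u g then m * h.choose else 0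
  have hp : ∀ u g, W (r u) u g → p u = m * g := by
    intro u g hg
    have h : ∃ g, W (r u) u g := ⟨g, hg⟩
    have := hm _ _ (htrans _ _ _ _ _ h.choose_spec (hsymm _ _ _ hg))
    simp only [p, dif_pos h]
    linear_combination this
  have hr : ∀ u w g, W u w g → ∃ g, W (r u) u g := by
    intro u w g h
    have : r u = u ∨ ∃ g, W (r u) u g := Quotient.mk_out (s := R) u
    rcases this with h' | h'
    · rw [h']; exact ⟨_, htrans _ _ _ _ _ h (hsymm _ _ _ h)⟩
    · exact h'
  refine ⟨p, fun u w g h => ?_⟩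
  obtain ⟨a, ha⟩ := hr u w g h
  have hrr : r u = r w := by
    simp only [r]
    rw [Quotient.sound (s := R) (Or.inr ⟨g, h⟩)]
  have hb := htrans _ _ _ _ _ ha h
  rw [hp u a ha, hp w (a + g) (hrr ▸ hb)]
  ring

theorem mul_walkGain_of_bal {p : V → ZMod k}
    (hp : ∀ e ∈ H.edges, BalE G.fixed m p (lab G e)) {L : List (E × Bool)} {u w : V}
    (h : IsWalk G H L u w) (hL : ∀ x ∈ walkVerts G u L, x ∉ G.fixed) :
    m * (walkGain G L).toAdd = p w - p u := by
  induction L generalizing u with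
  | nil => obtain ⟨rfl, _⟩ := h; rw [walkGain_nil]; ring
  | cons s L ih =>
    obtain ⟨a, rfl, b⟩ := h
    have h1 := ih b fun x hx => hL x (List.mem_cons_of_mem _ (by simpa [walkVerts] using hx))
    have h2 : BalE G.fixed m p (stepLab G s) := by
      obtain ⟨e, _ | _⟩ := s
      · rw [stepLab_false]; exact balE_rev (hp e a)
      · rw [stepLab_true]; exact hp e a
    have h3 := h2 (hL _ (by simp [walkVerts, stepLab])) (hL _ (by simp [walkVerts, stepLab]))
    simp only [stepLab] at h3
    rw [walkGain_cons]
    linear_combination h1 + h3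

theorem bal_iff_gainGroup :
    Bal G.fixed m (H.edges.image (lab G)) ↔ ∀ g ∈ gainGroup G H, m * g.toAdd = 0 := by
  constructor
  · rintro ⟨p, hp⟩ g hg
    refine Subgroup.closure_induction (p := fun g _ => m * g.toAdd = 0) ?_ (by simp) ?_ ?_ hg
    · rintro g ⟨u, L, h1, h2, rfl⟩
      rw [mul_walkGain_of_bal (p := p) (fun e he => hp _ (Finset.mem_image_of_mem _ he)) h1 h2,
        sub_self]
    · intro a b _ _ ha hb; rw [toAdd_mul, mul_add, ha, hb, add_zero]
    · intro a _ ha; rw [toAdd_inv, mul_neg, ha, neg_zero]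
  · intro h
    obtain ⟨p, hp⟩ := exists_potential (m := m) (W := FreeWalk G H) (fun _ _ _ h => h.symm)
      (fun _ _ _ _ _ h h' => h.trans h') (by
        rintro u g ⟨L, h1, h2, rfl⟩
        exact h _ (Subgroup.subset_closure ⟨u, L, h1, h2, rfl⟩))
    refine ⟨p, fun l hl a b => ?_⟩
    obtain ⟨e, he, rfl⟩ := Finset.mem_image.1 hl
    rw [← stepLab_true] at a b ⊢
    exact hp _ _ _ (freeWalk_step (s := (e, true)) he a b)

end Walks

section NearBalance

variable {V E : Type} [DecidableEq V] [DecidableEq E] {k : ℕ}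
  {G : GainedGraph V E (Multiplicative (ZMod k))} {H : Subgraph G} {m : ZMod k}

theorem nearE_stepLab {u : V} {δ : ZMod k} {p : V → ZMod k}
    (hp : ∀ e ∈ H.edges, NearE u δ p (lab G e)) {s : E × Bool} (hs : s.1 ∈ H.edges) :
    NearE u δ p (stepLab G s) := by
  obtain ⟨e, _ | _⟩ := s
  · rw [stepLab_false]; exact nearE_rev (hp e hs)
  · rw [stepLab_true]; exact hp e hs

theorem walkGain_return {u : V} {δ : ZMod k} {p : V → ZMod k}
    (hp : ∀ e ∈ H.edges, NearE u δ p (lab G e)) {L : List (E × Bool)} {w : V} (hw : w ≠ u)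
    (h : IsWalk G H L w u) (hL : ∀ x ∈ (L.map (stepEnd G)).dropLast, x ≠ u) :
    (walkGain G L).toAdd = p u - p w ∨ (walkGain G L).toAdd = p u - p w - δ := by
  induction L generalizing w with
  | nil => exact (hw h.1).elim
  | cons s L ih =>
    obtain ⟨a, rfl, b⟩ := h
    obtain ⟨h1, -, h3, -⟩ := nearE_stepLab hp a
    simp only [stepLab, defect] at h1 h3
    cases L with
    | nil =>
      have hb := b.1
      rw [walkGain_cons, walkGain_nil, add_zero]
      rw [hb] at h3
      rcases h3 hw rfl with h | h
      · left; linear_combination h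
      · right; linear_combination h
    | cons s' L =>
      have hne : stepEnd G s ≠ u := hL _ (by simp)
      rw [walkGain_cons]
      have h0 := h1 hw hne
      rcases ih hne b fun x hx => hL x (by simp only [List.map_cons, List.dropLast_cons_cons] at hx ⊢
                                           exact List.mem_cons_of_mem _ hx) with h | h
      · left; linear_combination h + h0
      · right; linear_combination h + h0

theorem nearBalanced_of_near (hf : NoFixed G H) (hb : ¬ Balanced G H) {u : V} {δ : ZMod k}
    (h : Near u δ (H.edges.image (lab G))) : NearBalanced G H := by
  obtain ⟨p, hp'⟩ := h
  have hp : ∀ e ∈ H.edges, NearE u δ p (lab G e) := fun e he => hp' _ (Finset.mem_image_of_mem _ he)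
  have hu : u ∈ H.verts := by
    by_contra hu
    refine hb ((Subgroup.eq_bot_iff_forall _).2 fun g hg => ?_)
    have h1 : Bal G.fixed 1 (H.edges.image (lab G)) := by
      refine ⟨p, fun l hl _ _ => ?_⟩
      obtain ⟨e, he, rfl⟩ := Finset.mem_image.1 hl
      have := (hp e he).1 (fun h => hu (h ▸ H.tail_mem e he)) (fun h => hu (h ▸ H.head_mem e he))
      rw [one_mul]
      exact sub_eq_zero.1 this
    simpa using bal_iff_gainGroup.1 h1 g hg
  refine ⟨hf, u, hu, Multiplicative.ofAdd δ, hb, fun L hL hL' => ?_⟩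
  suffices (walkGain G L).toAdd = 0 ∨ (walkGain G L).toAdd = δ ∨ (walkGain G L).toAdd = -δ by
    rcases this with h | h | h
    · left; exact Multiplicative.toAdd.injective h
    · right; left; exact Multiplicative.toAdd.injective h
    · right; right; exact Multiplicative.toAdd.injective h
  cases L with
  | nil => left; exact walkGain_nil
  | cons s L =>
    obtain ⟨a, h0, b⟩ := hL
    obtain ⟨-, h2, -, h4⟩ := nearE_stepLab hp a
    simp only [stepLab, defect, h0] at h2 h4
    cases L with
    | nil => rw [walkGain_cons, walkGain_nil, add_zero]; exact h4 trivial b.1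
    | cons s' L =>
      have hne : stepEnd G s ≠ u := hL' _ (by simp)
      rw [walkGain_cons]
      rcases walkGain_return hp hne b fun x hx => hL' x (by
          simp only [List.map_cons, List.dropLast_cons_cons] at hx ⊢
          exact List.mem_cons_of_mem _ hx) with h | h <;> rcases h2 trivial hne with h' | h'
      · left; linear_combination h + h'
      · right; left; linear_combination h + h'
      · right; right; linear_combination h + h'
      · left; linear_combination h + h'

/-- `g` is the gain of a walk from `v` to `w` which does not come back to `v`. -/
def Away (G : GainedGraph V E (Multiplicative (ZMod k))) (H : Subgraph G) (v w : V)
    (g : ZMod k) : Prop :=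
  ∃ L, IsWalk G H L v w ∧ (∀ s ∈ L, stepEnd G s ≠ v) ∧ (walkGain G L).toAdd = g

/-- `g` is the gain of a walk from `w` to `v` which meets `v` only at its end. -/
def Back (G : GainedGraph V E (Multiplicative (ZMod k))) (H : Subgraph G) (v w : V)
    (g : ZMod k) : Prop :=
  ∃ L, IsWalk G H L w v ∧ (∀ x ∈ (L.map (stepEnd G)).dropLast, x ≠ v) ∧ (walkGain G L).toAdd = g

theorem Back.step {v : V} {g : ZMod k} {s : E × Bool} (hs : s.1 ∈ H.edges)
    (hv : stepStart G s ≠ v) (h : Back G H v (stepStart G s) g) :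
    Back G H v (stepEnd G s) (g - (stepGain G s).toAdd) := by
  obtain ⟨L, h1, h2, rfl⟩ := h
  refine ⟨(s.1, !s.2) :: L, ⟨hs, stepStart_not _ _, by rwa [stepEnd_not]⟩, ?_, ?_⟩
  · cases L with
    | nil => simp
    | cons s' L =>
      intro x hx
      rw [List.map_cons, List.map_cons, List.dropLast_cons_cons, ← List.map_cons] at hx
      rcases List.mem_cons.1 hx with rfl | hx
      · rwa [stepEnd_not]
      · exact h2 x hx
  · rw [walkGain_cons, stepGain_not, toAdd_inv]; ring

theorem Back.of_walk {v u w : V} {g : ZMod k} {L : List (E × Bool)} (hu : u ≠ v)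
    (h : Back G H v u g) (hL : IsWalk G H L u w) (hv : ∀ s ∈ L, stepEnd G s ≠ v) :
    Back G H v w (g - (walkGain G L).toAdd) := by
  induction L generalizing u g with
  | nil => obtain ⟨rfl, _⟩ := hL; rwa [walkGain_nil, sub_zero]
  | cons s L ih =>
    obtain ⟨a, rfl, b⟩ := hL
    have := ih (hv s (by simp)) (h.step a hu) b fun s hs => hv s (List.mem_cons_of_mem _ hs)
    rwa [sub_sub, ← walkGain_cons] at this

theorem Away.back {v w : V} {g : ZMod k} (h : Away G H v w g) (hw : w ≠ v) :
    Back G H v w (-g) := by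
  obtain ⟨L, h1, h2, rfl⟩ := h
  cases L with
  | nil => exact (hw h1.1.symm).elim
  | cons s L =>
    obtain ⟨a, h0, b⟩ := h1
    have h3 : Back G H v (stepEnd G s) (-(stepGain G s).toAdd) := by
      refine ⟨[(s.1, !s.2)], ⟨a, stepStart_not _ _, ?_, ?_⟩, by simp, ?_⟩
      · rw [stepEnd_not, h0]
      · rw [stepEnd_not]; exact stepStart_mem a
      · rw [walkGain_cons, walkGain_nil, stepGain_not, toAdd_inv, add_zero]
    have := h3.of_walk (h2 s (by simp)) b fun s hs => h2 s (List.mem_cons_of_mem _ hs)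
    rwa [← neg_add', ← walkGain_cons] at this

theorem Away.step {v : V} {g : ZMod k} {s : E × Bool} (hs : s.1 ∈ H.edges)
    (h : Away G H v (stepStart G s) g) (hv : stepEnd G s ≠ v) :
    Away G H v (stepEnd G s) (g + (stepGain G s).toAdd) := by
  obtain ⟨L, h1, h2, rfl⟩ := h
  refine ⟨L ++ [s], h1.append (isWalk_singleton hs), fun s' hs' => ?_, ?_⟩
  · rcases List.mem_append.1 hs' with h' | h'
    · exact h2 _ h'
    · rw [List.mem_singleton.1 h']; exact hv
  · rw [walkGain_append, walkGain_cons, walkGain_nil, add_zero]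

theorem away_self {v : V} (hv : v ∈ H.verts) : Away G H v v 0 :=
  ⟨[], ⟨rfl, hv⟩, by simp, walkGain_nil⟩

theorem exists_away {v w : V} (h : Reachable G H v w) : ∃ g, Away G H v w g := by
  obtain ⟨L, hL⟩ := h
  have key : ∀ (L : List (E × Bool)) (u : V), IsWalk G H L u w →
      (∃ L', IsWalk G H L' u w ∧ ∀ s ∈ L', stepEnd G s ≠ v) ∨ ∃ g, Away G H v w g := by
    intro L
    induction L with
    | nil => intro u h; exact Or.inl ⟨[], h, by simp⟩
    | cons s L ih =>
      rintro u ⟨a, b, c⟩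
      rcases ih _ c with ⟨L', h1, h2⟩ | h
      · by_cases hs : stepEnd G s = v
        · exact Or.inr ⟨_, L', hs ▸ h1, h2, rfl⟩
        · exact Or.inl ⟨s :: L', ⟨a, b, h1⟩, List.forall_mem_cons.2 ⟨hs, h2⟩⟩
      · exact Or.inr h
  rcases key L v hL with ⟨L', h1, h2⟩ | h
  exacts [⟨_, L', h1, h2, rfl⟩, h]

section Base

variable {v : V} {d : ZMod k}
  (hv : ∀ L, IsWalk G H L v v → (∀ x ∈ (L.map (stepEnd G)).dropLast, x ≠ v) →
    (walkGain G L).toAdd = 0 ∨ (walkGain G L).toAdd = d ∨ (walkGain G L).toAdd = -d)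
include hv

theorem away_sub {w : V} {a b : ZMod k} (ha : Away G H v w a) (hb : Away G H v w b)
    (hw : w ≠ v) : a - b = 0 ∨ a - b = d ∨ a - b = -d := by
  obtain ⟨L, h1, h2, rfl⟩ := ha
  obtain ⟨M, h3, h4, h5⟩ := hb.back hw
  have := hv (L ++ M) (h1.append h3) (fun x hx => by
    cases M with
    | nil => exact (hw h3.1).elim
    | cons s M =>
      rw [List.map_append, List.dropLast_append_of_ne_nil (by simp), List.mem_append] at hx
      rcases hx with hx | hx
      · obtain ⟨s, hs, rfl⟩ := List.mem_map.1 hx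
        exact h2 s hs
      · exact h4 x hx)
  rwa [walkGain_append, h5, ← sub_eq_add_neg] at this

theorem loop_gain {e : E} (he : e ∈ H.edges) (h1 : G.tail e = v) (h2 : G.head e = v) :
    (G.gain e).toAdd = 0 ∨ (G.gain e).toAdd = d ∨ (G.gain e).toAdd = -d := by
  have := hv [(e, true)] ⟨he, h1, by simp [stepEnd, h2], by simpa [stepEnd] using H.head_mem e he⟩
    (by simp)
  simpa [walkGain, stepGain] using this

theorem away_of_edge {e : E} (he : e ∈ H.edges) {g : ZMod k} (h : Away G H v (G.tail e) g)
    (h2 : G.head e ≠ v) : Away G H v (G.head e) (g + (G.gain e).toAdd) := by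
  simpa [stepEnd, stepGain] using Away.step (s := (e, true)) he (by simpa [stepStart] using h)
    (by simpa [stepEnd] using h2)

theorem away_of_edge' {e : E} (he : e ∈ H.edges) {g : ZMod k} (h : Away G H v (G.head e) g)
    (h2 : G.tail e ≠ v) : Away G H v (G.tail e) (g - (G.gain e).toAdd) := by
  simpa [stepEnd, stepGain, sub_eq_add_neg] using Away.step (s := (e, false)) he
    (by simpa [stepStart] using h) (by simpa [stepEnd] using h2)

theorem bal_of_base (hvm : v ∈ H.verts) (hc : ∀ w ∈ H.verts, Reachable G H v w)
    (hm : m * d = 0) : Bal G.fixed m (H.edges.image (lab G)) := by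
  have hex : ∀ w, ∃ g, w ∈ H.verts → Away G H v w g ∧ (w = v → g = 0) := by
    intro w
    by_cases hw : w ∈ H.verts
    · by_cases hwv : w = v
      · exact ⟨0, fun _ => ⟨by subst hwv; exact away_self hw, fun _ => rfl⟩⟩
      · exact (exists_away (hc w hw)).imp fun g h _ => ⟨h, fun h' => (hwv h').elim⟩
    · exact ⟨0, fun h => (hw h).elim⟩
  choose q hq using hex
  refine ⟨fun w => m * q w, fun l hl _ _ => ?_⟩
  obtain ⟨e, he, rfl⟩ := Finset.mem_image.1 hl
  change m * (G.gain e).toAdd = m * q (G.head e) - m * q (G.tail e)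
  have ht := hq _ (H.tail_mem e he)
  have hh := hq _ (H.head_mem e he)
  by_cases h2 : G.head e = v
  · rw [hh.2 h2]
    by_cases h1 : G.tail e = v
    · rw [ht.2 h1]
      rcases loop_gain hv he h1 h2 with h | h | h <;> rw [h]
      · ring
      · linear_combination hm
      · linear_combination -hm
    · have h3 := away_of_edge' hv he (g := 0) (by rw [h2]; exact away_self hvm) h1
      rcases away_sub hv h3 ht.1 h1 with h | h | h
      · linear_combination -m * h
      · linear_combination -m * h - hm
      · linear_combination -m * h + hm
  · rcases away_sub hv (away_of_edge hv he ht.1 h2) hh.1 h2 with h | h | h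
    · linear_combination m * h
    · linear_combination m * h + hm
    · linear_combination m * h - hm

theorem near_of_base (hvm : v ∈ H.verts) (hc : ∀ w ∈ H.verts, Reachable G H v w)
    (h1 : d ≠ 0) (h2 : 2 * d ≠ 0) (h3 : 3 * d ≠ 0) : Near v d (H.edges.image (lab G)) := by
  set P : V → ZMod k → Prop := fun w a =>
    Away G H v w a ∧ ∀ b, Away G H v w b → b = a ∨ b = a + d with hP
  have hex : ∀ w ∈ H.verts, w ≠ v → ∃ a, Away G H v w a ∧
      ∀ b, Away G H v w b → b = a ∨ b = a + d := by
    intro w hw hwv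
    obtain ⟨a, ha⟩ := exists_away (hc w hw)
    by_cases hd : Away G H v w (a - d)
    · refine ⟨a - d, hd, fun b hb => ?_⟩
      rcases away_sub hv hb ha hwv with h | h | h
      · right; linear_combination h
      · exfalso
        rcases away_sub hv hb hd hwv with h' | h' | h'
        · exact h2 (by linear_combination h' - h)
        · exact h1 (by linear_combination h' - h)
        · exact h3 (by linear_combination h' - h)
      · left; linear_combination h
    · refine ⟨a, ha, fun b hb => ?_⟩
      rcases away_sub hv hb ha hwv with h | h | h
      · left; linear_combination h
      · right; linear_combination h
      · exact (hd (by rwa [show a - d = b by linear_combination -h])).elim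
  have huniq : ∀ w a b, P w a → P w b → a = b := by
    intro w a b ha hb
    rcases ha.2 b hb.1 with h | h
    · exact h.symm
    · rcases hb.2 a ha.1 with h' | h'
      · exact h'
      · exact (h2 (by linear_combination -h - h')).elim
  have hex' : ∀ w, ∃ a, (w = v → a = 0) ∧ (w ∈ H.verts → w ≠ v → P w a) := by
    intro w
    by_cases hwv : w = v
    · exact ⟨0, fun _ => rfl, fun _ h => (h hwv).elim⟩
    · by_cases hw : w ∈ H.verts
      · exact (hex w hw hwv).imp fun a ha => ⟨fun h => (hwv h).elim, fun _ _ => ha⟩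
      · exact ⟨0, fun _ => rfl, fun h => (hw h).elim⟩
  choose p hp using hex'
  refine ⟨p, fun l hl => ?_⟩
  obtain ⟨e, he, rfl⟩ := Finset.mem_image.1 hl
  have ht := hp (G.tail e)
  have hh := hp (G.head e)
  have htm := H.tail_mem e he
  have hhm := H.head_mem e he
  refine ⟨fun a b => ?_, fun a b => ?_, fun a b => ?_, fun a b => loop_gain hv he a b⟩
  · change (G.gain e).toAdd - (p (G.head e) - p (G.tail e)) = 0
    have : P (G.head e) (p (G.tail e) + (G.gain e).toAdd) := by
      refine ⟨away_of_edge hv he (ht.2 htm a).1 b, fun c hc => ?_⟩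
      rcases (ht.2 htm a).2 _ (away_of_edge' hv he hc a) with h | h
      · left; linear_combination h
      · right; linear_combination h
    rw [huniq _ _ _ (hh.2 hhm b) this]
    ring
  · change (G.gain e).toAdd - (p (G.head e) - p (G.tail e)) = 0 ∨
      (G.gain e).toAdd - (p (G.head e) - p (G.tail e)) = d
    rw [ht.1 a]
    have := away_of_edge hv he (g := 0) (by
      rw [show G.tail e = v from a]; exact away_self hvm) b
    rcases (hh.2 hhm b).2 _ this with h | h
    · left; linear_combination h
    · right; linear_combination h
  · change (G.gain e).toAdd - (p (G.head e) - p (G.tail e)) = 0 ∨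
      (G.gain e).toAdd - (p (G.head e) - p (G.tail e)) = -d
    rw [hh.1 b]
    have := away_of_edge' hv he (g := 0) (by
      rw [show G.head e = v from b]; exact away_self hvm) a
    rcases (ht.2 htm a).2 _ this with h | h
    · left; linear_combination -h
    · right; linear_combination -h

end Base

end NearBalance

section Alpha

variable {V E : Type} [DecidableEq V] [DecidableEq E] {k j : ℕ} [NeZero k]
  {G : GainedGraph V E (Multiplicative (ZMod k))} {X : Subgraph G}

theorem bal_iff_dvd (c : ℕ) :
    Bal G.fixed (c : ZMod k) (X.edges.image (lab G)) ↔ Nat.card (gainGroup G X) ∣ c := by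
  rw [bal_iff_gainGroup, ← IsCyclic.exponent_eq_card, Monoid.exponent_dvd_iff_forall_pow_eq_one]
  have key : ∀ g : Multiplicative (ZMod k), (c : ZMod k) * g.toAdd = 0 ↔ g ^ c = 1 := by
    intro g
    rw [← nsmul_eq_mul, ← toAdd_pow, toAdd_eq_zero]
  simp only [key, Subtype.forall, Subtype.ext_iff, Subgroup.coe_pow, Subgroup.coe_one]

theorem balanced_iff_card : Balanced G X ↔ Nat.card (gainGroup G X) = 1 :=
  Subgroup.card_eq_one.symm

theorem isZIso_iff_card {n : ℕ} : IsZIso G X n ↔ Nat.card (gainGroup G X) = n := by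
  constructor
  · rintro ⟨e⟩
    rw [Nat.card_congr e.toEquiv]
    exact Nat.card_zmod n
  · rintro rfl
    exact ⟨(zmodCyclicMulEquiv inferInstance).symm⟩

theorem card_gainGroup_dvd : Nat.card (gainGroup G X) ∣ k := by
  have := Subgroup.card_subgroup_dvd_card (gainGroup G X)
  rwa [show Nat.card (Multiplicative (ZMod k)) = k from Nat.card_zmod k] at this

theorem isS_iff {i : ℤ} : IsS G k j i X ↔ 2 ≤ Nat.card (gainGroup G X) ∧
    (Odd j → Nat.card (gainGroup G X) ≠ 2) ∧ (Nat.card (gainGroup G X) : ℤ) ∣ j - i := by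
  constructor
  · rintro ⟨n, ⟨h1, h2, h3, h4⟩, h5⟩
    rw [isZIso_iff_card] at h5
    subst h5
    refine ⟨h1, h3, ?_⟩
    rw [← ZMod.intCast_zmod_eq_zero_iff_dvd] 
    push_cast
    rw [h4, sub_self]
  · rintro ⟨h1, h2, h3⟩
    refine ⟨_, ⟨h1, card_gainGroup_dvd, h2, ?_⟩, isZIso_iff_card.2 rfl⟩
    have := (ZMod.intCast_zmod_eq_zero_iff_dvd _ _).2 h3
    push_cast at this
    exact sub_eq_zero.1 this

theorem near_of_properNearBalanced (hc : ∀ u ∈ X.verts, ∀ w ∈ X.verts, Reachable G X u w)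
    (h : ProperNearBalanced G X) : ∃ u δ, Near u δ (X.edges.image (lab G)) := by
  obtain ⟨⟨-, v, hv, δ, hb, hδ⟩, h2, h3⟩ := h
  rw [isZIso_iff_card] at h2 h3
  rw [balanced_iff_card] at hb
  have hbase : ∀ L, IsWalk G X L v v → (∀ x ∈ (L.map (stepEnd G)).dropLast, x ≠ v) →
      (walkGain G L).toAdd = 0 ∨ (walkGain G L).toAdd = δ.toAdd ∨
        (walkGain G L).toAdd = -δ.toAdd := by
    intro L hL hL'
    rcases hδ L hL hL' with h | h | h <;> rw [h]
    · left; rfl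
    · right; left; rfl
    · right; right; rfl
  have hn : ∀ c : ℕ, (c : ZMod k) * δ.toAdd = 0 → Nat.card (gainGroup G X) ∣ c := fun c hm =>
    (bal_iff_dvd c).1 (bal_of_base hbase hv (hc v hv) hm)
  refine ⟨v, δ.toAdd, near_of_base hbase hv (hc v hv) (fun h => ?_) (fun h => ?_) fun h => ?_⟩
  · exact hb (Nat.dvd_one.1 (hn 1 (by rw [h, mul_zero])))
  · rcases (Nat.dvd_prime Nat.prime_two).1 (hn 2 h) with h' | h'
    exacts [hb h', h2 h']
  · rcases (Nat.dvd_prime Nat.prime_three).1 (hn 3 h) with h' | h'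
    exacts [hb h', h3 h']

theorem freeEnds_lab (hX : X.verts = X.edges.image G.tail ∪ X.edges.image G.head) :
    freeEnds G.fixed (X.edges.image (lab G)) = X.freeVerts := by
  unfold freeEnds Subgraph.freeVerts
  rw [hX, Finset.image_image, Finset.image_image]
  rfl

theorem touches_lab_iff (hX : X.verts = X.edges.image G.tail ∪ X.edges.image G.head) :
    Touches G.fixed (X.edges.image (lab G)) ↔ X.fixedVerts.Nonempty := by
  unfold Subgraph.fixedVerts
  rw [hX]
  constructor
  · rintro ⟨l, hl, h⟩
    obtain ⟨e, he, rfl⟩ := Finset.mem_image.1 hl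
    rcases h with h | h
    · exact ⟨_, Finset.mem_inter.2
        ⟨Finset.mem_union_left _ (Finset.mem_image_of_mem _ he), h⟩⟩
    · exact ⟨_, Finset.mem_inter.2
        ⟨Finset.mem_union_right _ (Finset.mem_image_of_mem _ he), h⟩⟩
  · rintro ⟨x, hx⟩
    obtain ⟨hx, hxΦ⟩ := Finset.mem_inter.1 hx
    rcases Finset.mem_union.1 hx with h | h <;> obtain ⟨e, he, rfl⟩ := Finset.mem_image.1 h
    · exact ⟨_, Finset.mem_image_of_mem _ he, Or.inl hxΦ⟩
    · exact ⟨_, Finset.mem_image_of_mem _ he, Or.inr hxΦ⟩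

theorem balInd_lab (c : ℕ) : balInd G.fixed (c : ZMod k) (X.edges.image (lab G)) =
    if Nat.card (gainGroup G X) ∣ c then 1 else 0 := by
  simp only [balInd, bal_iff_dvd]

theorem balSum_lab (hj : 1 ≤ j) : balSum G.fixed j (X.edges.image (lab G)) =
    (if Nat.card (gainGroup G X) ∣ j - 1 then 1 else 0) +
    (if Nat.card (gainGroup G X) ∣ j then 1 else 0) +
    (if Nat.card (gainGroup G X) ∣ j + 1 then 1 else 0) := by
  unfold balSum
  rw [← balInd_lab, ← balInd_lab, ← balInd_lab]
  push_cast [hj]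
  rfl

theorem dof_arith_free {n : ℕ} {P1 P2 P3 O S N : Prop} (hn0 : n ≠ 0)
    (a1 : n = 2 → (P1 ↔ O)) (a2 : n = 2 → (P2 ↔ ¬ O)) (a3 : n = 2 → (P3 ↔ O))
    (x1 : P1 → P2 → n = 1) (x2 : P2 → P3 → n = 1) (x3 : P1 → P3 → n = 1 ∨ n = 2)
    (x4 : n = 3 → P1 ∨ P2 ∨ P3)
    (x5 : n = 1 → P1 ∧ P2 ∧ P3) (y1 : S → N) (y2 : N → n ≠ 1 → n ≠ 2 → n ≠ 3 → S) :
    max ((if P1 then 1 else 0 : ℤ) + (if P2 then 1 else 0) + (if P3 then 1 else 0))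
      (if N then 1 else 0) + (if n = 1 then 0 else if O ∧ n = 2 then 1 else
      if (2 ≤ n ∧ (O → n ≠ 2) ∧ P3) ∨ (2 ≤ n ∧ (O → n ≠ 2) ∧ P1) then 2 else
      if (2 ≤ n ∧ (O → n ≠ 2) ∧ P2) ∨ S then 2 else 3) = 3 := by
  grind

theorem dof_lab (hj : 1 ≤ j) (hX : X.verts = X.edges.image G.tail ∪ X.edges.image G.head)
    (hc : ∀ u ∈ X.verts, ∀ w ∈ X.verts, Reachable G X u w) (hΦ : G.fixed.card ≤ 1) :
    dof G.fixed j (X.edges.image (lab G)) + alpha G k j X + 2 * X.fixedVerts.card = 3 := by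
  set n := Nat.card (gainGroup G X) with hn
  have hn0 : n ≠ 0 := Nat.card_pos.ne'
  have hf : X.fixedVerts.card ≤ 1 :=
    (Finset.card_le_card Finset.inter_subset_right).trans hΦ
  have e0 : ((n : ℤ) ∣ (j : ℤ) - 0) ↔ n ∣ j := by rw [sub_zero, Int.natCast_dvd_natCast]
  have e1 : ((n : ℤ) ∣ (j : ℤ) - 1) ↔ n ∣ j - 1 := by
    rw [← Int.natCast_dvd_natCast, Nat.cast_sub hj, Nat.cast_one]
  have e2 : ((n : ℤ) ∣ (j : ℤ) - -1) ↔ n ∣ j + 1 := by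
    rw [← Int.natCast_dvd_natCast, sub_neg_eq_add]; push_cast; rfl
  have d2 : ∀ a : ℕ, n = 2 → (n ∣ a ↔ a % 2 = 0) := fun a h => by rw [h]; omega
  have hodd : Odd j ↔ j % 2 = 1 := Nat.odd_iff
  have x1 : n ∣ j - 1 → n ∣ j → n = 1 := fun h h' => by
    have := Nat.dvd_sub h' h
    rw [Nat.sub_sub_self hj] at this
    exact Nat.dvd_one.1 this
  have x2 : n ∣ j → n ∣ j + 1 → n = 1 := fun h h' => Nat.dvd_one.1 ((Nat.dvd_add_right h).1 h')
  have x3 : n ∣ j - 1 → n ∣ j + 1 → n = 1 ∨ n = 2 := fun h h' => by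
    have := Nat.dvd_sub h' h
    rw [show j + 1 - (j - 1) = 2 by omega] at this
    exact (Nat.dvd_prime Nat.prime_two).1 this
  have x4 : n = 3 → n ∣ j - 1 ∨ n ∣ j ∨ n ∣ j + 1 := fun h => by rw [h]; omega
  have x5 : n = 1 → n ∣ j - 1 ∧ n ∣ j ∧ n ∣ j + 1 := fun h => by simp [h]
  have a1 := d2 (j - 1)
  have a2 := d2 j
  have a3 := d2 (j + 1)
  unfold alpha IsSpm
  simp only [isS_iff, balanced_iff_card, isZIso_iff_card, ← hn, e0, e1, e2]
  by_cases ht : Touches G.fixed (X.edges.image (lab G))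
  · have hf1 : X.fixedVerts.card = 1 :=
      le_antisymm hf (Finset.card_pos.2 ((touches_lab_iff hX).1 ht))
    rw [dof_of_touches ht, balInd_lab, ← hn, hf1]
    simp only [one_ne_zero, false_and, or_false]
    clear d2 e0 e1 e2
    push_cast
    grind
  · have hf0 : X.fixedVerts.card = 0 := by
      rw [Finset.card_eq_zero, ← Finset.not_nonempty_iff_eq_empty, ← touches_lab_iff hX]
      exact ht
    have hNF : NoFixed G X := fun x hx hxΦ => by
      rw [Finset.card_eq_zero] at hf0
      have := (Finset.mem_inter.2 ⟨hx, hxΦ⟩ : x ∈ X.fixedVerts)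
      rw [show X.verts ∩ G.fixed = ∅ from hf0] at this
      exact absurd this (Finset.notMem_empty x)
    have y1 : ProperNearBalanced G X → ∃ u δ, Near u δ (X.edges.image (lab G)) :=
      near_of_properNearBalanced hc
    have y2 : (∃ u δ, Near u δ (X.edges.image (lab G))) → n ≠ 1 → n ≠ 2 → n ≠ 3 →
        ProperNearBalanced G X := fun ⟨u, δ, h⟩ h1 h2 h3 =>
      ⟨nearBalanced_of_near hNF (by rwa [balanced_iff_card]) h, by rwa [isZIso_iff_card],
        by rwa [isZIso_iff_card]⟩
    rw [dof, if_neg ht, balSum_lab hj, ← hn, hf0]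
    simp only [true_and]
    have := fun a b c => dof_arith_free (O := Odd j) hn0 a b c x1 x2 x3 x4 x5 y1 y2
    specialize this (by grind) (by grind) (by grind)
    simp only [Nat.cast_zero, mul_zero, sub_zero, add_zero]
    convert this

theorem cnt_lab (hj : 1 ≤ j) (hX : X.verts = X.edges.image G.tail ∪ X.edges.image G.head)
    (hc : ∀ u ∈ X.verts, ∀ w ∈ X.verts, Reachable G X u w) (hΦ : G.fixed.card ≤ 1) :
    2 * (X.verts.card : ℤ) - 3 + alpha G k j X = cnt G.fixed j (X.edges.image (lab G)) := by
  have h1 := dof_lab hj hX hc hΦ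
  have h2 := Finset.card_sdiff_add_card_inter X.verts G.fixed
  rw [cnt, freeEnds_lab hX]
  unfold Subgraph.freeVerts
  unfold Subgraph.fixedVerts at h1
  omega

end Alpha

section ClassSums

variable {V : Type} [DecidableEq V] {k j : ℕ} {Φ : Finset V} {ι κ : Type}
  {X Y : Finset (LEdge V k)}

/-- The part of `X` whose edges start in the class `i`. -/
noncomputable def part (c : V → ι) (X : Finset (LEdge V k)) (i : ι) : Finset (LEdge V k) :=
  X.filter fun e => c e.1 = i

theorem mem_part {c : V → ι} {i : ι} {e : LEdge V k} : e ∈ part c X i ↔ e ∈ X ∧ c e.1 = i :=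
  Finset.mem_filter

/-- The sum of the degrees of freedom of the parts of `X`. -/
noncomputable def dofSum (Φ : Finset V) (j : ℕ) (c : V → ι) (X : Finset (LEdge V k)) : ℤ :=
  ∑ i ∈ X.image fun e => c e.1, dof Φ j (part c X i)

theorem dofSum_le_dofSum {c : V → ι} {d : V → κ}
    (h : ∀ e ∈ X, ∀ f ∈ X, c e.1 = c f.1 → d e.1 = d f.1) :
    dofSum Φ j d X ≤ dofSum Φ j c X := by
  rcases X.eq_empty_or_nonempty with rfl | ⟨e₀, -⟩
  · simp [dofSum]
  have : Nonempty ι := ⟨c e₀.1⟩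
  have hex : ∀ i ∈ X.image fun e => d e.1, ∃ a, ∃ e ∈ X, c e.1 = a ∧ d e.1 = i := by
    intro i hi
    obtain ⟨e, he, rfl⟩ := Finset.mem_image.1 hi
    exact ⟨_, e, he, rfl, rfl⟩
  choose! σ hσ using hex
  have hinj : Set.InjOn σ (X.image fun e => d e.1 : Finset κ) := by
    intro i hi i' hi' heq
    obtain ⟨e, he, h1, rfl⟩ := hσ i hi
    obtain ⟨e', he', h1', rfl⟩ := hσ i' hi'
    exact h e he e' he' (by rw [h1, h1', heq])
  calc dofSum Φ j d X ≤ ∑ i ∈ X.image fun e => d e.1, dof Φ j (part c X (σ i)) := by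
        refine Finset.sum_le_sum fun i hi => dof_anti fun e he => ?_
        rw [mem_part] at he ⊢
        obtain ⟨e', he', h1, rfl⟩ := hσ i hi
        exact ⟨he.1, h e he.1 e' he' (by rw [he.2, h1])⟩
    _ = ∑ a ∈ (X.image fun e => d e.1).image σ, dof Φ j (part c X a) :=
        (Finset.sum_image (f := fun a => dof Φ j (part c X a)) hinj).symm
    _ ≤ dofSum Φ j c X := by
        refine Finset.sum_le_sum_of_subset_of_nonneg (fun a ha => ?_) fun _ _ _ => dof_nonneg
        obtain ⟨i, hi, rfl⟩ := Finset.mem_image.1 ha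
        obtain ⟨e, he, h1, -⟩ := hσ i hi
        exact Finset.mem_image.2 ⟨e, he, h1⟩

theorem dof_le_dofSum (c : V → ι) (hX : X.Nonempty) : dof Φ j X ≤ dofSum Φ j c X := by
  have h := dofSum_le_dofSum (Φ := Φ) (j := j) (X := X) (c := c) (d := fun _ => (∅ : Set V))
    fun _ _ _ _ _ => rfl
  rwa [dofSum, Finset.image_const hX, Finset.sum_singleton, part,
    Finset.filter_true_of_mem fun _ _ => rfl] at h

theorem sum_cnt_part {c : V → ι} (hc : ∀ e ∈ X, c e.1 = c e.2.1) :
    ∑ i ∈ X.image fun e => c e.1, cnt Φ j (part c X i) =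
      2 * ((freeEnds Φ X).card : ℤ) - dofSum Φ j c X := by
  have hm : Set.MapsTo c (freeEnds Φ X) (X.image fun e => c e.1 : Finset ι) := by
    intro x hx
    obtain ⟨-, e, he, h⟩ := mem_freeEnds.1 hx
    refine Finset.mem_coe.2 (Finset.mem_image.2 ⟨e, he, ?_⟩)
    rcases h with rfl | rfl
    exacts [rfl, hc e he]
  have hp : ∀ i, freeEnds Φ (part c X i) = (freeEnds Φ X).filter fun x => c x = i := by
    intro i
    ext x
    simp only [mem_freeEnds, Finset.mem_filter, mem_part]
    constructor
    · rintro ⟨h1, e, ⟨he, rfl⟩, h | h⟩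
      · exact ⟨⟨h1, e, he, Or.inl h⟩, by rw [h]⟩
      · exact ⟨⟨h1, e, he, Or.inr h⟩, by rw [hc e he, h]⟩
    · rintro ⟨⟨h1, e, he, h | h⟩, rfl⟩
      · exact ⟨h1, e, ⟨he, by rw [h]⟩, Or.inl h⟩
      · exact ⟨h1, e, ⟨he, by rw [hc e he, h]⟩, Or.inr h⟩
  rw [Finset.card_eq_sum_card_fiberwise hm]
  unfold cnt dofSum
  rw [Finset.sum_sub_distrib, Nat.cast_sum, Finset.mul_sum]
  simp only [hp]

end ClassSums

section Components

variable {V E : Type} [DecidableEq V] [DecidableEq E] {k j : ℕ}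
  {G : GainedGraph V E (Multiplicative (ZMod k))} {H : Subgraph G} {F : Finset E}

theorem reachable_symm {u w : V} (h : Reachable G H u w) : Reachable G H w u := by
  obtain ⟨L, h⟩ := h
  induction L generalizing u with
  | nil => obtain ⟨rfl, h⟩ := h; exact ⟨[], rfl, h⟩
  | cons s L ih =>
    obtain ⟨a, rfl, b⟩ := h
    obtain ⟨M, hM⟩ := ih b
    have := isWalk_singleton (G := G) (H := H) (s := (s.1, !s.2)) a
    rw [stepStart_not, stepEnd_not] at this
    exact ⟨_, hM.append this⟩

theorem reachable_trans {u w y : V} (h : Reachable G H u w) (h' : Reachable G H w y) :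
    Reachable G H u y := by
  obtain ⟨L, h⟩ := h
  obtain ⟨M, h'⟩ := h'
  exact ⟨_, h.append h'⟩

/-- The set of vertices reached from `x`. -/
def reachSet (G : GainedGraph V E (Multiplicative (ZMod k))) (F : Finset E) (x : V) : Set V :=
  {y | Reachable G (edgeSpan G F) x y}

theorem reachSet_eq_iff {x y : V} (hy : y ∈ (edgeSpan G F).verts) :
    reachSet G F x = reachSet G F y ↔ Reachable G (edgeSpan G F) x y := by
  constructor
  · intro h
    have : y ∈ reachSet G F y := ⟨[], rfl, hy⟩
    rwa [← h] at this
  · intro h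
    ext z
    exact ⟨fun hz => reachable_trans (reachable_symm h) hz, fun hz => reachable_trans h hz⟩

theorem reachSet_step {s : E × Bool} (h : s.1 ∈ F) :
    reachSet G F (stepStart G s) = reachSet G F (stepEnd G s) :=
  (reachSet_eq_iff (stepEnd_mem (H := edgeSpan G F) h)).2 ⟨_, isWalk_singleton h⟩

theorem reachSet_tail_eq_head {e : E} (h : e ∈ F) :
    reachSet G F (G.tail e) = reachSet G F (G.head e) :=
  reachSet_step (s := (e, true)) h

/-- The edges of `F` in a class of mutually reachable vertices. -/
noncomputable def classSpan (G : GainedGraph V E (Multiplicative (ZMod k))) (F : Finset E)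
    (i : Set V) : Subgraph G :=
  edgeSpan G (F.filter fun f => reachSet G F (G.tail f) = i)

theorem classSpan_reachable {i : Set V} {u w : V} (hu : u ∈ (classSpan G F i).verts)
    (hw : w ∈ (classSpan G F i).verts) : Reachable G (classSpan G F i) u w := by
  have hr : ∀ x ∈ (classSpan G F i).verts, x ∈ (edgeSpan G F).verts ∧ reachSet G F x = i := by
    intro x hx
    rcases Finset.mem_union.1 hx with h | h <;> obtain ⟨e, he, rfl⟩ := Finset.mem_image.1 h <;>
      obtain ⟨he, h'⟩ := Finset.mem_filter.1 he
    · exact ⟨(edgeSpan G F).tail_mem e he, h'⟩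
    · exact ⟨(edgeSpan G F).head_mem e he, by rw [← reachSet_tail_eq_head he, h']⟩
  obtain ⟨L, hL⟩ := (reachSet_eq_iff (hr w hw).1).1 ((hr u hu).2.trans (hr w hw).2.symm)
  refine ⟨L, ?_⟩
  induction L generalizing u with
  | nil => exact ⟨hL.1, hu⟩
  | cons s L ih =>
    obtain ⟨a, rfl, b⟩ := hL
    have hs : s.1 ∈ (classSpan G F i).edges := by
      refine Finset.mem_filter.2 ⟨a, ?_⟩
      rw [← (hr _ hu).2]
      rcases s with ⟨e, _ | _⟩
      · exact reachSet_step (s := (e, true)) a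
      · rfl
    exact ⟨hs, rfl, ih (stepEnd_mem hs) b⟩

theorem lab_classSpan (i : Set V) :
    (classSpan G F i).edges.image (lab G) = part (reachSet G F) (F.image (lab G)) i := by
  rw [part, Finset.filter_image]
  rfl

theorem components_eq : components G F =
    ((F.image (lab G)).image fun e => reachSet G F e.1).image (classSpan G F) := by
  rw [components, Finset.image_image, Finset.image_image]
  refine Finset.image_congr fun e he => ?_
  simp only [componentOf, Function.comp, classSpan, lab]
  congr 1
  refine Finset.filter_congr fun f hf => ?_
  rw [eq_comm, reachSet_eq_iff ((edgeSpan G F).tail_mem f hf)]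

variable [NeZero k]

theorem component_cnt (hj : 1 ≤ j) (hΦ : G.fixed.card ≤ 1) {X : Subgraph G}
    (hX : X ∈ components G F) : 2 * (X.verts.card : ℤ) - 3 + alpha G k j X =
      cnt G.fixed j (X.edges.image (lab G)) := by
  rw [components_eq] at hX
  obtain ⟨i, -, rfl⟩ := Finset.mem_image.1 hX
  exact cnt_lab hj rfl (fun u hu w hw => classSpan_reachable hu hw) hΦ

theorem fCount_eq (hj : 1 ≤ j) (hΦ : G.fixed.card ≤ 1) : fCount G k j F =
    2 * ((freeEnds G.fixed (F.image (lab G))).card : ℤ) -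
      dofSum G.fixed j (reachSet G F) (F.image (lab G)) := by
  rw [← sum_cnt_part]
  · rw [fCount, Finset.sum_congr rfl fun X hX => component_cnt hj hΦ hX, components_eq,
      Finset.sum_image]
    · exact Finset.sum_congr rfl fun i _ => by rw [lab_classSpan]
    · intro i hi i' _ h
      obtain ⟨l, hl, rfl⟩ := Finset.mem_image.1 hi
      obtain ⟨e, he, rfl⟩ := Finset.mem_image.1 hl
      have h1 : e ∈ (classSpan G F (reachSet G F (lab G e).1)).edges :=
        Finset.mem_filter.2 ⟨he, rfl⟩
      rw [h] at h1
      exact (Finset.mem_filter.1 h1).2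
  · intro l hl
    obtain ⟨e, he, rfl⟩ := Finset.mem_image.1 hl
    exact reachSet_tail_eq_head he

theorem fCount_le_cnt (hj : 1 ≤ j) (hΦ : G.fixed.card ≤ 1) (hF : F.Nonempty) :
    fCount G k j F ≤ cnt G.fixed j (F.image (lab G)) := by
  rw [fCount_eq hj hΦ, cnt]
  have := dof_le_dofSum (Φ := G.fixed) (j := j) (reachSet G F) (hF.image (lab G))
  omega

theorem exists_component_of_fCount_lt (hj : 1 ≤ j) (hΦ : G.fixed.card ≤ 1)
    (h : fCount G k j F < F.card) : ∃ X ∈ components G F, X.edges ⊆ F ∧ X.edges.Nonempty ∧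
      cnt G.fixed j (X.edges.image (lab G)) < X.edges.card := by
  by_contra! hcon
  have hsub : ∀ X ∈ components G F, X.edges ⊆ F ∧ X.edges.Nonempty := by
    intro X hX
    rw [components_eq] at hX
    obtain ⟨i, hi, rfl⟩ := Finset.mem_image.1 hX
    obtain ⟨l, hl, rfl⟩ := Finset.mem_image.1 hi
    obtain ⟨e, he, rfl⟩ := Finset.mem_image.1 hl
    exact ⟨Finset.filter_subset _ _, e, Finset.mem_filter.2 ⟨he, rfl⟩⟩
  have h1 : F ⊆ (components G F).biUnion Subgraph.edges := by
    intro e he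
    rw [components_eq]
    exact Finset.mem_biUnion.2 ⟨classSpan G F (reachSet G F (lab G e).1),
      Finset.mem_image_of_mem _ (Finset.mem_image_of_mem _ (Finset.mem_image_of_mem _ he)),
      Finset.mem_filter.2 ⟨he, rfl⟩⟩
  have h2 : F.card ≤ ∑ X ∈ components G F, X.edges.card :=
    (Finset.card_le_card h1).trans Finset.card_biUnion_le
  have h3 : ((∑ X ∈ components G F, X.edges.card : ℕ) : ℤ) ≤ fCount G k j F := by
    rw [Nat.cast_sum, fCount]
    refine Finset.sum_le_sum fun X hX => ?_
    rw [component_cnt hj hΦ hX]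
    exact hcon X hX (hsub X hX).1 (hsub X hX).2
  omega

end Components

section Reduce

variable {V : Type} [DecidableEq V] {k j : ℕ} {Φ : Finset V} {ι : Type}
  {X Y : Finset (LEdge V k)} {v x y : V} {g h : ZMod k}

theorem bal_reduce {m : ZMod k} (hv : v ∉ Φ) (hx : (v, x, g) ∈ X ∨ rev (v, x, g) ∈ X)
    (hy : (v, y, h) ∈ X ∨ rev (v, y, h) ∈ X)
    (hY : ∀ e ∈ Y, (e ∈ X ∧ e.1 ≠ v ∧ e.2.1 ≠ v) ∨ e = (x, y, h - g)) (hb : Bal Φ m X) :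
    Bal Φ m Y := by
  obtain ⟨p, hp⟩ := hb
  have hs : ∀ {e : LEdge V k}, e ∈ X ∨ rev e ∈ X → BalE Φ m p e := fun {e} he =>
    he.elim (hp e) fun h => by simpa only [rev_rev] using balE_rev (hp _ h)
  refine ⟨p, fun e he => ?_⟩
  rcases hY e he with ⟨he, -⟩ | rfl
  · exact hp e he
  · intro a b
    have h1 := hs hx hv a
    have h2 := hs hy hv b
    simp only at *
    linear_combination h2 - h1

theorem near_reduce (hxv : x ≠ v) (hyv : y ≠ v) (hx : (v, x, g) ∈ X ∨ rev (v, x, g) ∈ X)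
    (hy : (v, y, h) ∈ X ∨ rev (v, y, h) ∈ X)
    (hY : ∀ e ∈ Y, (e ∈ X ∧ e.1 ≠ v ∧ e.2.1 ≠ v) ∨ e = (x, y, h - g))
    (hn : ∃ u δ, Near u δ X) : ∃ u δ, Near u δ Y := by
  obtain ⟨u, δ, p, hp⟩ := hn
  have hs : ∀ {e : LEdge V k}, e ∈ X ∨ rev e ∈ X → NearE u δ p e := fun {e} he =>
    he.elim (hp e) fun h => by simpa only [rev_rev] using nearE_rev (hp _ h)
  obtain ⟨a1, -, a3, -⟩ := hs hx
  obtain ⟨b1, -, b3, -⟩ := hs hy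
  have hd : defect p (x, y, h - g) = defect p (v, y, h) - defect p (v, x, g) := by
    simp only [defect]; ring
  by_cases huv : u = v
  · subst huv
    refine ⟨x, defect p (x, y, h - g), p, fun e he => ?_⟩
    rcases hY e he with ⟨he, h1, h2⟩ | rfl
    · have h0 := (hp e he).1 h1 h2
      refine ⟨fun _ _ => h0, fun _ _ => Or.inl h0, fun _ _ => Or.inl h0, fun h1 h2 => Or.inl ?_⟩
      simpa [defect, h1, h2] using h0
    · refine ⟨fun h => (h rfl).elim, fun _ _ => Or.inr rfl, fun h => (h rfl).elim,
        fun _ h2 => Or.inr (Or.inl ?_)⟩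
      simp only at h2
      simp [defect, h2]
  · refine ⟨u, δ, p, fun e he => ?_⟩
    rcases hY e he with ⟨he, -⟩ | rfl
    · exact hp e he
    · have a1 := a1 (Ne.symm huv)
      have b1 := b1 (Ne.symm huv)
      have a3 := a3 (Ne.symm huv)
      have b3 := b3 (Ne.symm huv)
      simp only at a1 b1 a3 b3
      refine ⟨fun h1 h2 => ?_, fun h1 h2 => ?_, fun h1 h2 => ?_, fun h1 h2 => ?_⟩
      · rw [hd, a1 h1, b1 h2, sub_zero]
      · rw [hd, b1 h2]
        rcases a3 h1 with h | h <;> simp [h]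
      · rw [hd, a1 h1]
        rcases b3 h2 with h | h <;> simp [h]
      · have : h - g = defect p (v, y, h) - defect p (v, x, g) := by
          rw [← hd]
          simp only at h1 h2
          simp [defect, h1, h2]
        simp only
        rw [this]
        rcases a3 h1 with h | h <;> rcases b3 h2 with h' | h' <;> simp [h, h']

theorem dof_le_dof_reduce (hv : v ∉ Φ) (hxv : x ≠ v) (hyv : y ≠ v)
    (hx : (v, x, g) ∈ X ∨ rev (v, x, g) ∈ X) (hy : (v, y, h) ∈ X ∨ rev (v, y, h) ∈ X)
    (hY : ∀ e ∈ Y, (e ∈ X ∧ e.1 ≠ v ∧ e.2.1 ≠ v) ∨ e = (x, y, h - g)) :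
    dof Φ j X ≤ dof Φ j Y := by
  have hB : ∀ m : ZMod k, balInd Φ m X ≤ balInd Φ m Y := fun m => by
    unfold balInd
    split_ifs with h1 h2
    exacts [le_rfl, (h2 (bal_reduce hv hx hy hY h1)).elim, zero_le_one, le_rfl]
  by_cases hT : Touches Φ X
  · rw [dof_of_touches hT]
    exact (hB _).trans balInd_le_dof
  · have hT' : ¬ Touches Φ Y := by
      rintro ⟨e, he, h'⟩
      rcases hY e he with ⟨he, -⟩ | rfl
      · exact hT ⟨e, he, h'⟩
      · rcases h' with h' | h'
        · rcases hx with hx | hx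
          exacts [hT ⟨_, hx, Or.inr h'⟩, hT ⟨_, hx, Or.inl h'⟩]
        · rcases hy with hy | hy
          exacts [hT ⟨_, hy, Or.inr h'⟩, hT ⟨_, hy, Or.inl h'⟩]
    rw [dof, dof, if_neg hT, if_neg hT']
    refine max_le_max (add_le_add (add_le_add (hB _) (hB _)) (hB _)) ?_
    split_ifs with h1 h2
    exacts [le_rfl, (h2 (near_reduce hxv hyv hx hy hY h1)).elim, zero_le_one, le_rfl]

/-- Trading all edges at `v` for one edge between neighbours of `v` lowers the count by two. -/
theorem count_reduce {c : V → ι} (hc : ∀ e ∈ X, c e.1 = c e.2.1) (hv : v ∉ Φ) (hxv : x ≠ v)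
    (hyv : y ≠ v) (hx : (v, x, g) ∈ X ∨ rev (v, x, g) ∈ X)
    (hy : (v, y, h) ∈ X ∨ rev (v, y, h) ∈ X)
    (hY : ∀ e, e ∈ Y ↔ (e ∈ X ∧ e.1 ≠ v ∧ e.2.1 ≠ v) ∨ e = (x, y, h - g)) :
    2 * ((freeEnds Φ Y).card : ℤ) - dofSum Φ j c Y + 2 ≤
      2 * ((freeEnds Φ X).card : ℤ) - dofSum Φ j c X := by
  have hcx : c v = c x := by
    rcases hx with hx | hx
    exacts [hc _ hx, (hc _ hx).symm]
  have hxm : ∃ e ∈ X, e.1 = x ∨ e.2.1 = x := by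
    rcases hx with hx | hx
    exacts [⟨_, hx, Or.inr rfl⟩, ⟨_, hx, Or.inl rfl⟩]
  have hym : ∃ e ∈ X, e.1 = y ∨ e.2.1 = y := by
    rcases hy with hy | hy
    exacts [⟨_, hy, Or.inr rfl⟩, ⟨_, hy, Or.inl rfl⟩]
  have hvm : ∃ e ∈ X, e.1 = v ∨ e.2.1 = v := by
    rcases hx with hx | hx
    exacts [⟨_, hx, Or.inl rfl⟩, ⟨_, hx, Or.inr rfl⟩]
  have hfree : freeEnds Φ Y ⊆ (freeEnds Φ X).erase v := by
    intro z hz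
    obtain ⟨hzΦ, e, he, hez⟩ := mem_freeEnds.1 hz
    rw [Finset.mem_erase, mem_freeEnds]
    rcases (hY e).1 he with ⟨he, h1, h2⟩ | rfl
    · exact ⟨by rcases hez with rfl | rfl <;> assumption, hzΦ, e, he, hez⟩
    · rcases hez with rfl | rfl
      exacts [⟨hxv, hzΦ, hxm⟩, ⟨hyv, hzΦ, hym⟩]
  have hcard := Finset.card_le_card hfree
  have hvX : v ∈ freeEnds Φ X := mem_freeEnds.2 ⟨hv, hvm⟩
  have hpos := Finset.card_pos.2 ⟨v, hvX⟩
  rw [Finset.card_erase_of_mem hvX] at hcard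
  have hpart : ∀ {e}, e ∈ X → e.1 = v ∨ e.2.1 = v → c e.1 = c v := by
    rintro e he (rfl | rfl)
    exacts [rfl, hc e he]
  have hsum : dofSum Φ j c X ≤ dofSum Φ j c Y := by
    calc dofSum Φ j c X ≤ ∑ i ∈ X.image fun e => c e.1, dof Φ j (part c Y i) := by
          refine Finset.sum_le_sum fun i _ => ?_
          by_cases hi : c v = i
          · subst hi
            have hmem : ∀ {z r}, (v, z, r) ∈ X ∨ rev (v, z, r) ∈ X →
                (v, z, r) ∈ part c X (c v) ∨ rev (v, z, r) ∈ part c X (c v) := by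
              rintro z r (h | h)
              · exact Or.inl (mem_part.2 ⟨h, rfl⟩)
              · exact Or.inr (mem_part.2 ⟨h, hpart h (Or.inr rfl)⟩)
            refine dof_le_dof_reduce hv hxv hyv (hmem hx) (hmem hy) fun e he => ?_
            obtain ⟨he, hec⟩ := mem_part.1 he
            rcases (hY e).1 he with ⟨he, h'⟩ | h'
            exacts [Or.inl ⟨mem_part.2 ⟨he, hec⟩, h'⟩, Or.inr h']
          · refine dof_anti fun e he => ?_
            rw [mem_part] at he ⊢
            obtain ⟨he, rfl⟩ := he
            rcases (hY e).1 he with ⟨he, h'⟩ | rfl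
            exacts [⟨he, rfl⟩, (hi hcx).elim]
      _ ≤ dofSum Φ j c Y := by
          refine Finset.sum_le_sum_of_subset_of_nonneg (fun i hi => ?_) fun _ _ _ => dof_nonneg
          obtain ⟨e, he, rfl⟩ := Finset.mem_image.1 hi
          by_cases hev : e.1 = v ∨ e.2.1 = v
          · rw [hpart he hev]
            exact Finset.mem_image.2 ⟨_, (hY _).2 (Or.inr rfl), hcx.symm⟩
          · rw [not_or] at hev
            exact Finset.mem_image_of_mem _ ((hY e).2 (Or.inl ⟨he, hev⟩))
  omega

theorem good_rev {e : LEdge V k} (he : Good Φ e) : Good Φ (rev e) :=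
  ⟨fun h => by simpa [rev] using he.1 h.symm, he.2.symm⟩

theorem cnt_le_one_of_subset_pair {e : LEdge V k} (he : Good Φ e) (hX : X ⊆ {e, rev e}) :
    cnt Φ j X ≤ 1 := by
  refine (cnt_mono hX).trans ?_
  have hT : Touches Φ {e, rev e} → e.1 ∈ Φ ∨ e.2.1 ∈ Φ := by
    rintro ⟨f, hf, h⟩
    rw [Finset.mem_insert, Finset.mem_singleton] at hf
    rcases hf with rfl | rfl
    exacts [h, h.symm]
  have hfree : freeEnds Φ {e, rev e} ⊆ ({e.1, e.2.1} : Finset V) \ Φ := by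
    intro z hz
    obtain ⟨hzΦ, f, hf, hfz⟩ := mem_freeEnds.1 hz
    rw [Finset.mem_insert, Finset.mem_singleton] at hf
    simp only [Finset.mem_sdiff, Finset.mem_insert, Finset.mem_singleton]
    rcases hf with rfl | rfl <;> rcases hfz with rfl | rfl <;> simp_all [rev]
  have hcard := Finset.card_le_card hfree
  have hbal : e.1 ∈ Φ ∨ e.2.1 ∈ Φ → ∀ m, Bal Φ m {e, rev e} := by
    intro h m
    have hb : BalE Φ m (fun _ => 0) e := fun a b => by tauto
    refine ⟨fun _ => 0, fun f hf => ?_⟩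
    rw [Finset.mem_insert, Finset.mem_singleton] at hf
    rcases hf with rfl | rfl
    exacts [hb, balE_rev hb]
  unfold cnt
  by_cases h1 : e.1 ∈ Φ ∨ e.2.1 ∈ Φ
  · have h2 := (balInd_of (hbal h1 (j : ZMod k))).ge.trans (balInd_le_dof (Φ := Φ) (j := j))
    have h3 : (({e.1, e.2.1} : Finset V) \ Φ).card ≤ 1 := by
      rw [Finset.card_le_one]
      intro a ha b hb
      simp only [Finset.mem_sdiff, Finset.mem_insert, Finset.mem_singleton] at ha hb
      rcases ha with ⟨rfl | rfl, ha⟩ <;> rcases hb with ⟨rfl | rfl, hb⟩ <;> tauto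
    omega
  · have hT' : ¬ Touches Φ {e, rev e} := fun h => h1 (hT h)
    by_cases hl : e.1 = e.2.1
    · have hn : Near e.1 e.2.2 {e, rev e} := by
        have hb : NearE e.1 e.2.2 (fun _ => 0) e :=
          ⟨fun h => (h rfl).elim, fun _ h => (h hl.symm).elim, fun h => (h rfl).elim,
            fun _ _ => Or.inr (Or.inl rfl)⟩
        refine ⟨fun _ => 0, fun f hf => ?_⟩
        rw [Finset.mem_insert, Finset.mem_singleton] at hf
        rcases hf with rfl | rfl
        exacts [hb, nearE_rev hb]
      have h2 := one_le_dof_of_near (j := j) hT' hn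
      have h3 : (({e.1, e.2.1} : Finset V) \ Φ).card ≤ 1 := by
        rw [hl, Finset.pair_eq_singleton]
        exact (Finset.card_le_card Finset.sdiff_subset).trans (Finset.card_singleton _).le
      omega
    · have hb : Bal Φ 1 {e, rev e} := by
        have hb : BalE Φ 1 (fun z => if z = e.1 then 0 else e.2.2) e := fun _ _ => by
          simp [Ne.symm hl]
        refine ⟨fun z => if z = e.1 then 0 else e.2.2, fun f hf => ?_⟩
        rw [Finset.mem_insert, Finset.mem_singleton] at hf
        rcases hf with rfl | rfl
        exacts [hb, balE_rev hb]
      have h2 := dof_of_bal_one (j := j) hT' hb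
      have h3 := (Finset.card_le_card (Finset.sdiff_subset (s := ({e.1, e.2.1} : Finset V))
        (t := Φ))).trans Finset.card_le_two
      omega

theorem cnt_le_one_of_fixed {z w : V} (hw : w ∈ Φ)
    (hX : ∀ e ∈ X, (e.1 = z ∧ e.2.1 = w) ∨ (e.1 = w ∧ e.2.1 = z)) :
    cnt Φ j X ≤ 1 := by
  have hfree : freeEnds Φ X ⊆ {z} := by
    intro u hu
    obtain ⟨huΦ, e, he, h⟩ := mem_freeEnds.1 hu
    rw [Finset.mem_singleton]
    rcases hX e he with ⟨h1, h2⟩ | ⟨h1, h2⟩ <;> rcases h with h | h <;> grind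
  have hcard := Finset.card_le_card hfree
  rw [Finset.card_singleton] at hcard
  have hb : Bal Φ (j : ZMod k) X := ⟨fun _ => 0, fun e he a b => by
    rcases hX e he with ⟨h1, h2⟩ | ⟨h1, h2⟩
    exacts [(b (h2 ▸ hw)).elim, (a (h1 ▸ hw)).elim]⟩
  have := (balInd_of hb).ge.trans (balInd_le_dof (Φ := Φ) (j := j))
  unfold cnt
  omega

end Reduce

section GainGraphs

variable {V E : Type} [DecidableEq V] [DecidableEq E] [Fintype V] [Fintype E] {k j : ℕ}
  {G : GainedGraph V E (Multiplicative (ZMod k))} {K : Subgraph G}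

theorem IsGainGraphOn.good (hK : IsGainGraphOn G K) (hΦ : G.fixed.card ≤ 1) {e : E}
    (he : e ∈ K.edges) : Good G.fixed (lab G e) := by
  refine ⟨fun h h0 => hK.loop_gain e he h (toAdd_eq_zero.1 h0), ?_⟩
  by_contra! h
  exact hK.fixed_not_loop e he (Finset.card_le_one.1 hΦ _ h.1 _ h.2) h.1

theorem IsGainGraphOn.lab_injOn (hK : IsGainGraphOn G K) : Set.InjOn (lab G) K.edges := by
  intro e he f hf h
  by_contra hne
  simp only [lab, Prod.mk.injEq] at h
  exact hK.same_dir e he f hf hne h.1 h.2.1 (Multiplicative.toAdd.injective h.2.2)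

theorem IsGainGraphOn.eq_of_lab_eq_rev (hK : IsGainGraphOn G K) {e f : E} (he : e ∈ K.edges)
    (hf : f ∈ K.edges) (h : lab G e = rev (lab G f)) : e = f := by
  by_contra hne
  simp only [lab, rev, Prod.mk.injEq] at h
  exact hK.opp_dir e he f hf hne h.1 h.2.1
    (Multiplicative.toAdd.injective (by rw [h.2.2, toAdd_inv]))

theorem IsGainGraphOn.eq_of_stepLab_eq (hK : IsGainGraphOn G K) {e f : E} {b c : Bool}
    (he : e ∈ K.edges) (hf : f ∈ K.edges) (h : stepLab G (e, b) = stepLab G (f, c)) : e = f := by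
  cases b <;> cases c <;> simp only [stepLab_true, stepLab_false] at h
  · exact hK.lab_injOn he hf (by rw [← rev_rev (lab G e), h, rev_rev])
  · exact (hK.eq_of_lab_eq_rev hf he h.symm).symm
  · exact hK.eq_of_lab_eq_rev he hf h
  · exact hK.lab_injOn he hf h

variable [NeZero k]

theorem GainSparseKJ.indep (hj : 1 ≤ j) (hΦ : G.fixed.card ≤ 1)
    (h : GainSparseKJ G k j (⊤ : Subgraph G)) :
    Indep G.fixed j (Finset.univ.image (lab G)) := by
  intro H hH hne
  have himg : (Finset.univ.filter fun e => lab G e ∈ H).image (lab G) = H := by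
    ext l
    simp only [Finset.mem_image, Finset.mem_filter, Finset.mem_univ, true_and]
    refine ⟨by rintro ⟨e, he, rfl⟩; exact he, fun hl => ?_⟩
    obtain ⟨e, -, rfl⟩ := Finset.mem_image.1 (hH hl)
    exact ⟨e, hl, rfl⟩
  set F := Finset.univ.filter fun e => lab G e ∈ H
  have hF : F.Nonempty := (Finset.image_nonempty (f := lab G)).1 (himg.symm ▸ hne)
  have h1 := h (edgeSpan G F) ⟨Finset.subset_univ _, Finset.subset_univ _⟩ hF
  have h2 := fCount_le_cnt (k := k) hj hΦ hF
  have h3 := Finset.card_image_le (s := F) (f := lab G)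
  rw [himg] at h2 h3
  have h4 : (edgeSpan G F).edges = F := rfl
  rw [h4] at h1
  omega

end GainGraphs

section OneReduction

variable {V E : Type} [DecidableEq V] [DecidableEq E] [Fintype V] [Fintype E] {k j : ℕ}
  {G : GainedGraph V E (Multiplicative (ZMod k))} {v t h : V} {γ : Multiplicative (ZMod k)}

/-- The edges of `G` not meeting `v`. -/
def awayEdges (G : GainedGraph V E (Multiplicative (ZMod k))) (v : V) : Finset E :=
  Finset.univ.filter fun e => G.tail e ≠ v ∧ G.head e ≠ v

/-- The graph obtained from `G` by deleting `v` and adding an edge. -/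
abbrev reduced (G : GainedGraph V E (Multiplicative (ZMod k))) (v t h : V)
    (γ : Multiplicative (ZMod k)) : Subgraph (extendGraph G t h γ) :=
  reduceAt (extendGraph G t h γ) (extendTop G t h γ) v none

theorem mem_awayEdges {e : E} : e ∈ awayEdges G v ↔ G.tail e ≠ v ∧ G.head e ≠ v := by
  simp [awayEdges]

theorem reduced_edges :
    (reduced G v t h γ).edges = insert none ((awayEdges G v).image some) := by
  ext e
  simp only [reduced, reduceAt, extendTop, Finset.mem_insert, Finset.mem_filter,
    Finset.mem_image, Finset.mem_univ, true_and, mem_awayEdges]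
  refine or_congr_right ?_
  constructor
  · rintro ⟨⟨e, rfl⟩, h'⟩; exact ⟨e, h', rfl⟩
  · rintro ⟨e, h', rfl⟩; exact ⟨⟨e, rfl⟩, h'⟩

theorem card_reduced_edges :
    (reduced G v t h γ).edges.card = (awayEdges G v).card + 1 := by
  rw [reduced_edges, Finset.card_insert_of_notMem (by simp),
    Finset.card_image_of_injective _ (Option.some_injective E)]

theorem image_lab_reduced : (reduced G v t h γ).edges.image (lab (extendGraph G t h γ)) =
    insert (t, h, γ.toAdd) ((awayEdges G v).image (lab G)) := by
  rw [reduced_edges, Finset.image_insert, Finset.image_image]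
  rfl

variable [NeZero k]

/-- If the reduced graph is sparse then it is tight. -/
theorem reduced_tight (hj : 1 ≤ j) (hΦ : G.fixed.card ≤ 1)
    (htight : GainTightKJ G k j (⊤ : Subgraph G)) (hv : v ∉ G.fixed) (htv : t ≠ v) (hhv : h ≠ v)
    (hcard : Fintype.card E = (awayEdges G v).card + 3) {a b : ZMod k}
    (ha : (v, t, a) ∈ Finset.univ.image (lab G) ∨ rev (v, t, a) ∈ Finset.univ.image (lab G))
    (hb : (v, h, b) ∈ Finset.univ.image (lab G) ∨ rev (v, h, b) ∈ Finset.univ.image (lab G))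
    (hγ : γ.toAdd = b - a)
    (hsparse : GainSparseKJ (extendGraph G t h γ) k j (reduced G v t h γ)) :
    GainTightKJ (extendGraph G t h γ) k j (reduced G v t h γ) := by
  have hne : (reduced G v t h γ).edges.Nonempty := by rw [reduced_edges]; simp
  refine ⟨hsparse, le_antisymm (hsparse _ ⟨subset_rfl, subset_rfl⟩ hne) ?_⟩
  set c := reachSet G Finset.univ
  set X := Finset.univ.image (lab G)
  have hcX : ∀ e ∈ X, c e.1 = c e.2.1 := by
    intro l hl
    obtain ⟨e, he, rfl⟩ := Finset.mem_image.1 hl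
    exact reachSet_tail_eq_head he
  have hct : c t = c v := by
    rcases ha with ha | ha
    exacts [(hcX _ ha).symm, hcX _ ha]
  have hch : c h = c v := by
    rcases hb with hb | hb
    exacts [(hcX _ hb).symm, hcX _ hb]
  have hcE : ∀ e ∈ (reduced G v t h γ).edges,
      c ((extendGraph G t h γ).tail e) = c ((extendGraph G t h γ).head e) := by
    rintro (_ | e) -
    · exact hct.trans hch.symm
    · exact reachSet_tail_eq_head (Finset.mem_univ e)
  have hcR : ∀ L x y, IsWalk (extendGraph G t h γ)
      (edgeSpan _ (reduced G v t h γ).edges) L x y → c x = c y := by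
    intro L
    induction L with
    | nil => rintro x y ⟨rfl, -⟩; rfl
    | cons s L ih =>
      rintro x y ⟨h1, rfl, h2⟩
      rw [← ih _ _ h2]
      rcases s with ⟨e, _ | _⟩
      · exact (hcE e h1).symm
      · exact hcE e h1
  have h1 : (Fintype.card E : ℤ) = fCount G k j Finset.univ := htight.2
  rw [fCount_eq hj hΦ] at h1
  change _ = 2 * ((freeEnds G.fixed X).card : ℤ) - dofSum G.fixed j c X at h1
  rw [fCount_eq (G := extendGraph G t h γ) hj hΦ, image_lab_reduced, card_reduced_edges]
  have hY : ∀ e, e ∈ insert (t, h, γ.toAdd) ((awayEdges G v).image (lab G)) ↔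
      (e ∈ X ∧ e.1 ≠ v ∧ e.2.1 ≠ v) ∨ e = (t, h, b - a) := by
    intro e
    rw [Finset.mem_insert, hγ, or_comm]
    refine or_congr_left ?_
    constructor
    · intro he
      obtain ⟨e, he', rfl⟩ := Finset.mem_image.1 he
      exact ⟨Finset.mem_image_of_mem _ (Finset.mem_univ _), mem_awayEdges.1 he'⟩
    · rintro ⟨he, h'⟩
      obtain ⟨e, -, rfl⟩ := Finset.mem_image.1 he
      exact Finset.mem_image_of_mem _ (mem_awayEdges.2 h')
  have h2 := count_reduce (j := j) hcX hv htv hhv ha hb hY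
  have h3 : dofSum G.fixed j c (insert (t, h, γ.toAdd) ((awayEdges G v).image (lab G))) ≤
      dofSum G.fixed j (reachSet (extendGraph G t h γ) (reduced G v t h γ).edges)
        (insert (t, h, γ.toAdd) ((awayEdges G v).image (lab G))) := by
    refine dofSum_le_dofSum fun e he f hf hef => ?_
    rw [← image_lab_reduced] at hf
    obtain ⟨f, hf', rfl⟩ := Finset.mem_image.1 hf
    obtain ⟨L, hL⟩ := (reachSet_eq_iff
      ((edgeSpan (extendGraph G t h γ) _).tail_mem f hf')).1 hef
    exact hcR L _ _ hL
  have h4 : (extendGraph G t h γ).fixed = G.fixed := rfl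
  rw [h4]
  push_cast
  omega

/-- A subgraph blocking a failed 1-reduction. -/
theorem exists_tightFor (hj : 1 ≤ j) (hΦ : G.fixed.card ≤ 1)
    (hG : IsGainGraphOn G (⊤ : Subgraph G))
    (htight : GainTightKJ G k j (⊤ : Subgraph G)) (hv : v ∉ G.fixed) (htv : t ≠ v) (hhv : h ≠ v)
    (hcard : Fintype.card E = (awayEdges G v).card + 3) {a b : ZMod k}
    (ha : (v, t, a) ∈ Finset.univ.image (lab G) ∨ rev (v, t, a) ∈ Finset.univ.image (lab G))
    (hb : (v, h, b) ∈ Finset.univ.image (lab G) ∨ rev (v, h, b) ∈ Finset.univ.image (lab G))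
    (hγ : γ.toAdd = b - a) (hl : t = h → γ ≠ 1 ∧ t ∉ G.fixed)
    (hno : ¬ (IsGainGraphOn (extendGraph G t h γ) (reduced G v t h γ) ∧
      GainTightKJ (extendGraph G t h γ) k j (reduced G v t h γ))) :
    ∃ A, TightFor G.fixed j ((awayEdges G v).image (lab G)) A ∧ (t, h, γ.toAdd) ∈ A := by
  by_contra! hA
  set I := (awayEdges G v).image (lab G)
  set f₀ : LEdge V k := (t, h, γ.toAdd)
  have hf₀ : Good G.fixed f₀ := by
    refine ⟨fun h' h0 => (hl h').1 (toAdd_eq_zero.1 h0), ?_⟩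
    by_contra! h'
    exact (hl (Finset.card_le_one.1 hΦ _ h'.1 _ h'.2)).2 h'.1
  have hcross : ∀ (A : Finset (LEdge V k)) (l : LEdge V k), (∀ e ∈ A, Good G.fixed e) →
      f₀ ∈ A → l ∈ A → l ∈ I → ¬ cnt G.fixed j A ≤ 1 := by
    intro A l hg hf hl hlI hle
    refine hA A ⟨hg, hle.trans ?_⟩ hf
    have := Finset.card_pos.2 ⟨l, Finset.mem_inter.2 ⟨hlI, hl⟩⟩
    omega
  have hedge : ∀ e ∈ (reduced G v t h γ).edges, e = none ∨ ∃ f, e = some f ∧ lab G f ∈ I := by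
    intro e he
    rw [reduced_edges, Finset.mem_insert, Finset.mem_image] at he
    rcases he with rfl | ⟨f, hf, rfl⟩
    exacts [Or.inl rfl, Or.inr ⟨f, rfl, Finset.mem_image_of_mem _ hf⟩]
  have hgoodI : ∀ l ∈ I, Good G.fixed l := by
    intro l hl
    obtain ⟨e, -, rfl⟩ := Finset.mem_image.1 hl
    exact hG.good hΦ (Finset.mem_univ e)
  have hpair : ∀ l ∈ I, l ≠ f₀ ∧ l ≠ rev f₀ := by
    refine fun l hl => ⟨?_, ?_⟩ <;> rintro rfl
    · exact hcross {f₀} f₀ (by simpa using hf₀) (by simp) (by simp) hl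
        (cnt_le_one_of_subset_pair hf₀ (by simp))
    · refine hcross {f₀, rev f₀} (rev f₀) (fun e he => ?_) (by simp) (by simp) hl
        (cnt_le_one_of_subset_pair hf₀ subset_rfl)
      rw [Finset.mem_insert, Finset.mem_singleton] at he
      rcases he with rfl | rfl
      exacts [hf₀, good_rev hf₀]
  have hpar : ∀ l ∈ I, t ∈ G.fixed ∨ h ∈ G.fixed → ({t, h} : Finset V) ≠ {l.1, l.2.1} := by
    intro l hl htf heq
    have hl1 : l.1 = t ∨ l.1 = h := by
      have : l.1 ∈ ({t, h} : Finset V) := by rw [heq]; simp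
      simpa using this
    have hl2 : l.2.1 = t ∨ l.2.1 = h := by
      have : l.2.1 ∈ ({t, h} : Finset V) := by rw [heq]; simp
      simpa using this
    have ht : t = l.1 ∨ t = l.2.1 := by
      have : t ∈ ({l.1, l.2.1} : Finset V) := by rw [← heq]; simp
      simpa using this
    have hh : h = l.1 ∨ h = l.2.1 := by
      have : h ∈ ({l.1, l.2.1} : Finset V) := by rw [← heq]; simp
      simpa using this
    refine hcross {f₀, l} l (fun e he => ?_) (by simp) (by simp) hl ?_
    · rw [Finset.mem_insert, Finset.mem_singleton] at he
      rcases he with rfl | rfl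
      exacts [hf₀, hgoodI _ hl]
    · rcases htf with h' | h'
      · refine cnt_le_one_of_fixed (z := h) h' fun e he => ?_
        rw [Finset.mem_insert, Finset.mem_singleton] at he
        rcases he with rfl | rfl
        · exact Or.inr ⟨rfl, rfl⟩
        · grind
      · refine cnt_le_one_of_fixed (z := t) h' fun e he => ?_
        rw [Finset.mem_insert, Finset.mem_singleton] at he
        rcases he with rfl | rfl
        · exact Or.inl ⟨rfl, rfl⟩
        · grind
  have hR : IsGainGraphOn (extendGraph G t h γ) (reduced G v t h γ) := by
    constructor
    · exact (Finset.card_le_card Finset.inter_subset_right).trans hΦ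
    · intro e he f hf hne h1 h2 h3
      have h' : lab (extendGraph G t h γ) e = lab (extendGraph G t h γ) f := by
        simp only [lab, h1, h2, h3]
      rcases hedge e he with rfl | ⟨e, rfl, he'⟩ <;> rcases hedge f hf with rfl | ⟨f, rfl, hf'⟩
      · exact hne rfl
      · exact (hpair _ hf').1 h'.symm
      · exact (hpair _ he').1 h'
      · exact hne (congrArg some (hG.lab_injOn (Finset.mem_univ e) (Finset.mem_univ f) h'))
    · intro e he f hf hne h1 h2 h3
      have h' : lab (extendGraph G t h γ) e = rev (lab (extendGraph G t h γ) f) := by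
        simp only [lab, rev, h1, h2, h3, toAdd_inv]
      rcases hedge e he with rfl | ⟨e, rfl, he'⟩ <;> rcases hedge f hf with rfl | ⟨f, rfl, hf'⟩
      · exact hne rfl
      · exact (hpair _ hf').2 ((rev_rev (lab G f)).symm.trans (congrArg rev h'.symm))
      · exact (hpair _ he').2 h'
      · exact hne (congrArg some
          (hG.eq_of_lab_eq_rev (Finset.mem_univ e) (Finset.mem_univ f) h'))
    · intro e he h'
      rcases hedge e he with rfl | ⟨e, rfl, -⟩
      · exact (hl h').2
      · exact hG.fixed_not_loop e (Finset.mem_univ e) h'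
    · intro e he f hf hne h1 h2
      rcases hedge e he with rfl | ⟨e, rfl, he'⟩ <;> rcases hedge f hf with rfl | ⟨f, rfl, hf'⟩
      · exact hne rfl
      · exact hpar _ hf' h1 h2
      · refine hpar _ he' ?_ h2.symm
        have ht : G.tail e ∈ ({t, h} : Finset V) := by
          rw [← show ({G.tail e, G.head e} : Finset V) = {t, h} from h2]; simp
        have hh : G.head e ∈ ({t, h} : Finset V) := by
          rw [← show ({G.tail e, G.head e} : Finset V) = {t, h} from h2]; simp
        rw [Finset.mem_insert, Finset.mem_singleton] at ht hh
        have h1 : G.tail e ∈ G.fixed ∨ G.head e ∈ G.fixed := h1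
        grind
      · exact hG.fixed_not_parallel e (Finset.mem_univ e) f (Finset.mem_univ f)
          (fun h' => hne (congrArg some h')) h1 h2
    · intro e he h'
      rcases hedge e he with rfl | ⟨e, rfl, -⟩
      · exact (hl h').1
      · exact hG.loop_gain e (Finset.mem_univ e) h'
  have hsp : ¬ GainSparseKJ (extendGraph G t h γ) k j (reduced G v t h γ) := fun hs =>
    hno ⟨hR, reduced_tight hj hΦ htight hv htv hhv hcard ha hb hγ hs⟩
  unfold GainSparseKJ at hsp
  push Not at hsp
  obtain ⟨H, hH, -, hlt⟩ := hsp
  obtain ⟨X, -, hXH, hXne, hX⟩ := exists_component_of_fCount_lt (G := extendGraph G t h γ) hj hΦ hlt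
  have hXR : X.edges ⊆ (reduced G v t h γ).edges := hXH.trans hH.2
  have hinj : Set.InjOn (lab (extendGraph G t h γ)) X.edges :=
    hR.lab_injOn.mono (Finset.coe_subset.2 hXR)
  have hI : Indep G.fixed j I :=
    (htight.1.indep hj hΦ).mono (Finset.image_subset_image (Finset.subset_univ _))
  have hsubI : (X.edges.erase none).image (lab (extendGraph G t h γ)) ⊆ I := by
    intro l hl
    obtain ⟨e, he, rfl⟩ := Finset.mem_image.1 hl
    obtain ⟨hne, he⟩ := Finset.mem_erase.1 he
    rcases hedge e (hXR he) with rfl | ⟨e, rfl, he'⟩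
    exacts [(hne rfl).elim, he']
  have hfix : (extendGraph G t h γ).fixed = G.fixed := rfl
  rw [hfix] at hX
  by_cases hnone : none ∈ X.edges
  · refine hA (X.edges.image (lab (extendGraph G t h γ))) ⟨fun l hl => ?_, ?_⟩
      (Finset.mem_image_of_mem _ hnone)
    · obtain ⟨e, he, rfl⟩ := Finset.mem_image.1 hl
      exact hR.good hΦ (hXR he)
    · have h1 := Finset.card_le_card (Finset.subset_inter hsubI
        (Finset.image_subset_image (f := lab (extendGraph G t h γ))
          (Finset.erase_subset none X.edges)))
      rw [Finset.card_image_of_injOn (hinj.mono (Finset.coe_subset.2 (Finset.erase_subset _ _))),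
        Finset.card_erase_of_mem hnone] at h1
      have := Finset.card_pos.2 hXne
      omega
  · rw [Finset.erase_eq_of_notMem hnone] at hsubI
    have h1 := hI _ hsubI (hXne.image _)
    rw [Finset.card_image_of_injOn hinj] at h1
    omega

end OneReduction

section CubicVertex

variable {V E : Type} [DecidableEq V] [DecidableEq E] [Fintype V] [Fintype E] {k j : ℕ}
  {G : GainedGraph V E (Multiplicative (ZMod k))} {v : V}

theorem card_edges_at (hdeg : degree G (⊤ : Subgraph G) v = 3)
    (hloop : ¬ HasLoopAt G (⊤ : Subgraph G) v) :
    (Finset.univ.filter fun e => G.tail e = v ∨ G.head e = v).card = 3 := by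
  rw [Finset.filter_or, Finset.card_union_of_disjoint]
  · exact hdeg
  · rw [Finset.disjoint_filter]
    exact fun e he h h' => hloop ⟨e, he, h, h'⟩

theorem card_eq_card_awayEdges_add (hdeg : degree G (⊤ : Subgraph G) v = 3)
    (hloop : ¬ HasLoopAt G (⊤ : Subgraph G) v) :
    Fintype.card E = (awayEdges G v).card + 3 := by
  rw [← card_edges_at hdeg hloop, ← Finset.card_univ, add_comm,
    ← Finset.card_filter_add_card_filter_not (s := Finset.univ)
      (fun e => G.tail e = v ∨ G.head e = v)]
  simp only [awayEdges, not_or, ne_eq]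

/-- The edges at a vertex of degree three, oriented away from it. -/
theorem exists_steps (hdeg : degree G (⊤ : Subgraph G) v = 3)
    (hloop : ¬ HasLoopAt G (⊤ : Subgraph G) v) :
    ∃ (e : Fin 3 → E) (b : Fin 3 → Bool), Function.Injective e ∧
      (∀ i, stepStart G (e i, b i) = v) ∧ ∀ f, G.tail f = v ∨ G.head f = v → ∃ i, e i = f := by
  set φ := Finset.equivFinOfCardEq (card_edges_at hdeg hloop)
  refine ⟨fun i => φ.symm i, fun i => decide (G.tail (φ.symm i) = v),
    Subtype.val_injective.comp φ.symm.injective, fun i => ?_, fun f hf => ?_⟩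
  · have := (Finset.mem_filter.1 (φ.symm i).2).2
    by_cases h : G.tail (φ.symm i) = v
    · simp [stepStart, h]
    · simpa [stepStart, h] using this
  · exact ⟨φ ⟨f, Finset.mem_filter.2 ⟨Finset.mem_univ f, hf⟩⟩, by simp⟩

theorem lab_eq_or_of_stepStart {e : E} {b : Bool} (h : stepStart G (e, b) = v) :
    lab G e = (v, stepEnd G (e, b), (stepGain G (e, b)).toAdd) ∨
      lab G e = rev (v, stepEnd G (e, b), (stepGain G (e, b)).toAdd) := by
  subst h
  cases b
  · exact Or.inr ((stepLab_true e).symm.trans (stepLab_not e false))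
  · exact Or.inl rfl

theorem neighbors_eq_image {e : Fin 3 → E} {b : Fin 3 → Bool}
    (hb : ∀ i, stepStart G (e i, b i) = v)
    (hloop : ¬ HasLoopAt G (⊤ : Subgraph G) v)
    (hcov : ∀ f, G.tail f = v ∨ G.head f = v → ∃ i, e i = f) :
    neighbors G (⊤ : Subgraph G) v = Finset.univ.image fun i => stepEnd G (e i, b i) := by
  have hl : ∀ f, ¬ (G.tail f = v ∧ G.head f = v) := fun f hf => hloop ⟨f, Finset.mem_univ f, hf⟩
  ext w
  simp only [neighbors, Finset.mem_union, Finset.mem_image, Finset.mem_filter, Finset.mem_univ,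
    true_and]
  constructor
  · rintro (⟨f, ⟨-, hf⟩, rfl⟩ | ⟨f, ⟨-, hf⟩, rfl⟩)
    · obtain ⟨i, rfl⟩ := hcov f (Or.inl hf)
      refine ⟨i, ?_⟩
      have := hb i
      cases hbi : b i <;> rw [hbi] at this
      · exact (hl _ ⟨hf, this⟩).elim
      · rfl
    · obtain ⟨i, rfl⟩ := hcov f (Or.inr hf)
      refine ⟨i, ?_⟩
      have := hb i
      cases hbi : b i <;> rw [hbi] at this
      · rfl
      · exact (hl _ ⟨this, hf⟩).elim
  · rintro ⟨i, rfl⟩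
    have := hb i
    cases hbi : b i <;> rw [hbi] at this
    · exact Or.inr ⟨e i, ⟨Finset.mem_univ _, this⟩, rfl⟩
    · exact Or.inl ⟨e i, ⟨Finset.mem_univ _, this⟩, rfl⟩

variable [NeZero k]

theorem exists_star (hj : 1 ≤ j) (hΦ : G.fixed.card ≤ 1)
    (hG : IsGainGraphOn G (⊤ : Subgraph G))
    (htight : GainTightKJ G k j (⊤ : Subgraph G)) (hv : v ∉ G.fixed)
    (hloop : ¬ HasLoopAt G (⊤ : Subgraph G) v)
    (hno : ¬ AdmissibleOneReductionExists G k j v)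
    (hcard : Fintype.card E = (awayEdges G v).card + 3) {e : Fin 3 → E} {b : Fin 3 → Bool}
    (he : Function.Injective e) (hb : ∀ i, stepStart G (e i, b i) = v) :
    ∃ I S K, Star G.fixed j I S K v (fun i => stepEnd G (e i, b i))
      (fun i => (stepGain G (e i, b i)).toAdd) := by
  have hne : ∀ i, stepEnd G (e i, b i) ≠ v := by
    intro i hi
    have h := hb i
    refine hloop ⟨e i, Finset.mem_univ _, ?_⟩
    cases hbi : b i <;> rw [hbi] at h hi
    exacts [⟨hi, h⟩, ⟨h, hi⟩]
  have hlab := fun i => lab_eq_or_of_stepStart (hb i)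
  have hends : ∀ i, ({G.tail (e i), G.head (e i)} : Finset V) = {v, stepEnd G (e i, b i)} := by
    intro i
    rcases hlab i with h | h <;> simp only [lab, rev, Prod.mk.injEq] at h
    · rw [h.1, h.2.1]
    · rw [h.1, h.2.1, Finset.pair_comm]
  have hgain : ∀ i i', i ≠ i' → stepEnd G (e i, b i) = stepEnd G (e i', b i') →
      (stepGain G (e i, b i)).toAdd ≠ (stepGain G (e i', b i')).toAdd := by
    intro i i' hi hx hg
    refine hi (he (hG.eq_of_stepLab_eq (b := b i) (c := b i') (Finset.mem_univ _)
      (Finset.mem_univ _) ?_))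
    rw [stepLab, stepLab, hb, hb, hx, hg]
  have hpar : ∀ i i', i ≠ i' → stepEnd G (e i, b i) = stepEnd G (e i', b i') →
      stepEnd G (e i, b i) ∉ G.fixed := by
    intro i i' hi hx hf
    refine hG.fixed_not_parallel (e i) (Finset.mem_univ _) (e i') (Finset.mem_univ _)
      (he.ne hi) ?_ (by rw [hends, hends, hx])
    have : stepEnd G (e i, b i) ∈ ({G.tail (e i), G.head (e i)} : Finset V) := by
      rw [hends]; simp
    rw [Finset.mem_insert, Finset.mem_singleton] at this
    rcases this with h | h <;> rw [h] at hf
    exacts [Or.inl hf, Or.inr hf]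
  have hmem : ∀ i, (v, stepEnd G (e i, b i), (stepGain G (e i, b i)).toAdd) ∈
      Finset.univ.image (lab G) ∨ rev (v, stepEnd G (e i, b i), (stepGain G (e i, b i)).toAdd) ∈
      Finset.univ.image (lab G) := by
    intro i
    have h := Finset.mem_image_of_mem (lab G) (Finset.mem_univ (e i))
    rcases hlab i with h' | h' <;> rw [h'] at h
    exacts [Or.inl h, Or.inr h]
  have hat : ∀ i, lab G (e i) ∉ (awayEdges G v).image (lab G) := by
    intro i h
    obtain ⟨f, hf, hfi⟩ := Finset.mem_image.1 h
    rw [mem_awayEdges] at hf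
    have hv' : v ∈ ({G.tail (e i), G.head (e i)} : Finset V) := by rw [hends]; simp
    rw [← hG.lab_injOn (Finset.mem_univ f) (Finset.mem_univ (e i)) hfi, Finset.mem_insert,
      Finset.mem_singleton] at hv'
    exact hv'.elim (fun h => hf.1 h.symm) fun h => hf.2 h.symm
  refine ⟨(awayEdges G v).image (lab G), Finset.univ.image fun i => lab G (e i),
    (Finset.univ.image fun i => lab G (e i)) ∪
      (Finset.univ.filter fun p : Fin 3 × Fin 3 => p.1 ≠ p.2).image fun p =>
        (stepEnd G (e p.1, b p.1), stepEnd G (e p.2, b p.2),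
          (stepGain G (e p.2, b p.2)).toAdd - (stepGain G (e p.1, b p.1)).toAdd), ?_⟩
  refine ⟨?_, ?_, ?_, Finset.subset_union_left, ?_, ?_, ?_, hv, hne, hgain, hpar, hΦ⟩
  · refine (htight.1.indep hj hΦ).mono (Finset.union_subset ?_
      (Finset.image_subset_image (Finset.subset_univ _)))
    intro l hl
    obtain ⟨i, -, rfl⟩ := Finset.mem_image.1 hl
    exact Finset.mem_image_of_mem _ (Finset.mem_univ _)
  · rw [Finset.disjoint_left]
    intro l hl
    obtain ⟨i, -, rfl⟩ := Finset.mem_image.1 hl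
    exact hat i
  · rw [Finset.card_image_of_injective, Finset.card_univ, Fintype.card_fin]
    exact fun i i' h => he (hG.lab_injOn (Finset.mem_univ _) (Finset.mem_univ _) h)
  · intro i i' hi
    refine exists_tightFor (γ := (stepGain G (e i, b i))⁻¹ * stepGain G (e i', b i')) hj hΦ hG
      htight hv (hne i) (hne i') hcard (hmem i) (hmem i')
      (by rw [toAdd_mul, toAdd_inv]; ring) ?_ ?_
      |>.imp fun A hA => ⟨hA.1, ?_⟩
    · refine fun hx => ⟨fun h1 => hgain i i' hi hx ?_, hpar i i' hi hx⟩
      rw [inv_mul_eq_one.1 h1]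
    · refine fun h => hno ⟨_, _, _, ⟨?_, hne i, hne i', (some (e i), !b i), (some (e i'), b i'),
        ?_, ?_, ?_, ?_, hb i', ?_, rfl, ?_⟩, h.1, h.2⟩
      · simp [extendTop]
      · exact Finset.mem_image_of_mem _ (Finset.mem_univ _)
      · exact Finset.mem_image_of_mem _ (Finset.mem_univ _)
      · exact fun h' => hi (he (Option.some_injective _ h'))
      · exact (stepEnd_not _ _).trans (hb i)
      · exact (stepStart_not _ _).symm
      · rw [stepGain_not]; rfl
    · have := hA.2
      rw [toAdd_mul, toAdd_inv] at this
      convert this using 3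
      ring
  · intro i i' hi
    exact Finset.mem_union_right _ (Finset.mem_image_of_mem (a := (i, i')) _
      (Finset.mem_filter.2 ⟨Finset.mem_univ _, hi⟩))
  · intro l hl
    rcases Finset.mem_union.1 hl with hl | hl
    · obtain ⟨i, -, rfl⟩ := Finset.mem_image.1 hl
      exact Or.inl ⟨i, hlab i⟩
    · obtain ⟨⟨i, i'⟩, hi, rfl⟩ := Finset.mem_image.1 hl
      exact Or.inr ⟨i, i', (Finset.mem_filter.1 hi).2, rfl⟩

end CubicVertex

/-- Let `(G,ψ)` be a `ℤ_k^j`-gain tight `Γ`-gain graph (`Γ ≅ ℤ_k`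
generated by `γ`, `2 ≤ j ≤ k−2`) with a free vertex `v` of degree `3` and no loop.  If
there is no admissible 1-reduction at `v`, then `k` is even, `j` is odd, `v` has exactly
two distinct neighbours of which exactly one, `v₁`, is free, and the 2-cycle formed by
the two edges between `v` and `v₁` has gain `γ^{k/2}`. -/
theorem no_admissible_one_reduction_structure {V E : Type}
    [DecidableEq V] [DecidableEq E] [Fintype V] [Fintype E]
    (k j : ℕ) (hk : 4 ≤ k) (hj2 : 2 ≤ j) (hjk : j ≤ k - 2)
    (G : GainedGraph V E (Multiplicative (ZMod k)))
    (hG : IsGainGraphOn G (⊤ : Subgraph G))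
    (htight : GainTightKJ G k j (⊤ : Subgraph G))
    (v : V) (hvfree : v ∉ G.fixed)
    (hdeg : degree G (⊤ : Subgraph G) v = 3)
    (hloop : ¬ HasLoopAt G (⊤ : Subgraph G) v)
    (hno : ¬ AdmissibleOneReductionExists G k j v) :
    Even k ∧ Odd j ∧
      ∃ v₁ u : V, v₁ ≠ u ∧ v₁ ∉ G.fixed ∧ u ∈ G.fixed ∧
        neighbors G (⊤ : Subgraph G) v = {v₁, u} ∧
        ∃ e e' : E, e ≠ e' ∧ ∃ b b' : Bool,
          stepStart G (e, b) = v ∧ stepEnd G (e, b) = v₁ ∧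
          stepStart G (e', b') = v₁ ∧ stepEnd G (e', b') = v ∧
          stepGain G (e, b) * stepGain G (e', b') =
            Multiplicative.ofAdd ((k / 2 : ℕ) : ZMod k) := by
  have : NeZero k := ⟨by omega⟩
  have hj : 1 ≤ j := by omega
  have hΦ : G.fixed.card ≤ 1 := by
    have h := hG.fixed_card
    rwa [show (⊤ : Subgraph G).fixedVerts = G.fixed from Finset.univ_inter _] at h
  obtain ⟨e, b, he, hb, hcov⟩ := exists_steps hdeg hloop
  obtain ⟨I, S, K, h⟩ := exists_star hj hΦ hG htight hvfree hloop hno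
    (card_eq_card_awayEdges_add hdeg hloop) he hb
  obtain ⟨p, q, r, hpq, hall, hx, hne, hp, hr, hk2, hj', hg⟩ := h.conclusion
  refine ⟨hk2, hj', stepEnd G (e p, b p), stepEnd G (e r, b r), hne, hp, hr, ?_, e q, e p,
    he.ne hpq.symm, b q, !b p, hb q, hx.symm, stepStart_not _ _, (stepEnd_not _ _).trans (hb p), ?_⟩
  · rw [neighbors_eq_image hb hloop hcov]
    ext w
    simp only [Finset.mem_image, Finset.mem_univ, true_and, Finset.mem_insert,
      Finset.mem_singleton]
    constructor
    · rintro ⟨i, rfl⟩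
      rcases hall i with rfl | rfl | rfl
      exacts [Or.inl rfl, Or.inl hx.symm, Or.inr rfl]
    · rintro (rfl | rfl)
      exacts [⟨p, rfl⟩, ⟨r, rfl⟩]
  · rw [stepGain_not, ← hg, sub_eq_add_neg]
    rfl

end GR
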